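/- arXiv:1408.2667 — 2 statements merged into one kernel-verified Lean document; each statement's English description precedes it below -/
import Mathlib

section
/- Let X be a Peano space (compact, locally connected, metric space) that contains arbitrarily small circles, i.e., for every ε > 0 there is a topological embedding ι : S¹ → X with diam(ι(S¹)) < ε. Then X is not an absolute neighborhood retract of dimension at most one. Conversely, if X is a Peano space containing no arbitrarily small circles (there is ε > 0 with diam(ι(S¹)) ≥ ε for every embedding ι : S¹ → X), then X is an ANR of covering dimension at most 1. -/
/-- A compact metric space `X` is an absolute neighborhood retract (ANR) if
every continuous map into `X` from a closed subspace `Z` of a compact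
metrizable space `Y` extends to a closed neighborhood of `Z` in `Y`. -/
def IsANRSpace (X : Type) [TopologicalSpace X] : Prop :=
  ∀ (Y : Type) (_ : TopologicalSpace Y), CompactSpace Y →
    TopologicalSpace.MetrizableSpace Y →
    ∀ Z : Set Y, IsClosed Z → ∀ f : C(Z, X),
      ∃ (V : Set Y) (hZV : Z ⊆ V), IsClosed V ∧ Z ⊆ interior V ∧
        ∃ g : C(V, X), ∀ (z : Y) (hz : z ∈ Z), g ⟨z, hZV hz⟩ = f ⟨z, hz⟩

/-- Covering dimension at most `n`: every open cover admits an open refinement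
in which each point lies in at most `n + 1` members. -/
def CovDimLE (X : Type*) [TopologicalSpace X] (n : ℕ) : Prop :=
  ∀ U : Set (Set X), (∀ u ∈ U, IsOpen u) → ⋃₀ U = Set.univ →
    ∃ V : Set (Set X), (∀ v ∈ V, IsOpen v) ∧ ⋃₀ V = Set.univ ∧
      (∀ v ∈ V, ∃ u ∈ U, v ⊆ u) ∧
      ∀ x : X, {v ∈ V | x ∈ v}.Finite ∧ {v ∈ V | x ∈ v}.ncard ≤ n + 1

section WardProof
open Set Filter Topology Metric

theorem no_retraction_circle (R : ℂ → Circle) (hR : Continuous R)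
    (h : ∀ z : Circle, R z = z) : False := by
  obtain ⟨F, ⟨-, hF⟩, -⟩ := Circle.isCoveringMap_exp.existsUnique_continuousMap_lifts
    (⟨R, hR⟩ : C(ℂ, Circle)) ((Circle.exp 0 : Circle) : ℂ) 0 (by have := h 1; simp at this; simp [this])
  have hF' : ∀ z, Circle.exp (F z) = R z := fun z => congrFun hF z
  have key : (fun t : ℝ => F (Circle.exp t : ℂ)) = fun t => t + F (Circle.exp 0 : ℂ) := by
    refine Circle.isCoveringMap_exp.eq_of_comp_eq (by fun_prop) (by fun_prop) ?_ 0 (by simp)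
    funext t
    simp only [Function.comp, hF', h, Circle.exp_add]
    simp
  have := congrFun key (2 * Real.pi)
  simp only [Circle.exp_two_pi, Circle.exp_zero] at this
  linarith [Real.pi_pos]

/-- generic perturbation -/
theorem exists_generic {ι : Type*} [DecidableEq ι] (s : Finset ι) (F : ι → ℂ) (δ : ℝ) (hδ : 0 < δ) :
    ∃ c : ι → ℂ, (∀ i ∈ s, ‖c i - F i‖ < δ ∧ c i ≠ 0) ∧
      ∀ i ∈ s, ∀ j ∈ s, i ≠ j → ∀ a b : ℝ, 0 ≤ a → 0 ≤ b → (a : ℂ) * c i + b * c j = 0 →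
        a = 0 ∧ b = 0 := by
  induction s using Finset.induction_on with
  | empty => exact ⟨fun _ => 1, by simp, by simp⟩
  | insert i s hi ih =>
    obtain ⟨c, hc1, hc2⟩ := ih
    have hdense : Dense (⋂ j ∈ (s : Set ι), {z : ℂ | (z * (starRingEnd ℂ) (c j)).im ≠ 0} ) := by
      refine dense_biInter_of_isOpen ?_ s.countable_toSet ?_
      · intro j hj
        exact isOpen_ne_fun (by fun_prop) (by fun_prop)
      · intro j hj
        have hcj : c j ≠ 0 := (hc1 j hj).2
        rw [Metric.dense_iff]
        intro z r hr
        by_cases hz : (z * (starRingEnd ℂ) (c j)).im = 0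
        · refine ⟨z + ((r / 2 / ‖c j‖ : ℝ) : ℂ) * (Complex.I * c j), ?_, ?_⟩
          · have hn : ‖c j‖ ≠ 0 := by simpa using hcj
            rw [Metric.mem_ball, dist_eq_norm]
            simp only [add_sub_cancel_left, norm_mul, Complex.norm_real, Complex.norm_I, one_mul]
            rw [Real.norm_of_nonneg (by positivity)]
            field_simp; linarith
          · have hn : 0 < ‖c j‖ := by simpa using hcj
            show _ ≠ _
            rw [add_mul, Complex.add_im, hz, mul_assoc, mul_assoc, Complex.mul_conj]
            have : 0 < Complex.normSq (c j) := by simpa [Complex.normSq_pos] using hcj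
            rw [zero_add, Complex.im_ofReal_mul, Complex.I_mul_im, Complex.ofReal_re]
            positivity
        · exact ⟨z, mem_ball_self hr, hz⟩
    have hdense2 := hdense.inter_of_isOpen_right (dense_compl_singleton (0:ℂ)) isOpen_compl_singleton
    obtain ⟨z, hz1, hz2⟩ := Metric.dense_iff.1 hdense2 (F i) δ hδ
    simp only [mem_inter_iff, mem_iInter] at hz2
    obtain ⟨hz2, hz3⟩ := hz2
    have hz0 : z ≠ 0 := hz3
    refine ⟨fun j => if j = i then z else c j, ?_, ?_⟩
    · intro j hj
      by_cases hji : j = i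
      · subst hji
        simpa [hz0, ← dist_eq_norm] using hz1
      · simpa [hji] using hc1 j (Finset.mem_of_mem_insert_of_ne hj hji)
    · have aux : ∀ j ∈ s, ∀ a b : ℝ, (a : ℂ) * z + b * c j = 0 → a = 0 ∧ b = 0 := by
        intro j hj a b hab
        have hcj := (hc1 j hj).2
        have h1 : (z * (starRingEnd ℂ) (c j)).im ≠ 0 := hz2 j hj
        have h2 : ((a : ℂ) * z + b * c j) * (starRingEnd ℂ) (c j) = 0 := by rw [hab, zero_mul]
        rw [add_mul, mul_assoc, mul_assoc, Complex.mul_conj] at h2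
        have h3 := congrArg Complex.im h2
        rw [Complex.add_im, Complex.im_ofReal_mul, Complex.im_ofReal_mul] at h3
        simp only [Complex.ofReal_im, mul_zero, add_zero, Complex.zero_im] at h3
        have ha : a = 0 := by
          rcases mul_eq_zero.1 h3 with h | h
          · exact h
          · exact absurd h h1
        subst ha
        simpa [hcj] using hab
      intro j hj k hk hjk a b ha hb hab
      by_cases hji : j = i
      · have hki : k ≠ i := fun h => hjk (hji.trans h.symm)
        simp only [hji, hki, if_true, if_false] at hab
        exact aux k (Finset.mem_of_mem_insert_of_ne hk hki) a b hab
      · by_cases hki : k = i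
        · simp only [hji, hki, if_true, if_false] at hab
          exact (aux j (Finset.mem_of_mem_insert_of_ne hj hji) b a (by rw [add_comm]; exact hab)).symm
        · simp only [hji, hki, if_false] at hab
          exact hc2 j (Finset.mem_of_mem_insert_of_ne hj hji) k
            (Finset.mem_of_mem_insert_of_ne hk hki) hjk a b ha hb hab

theorem dim_one_extend {X : Type*} [MetricSpace X] [CompactSpace X] (hX : CovDimLE X 1)
    (A : Set X) (hA : IsClosed A) (f : C(A, ℂ)) (hf : ∀ a, ‖f a‖ = 1) :
    ∃ r : C(X, ℂ), (∀ x, ‖r x‖ = 1) ∧ ∀ a : A, r a = f a := by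
  classical
  obtain ⟨F, hF⟩ : ∃ F : C(X, ℂ), F.restrict A = f := ContinuousMap.exists_restrict_eq hA f
  have hF' : ∀ a : A, F a = f a := fun a => by rw [← hF]; rfl
  obtain ⟨V, hVo, hVc, hVr, hVm⟩ := hX {u | ∃ x, u = F ⁻¹' ball (F x) (1/4)}
    (by rintro u ⟨x, rfl⟩; exact isOpen_ball.preimage F.continuous)
    (by
      refine eq_univ_of_forall fun x => mem_sUnion.2 ⟨_, ⟨x, rfl⟩, ?_⟩
      simp)
  obtain ⟨T', hTV, hTf, hTc⟩ := isCompact_univ.elim_finite_subcover_image (c := id) hVo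
    (by rw [← hVc, sUnion_eq_biUnion]; exact subset_rfl)
  have : Fintype T' := hTf.fintype
  obtain ⟨φ, hφ⟩ := PartitionOfUnity.exists_isSubordinate (X := X) (s := univ) isClosed_univ
    (fun v : T' => (v : Set X)) (fun v => hVo _ (hTV v.2)) (by
      intro x hx
      obtain ⟨v, hv, hxv⟩ := mem_iUnion₂.1 (hTc hx)
      exact mem_iUnion.2 ⟨⟨v, hv⟩, hxv⟩)
  have hmem : ∀ (v : T') x, φ v x ≠ 0 → x ∈ (v : Set X) := fun v x h =>
    hφ v (subset_tsupport _ h)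
  have hsum : ∀ x, ∑ v, φ v x = 1 := fun x => by
    rw [← finsum_eq_sum_of_fintype]; exact φ.sum_eq_one (mem_univ x)
  have hx : ∀ v : T', ∃ x, (v : Set X) ⊆ F ⁻¹' ball (F x) (1/4) := by
    intro v
    obtain ⟨u, ⟨x, rfl⟩, h⟩ := hVr v (hTV v.2)
    exact ⟨x, h⟩
  choose ξ hξ using hx
  obtain ⟨c, hc1, hc2⟩ := exists_generic (Finset.univ : Finset T') (fun v => F (ξ v)) (1/4) (by norm_num)
  let G : X → ℂ := fun x => ∑ v, (φ v x : ℂ) * c v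
  have hGc : Continuous G := by
    refine continuous_finsetSum _ fun v _ => ?_
    exact (Complex.continuous_ofReal.comp (φ v).continuous).mul continuous_const
  have hG0 : ∀ x, G x ≠ 0 := by
    intro x h0
    obtain ⟨v, hv⟩ : ∃ v, φ v x ≠ 0 := by
      by_contra! h
      simpa [h] using hsum x
    by_cases hw : ∃ w, w ≠ v ∧ φ w x ≠ 0
    · obtain ⟨w, hwv, hw⟩ := hw
      have hoth : ∀ u, u ≠ v ∧ u ≠ w → φ u x = 0 := by
        rintro u ⟨huv, huw⟩
        by_contra hu
        have h3 : ({(v : Set X), (w : Set X), (u : Set X)} : Set (Set X)) ⊆ {v ∈ V | x ∈ v} := by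
          rintro y (rfl | rfl | rfl)
          · exact ⟨hTV v.2, hmem v x hv⟩
          · exact ⟨hTV w.2, hmem w x hw⟩
          · exact ⟨hTV u.2, hmem u x hu⟩
        have h4 := ncard_le_ncard h3 (hVm x).1
        rw [ncard_eq_three.2 ⟨(v : Set X), w, u, fun h => hwv (Subtype.ext h.symm),
          fun h => huv (Subtype.ext h.symm), fun h => huw (Subtype.ext h.symm), rfl⟩] at h4
        have := (hVm x).2
        omega
      have : G x = (φ v x : ℂ) * c v + φ w x * c w := by
        refine Finset.sum_eq_add v w hwv.symm (fun u _ hu => by simp [hoth u hu]) ?_ ?_ <;> simp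
      rw [this] at h0
      exact hv (hc2 v (Finset.mem_univ _) w (Finset.mem_univ _) hwv.symm _ _ (φ.nonneg _ _)
        (φ.nonneg _ _) h0).1
    · push Not at hw
      have : G x = (φ v x : ℂ) * c v := by
        refine Finset.sum_eq_single v (fun u _ hu => by simp [hw u hu]) (by simp)
      rw [this] at h0
      simp [hv, (hc1 v (Finset.mem_univ _)).2] at h0
  have hclose : ∀ x, ‖G x - F x‖ < 1 := by
    intro x
    have h1 : G x - F x = ∑ v, (φ v x : ℂ) * (c v - F x) := by
      have : (∑ v, (φ v x : ℂ)) = 1 := by exact_mod_cast hsum x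
      simp only [mul_sub, Finset.sum_sub_distrib, ← Finset.sum_mul, this, one_mul, G]
    have h2 : ‖G x - F x‖ ≤ ∑ v, φ v x * (1/2) := by
      rw [h1]
      refine norm_sum_le_of_le _ fun v _ => ?_
      rw [norm_mul, Complex.norm_real, Real.norm_of_nonneg (φ.nonneg _ _)]
      by_cases h : φ v x = 0
      · simp [h]
      · refine mul_le_mul_of_nonneg_left ?_ (φ.nonneg _ _)
        have h3 : dist (F x) (F (ξ v)) < 1/4 := hξ v (hmem v x h)
        have h4 := (hc1 v (Finset.mem_univ _)).1
        rw [← dist_eq_norm] at h4 ⊢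
        have := dist_triangle_right (c v) (F x) (F (ξ v))
        linarith
    rw [← Finset.sum_mul, hsum] at h2
    linarith
  have hslit : ∀ a : A, f a / G a ∈ Complex.slitPlane := by
    intro a
    have h1 : ‖G a / f a - 1‖ < 1 := by
      have hfa : f a ≠ 0 := fun h => by simpa [h] using hf a
      rw [show G a / f a - 1 = (G a - f a) / f a by field_simp, norm_div, hf, div_one, ← hF' a]
      exact hclose a
    have h2 : 0 < (G a / f a).re := by
      have := Complex.abs_re_le_norm (G a / f a - 1)
      have := abs_lt.1 (this.trans_lt h1)
      simp only [Complex.sub_re, Complex.one_re] at this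
      linarith
    have h3 : 0 < ((G a / f a)⁻¹).re := by
      rw [Complex.inv_re]
      have : G a / f a ≠ 0 := by intro h; simp [h] at h2
      have := Complex.normSq_pos.2 this
      positivity
    rw [inv_div] at h3
    exact Or.inl h3
  let θ : C(A, ℝ) := ⟨fun a => (f a / G a).arg, by
    rw [continuous_iff_continuousAt]
    intro a
    exact (Complex.continuousAt_arg (hslit a)).comp
      (f := fun a : A => f a / G a) ((f.continuous.continuousAt).div (hGc.comp continuous_subtype_val).continuousAt (hG0 a))⟩
  obtain ⟨Θ, hΘ⟩ := ContinuousMap.exists_restrict_eq hA θ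
  have hΘ' : ∀ a : A, Θ a = (f a / G a).arg := fun a => congrFun (congrArg DFunLike.coe hΘ) a
  refine ⟨⟨fun x => G x / ‖G x‖ * Complex.exp (Θ x * Complex.I), ?_⟩, ?_, ?_⟩
  · refine Continuous.mul (hGc.div (by fun_prop) fun x => by simpa using hG0 x) (by fun_prop)
  · intro x
    simp [Complex.norm_exp_ofReal_mul_I, hG0 x]
  · intro a
    have hfa : f a ≠ 0 := fun h => by simpa [h] using hf a
    have h1 := Complex.norm_mul_exp_arg_mul_I (f a / G a)
    have h2 : ‖f a / G a‖ = ‖G a‖⁻¹ := by rw [norm_div, hf, one_div]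
    rw [h2] at h1
    have h3 : (‖G a‖ : ℂ) ≠ 0 := by simpa using hG0 a
    have h4 := hG0 a
    simp only [ContinuousMap.coe_mk, hΘ']
    push_cast at h1
    calc _ = G a * ((‖G a‖ : ℂ)⁻¹ * Complex.exp ((f a / G a).arg * Complex.I)) := by ring
      _ = _ := by rw [h1]; field_simp

theorem small_circle_disc {X : Type} [MetricSpace X] [CompactSpace X] (hX : IsANRSpace X)
    (h : ∀ ε > (0 : ℝ), ∃ ι : Circle → X, Topology.IsEmbedding ι ∧ Metric.diam (Set.range ι) < ε) :
    ∃ ι : Circle → X, IsEmbedding ι ∧ ∃ e : C(closedBall (0:ℂ) 1, X),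
      ∀ z : Circle, e ⟨z, by simp [Circle.norm_coe]⟩ = ι z := by
  have hpos : ∀ n : ℕ, (0:ℝ) < 1 / ((n:ℝ) + 1) := fun n => by positivity
  choose ι0 hι0 hd0 using fun n : ℕ => h (1 / ((n:ℝ) + 1)) (hpos n)
  obtain ⟨p, σ, hσ, hp⟩ := CompactSpace.tendsto_subseq (fun n => ι0 n 1)
  let ι : ℕ → Circle → X := fun n => ι0 (σ n)
  have hι : ∀ n, IsEmbedding (ι n) := fun n => hι0 _
  have hclose : ∀ ε > (0:ℝ), ∃ N : ℕ, ∀ n ≥ N, ∀ z, dist (ι n z) p < ε := by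
    intro ε hε
    have h1 : Tendsto (fun n : ℕ => 1 / ((n:ℝ) + 1)) atTop (𝓝 0) := tendsto_one_div_add_atTop_nhds_zero_nat
    have h2 : ∀ᶠ n : ℕ in atTop, 1 / ((n:ℝ) + 1) < ε / 2 := h1.eventually_lt_const (by positivity)
    have h3 : ∀ᶠ n in atTop, dist (ι0 (σ n) 1) p < ε / 2 := Metric.tendsto_nhds.1 hp _ (by positivity)
    obtain ⟨N, hN⟩ := eventually_atTop.1 (h2.and h3)
    refine ⟨N, fun n hn z => ?_⟩
    obtain ⟨h4, h5⟩ := hN n hn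
    have h6 : dist (ι n z) (ι n 1) ≤ diam (range (ι n)) :=
      dist_le_diam_of_mem (isCompact_range (hι n).continuous).isBounded (mem_range_self _) (mem_range_self _)
    have h7 : diam (range (ι n)) < 1 / ((σ n : ℝ) + 1) := hd0 _
    have h8 : 1 / ((σ n : ℝ) + 1) ≤ 1 / ((n:ℝ) + 1) := by
      have : (n:ℝ) ≤ σ n := by exact_mod_cast hσ.id_le n
      gcongr
    have h9 := dist_triangle (ι n z) (ι n 1) p
    have h10 : dist (ι n 1) p < ε / 2 := h5
    linarith
  classical
  let u : ℂ → Circle := fun z => if h : ‖z‖ = 1 then ⟨z, by simpa [Submonoid.unitSphere] using h⟩ else 1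
  have hu : ∀ z : Circle, u z = z := by
    intro z; exact Subtype.ext (by simp [u, Circle.norm_coe])
  have hu2 : ∀ z : ℂ, ‖z‖ = 1 → (u z : ℂ) = z := by
    intro z hz; simp [u, hz]
  have huc : ContinuousOn u {z | ‖z‖ = 1} := by
    have hemb : IsEmbedding (fun z : Circle => (z : ℂ)) := IsEmbedding.subtypeVal
    rw [hemb.continuousOn_iff]
    exact continuousOn_id.congr fun z hz => hu2 z hz
  have : CompactSpace (closedBall (0:ℂ) 1) := isCompact_iff_compactSpace.1 (isCompact_closedBall _ _)
  let Z : Set (ℕ∞ × closedBall (0:ℂ) 1) := {y | y.1 = ⊤ ∨ ‖(y.2 : ℂ)‖ = 1}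
  have hZ : IsClosed Z := by
    refine IsClosed.union (isClosed_eq continuous_fst continuous_const)
      (isClosed_eq (by fun_prop) continuous_const)
  let f0 : ℕ∞ × closedBall (0:ℂ) 1 → X := fun y => if y.1 = ⊤ then p else ι y.1.toNat (u y.2)
  have hf0 : ContinuousOn f0 Z := by
    rintro ⟨n, d⟩ hnd
    by_cases hn : n = ⊤
    · subst hn
      refine ContinuousAt.continuousWithinAt ?_
      rw [ContinuousAt, Metric.tendsto_nhds]
      intro ε hε
      obtain ⟨N, hN⟩ := hclose ε hε
      have h1 : Tendsto (fun y : ℕ∞ × closedBall (0:ℂ) 1 => y.1) (𝓝 (⊤, d)) (𝓝 ⊤) := continuousAt_fst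
      filter_upwards [ENat.tendsto_nhds_top_iff_natCast_lt.1 h1 N] with y hy
      by_cases hy1 : y.1 = ⊤
      · simp [f0, hy1, hε]
      · simp only [f0, hy1, if_true, if_false]
        refine hN _ ?_ _
        obtain ⟨m, hm⟩ := ENat.ne_top_iff_exists.1 hy1
        rw [← hm] at hy ⊢
        simp only [ENat.toNat_natCast]
        exact_mod_cast hy.le
    · have hd : ‖(d : ℂ)‖ = 1 := hnd.resolve_left hn
      have h1 : ContinuousWithinAt (fun y : ℕ∞ × closedBall (0:ℂ) 1 => ι n.toNat (u y.2)) Z (n, d) := by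
        refine (hι n.toNat).continuous.continuousAt.comp_continuousWithinAt ?_
        have h2 : ContinuousWithinAt (fun y : ℕ∞ × closedBall (0:ℂ) 1 => u y.2)
            {y | ‖(y.2 : ℂ)‖ = 1} (n, d) := by
          refine ContinuousWithinAt.comp (g := u) (x := (n, d)) (f := fun y : ℕ∞ × closedBall (0:ℂ) 1 => (y.2 : ℂ)) (t := {z : ℂ | ‖z‖ = 1}) (huc d hd) ?_ (fun y hy => hy)
          exact (continuous_subtype_val.comp continuous_snd).continuousWithinAt
        refine h2.mono_of_mem_nhdsWithin ?_
        have h3 : {y : ℕ∞ × closedBall (0:ℂ) 1 | y.1 = n} ∈ 𝓝 (n, d) :=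
          ((ENat.isOpen_singleton hn).preimage continuous_fst).mem_nhds rfl
        filter_upwards [mem_nhdsWithin_of_mem_nhds h3, self_mem_nhdsWithin] with y hy hyZ
        have hy' : y.1 = n := hy
        exact hyZ.resolve_left (hy' ▸ hn)
      refine h1.congr_of_eventuallyEq ?_ (by simp [f0, hn])
      have h3 : {y : ℕ∞ × closedBall (0:ℂ) 1 | y.1 = n} ∈ 𝓝 (n, d) :=
          ((ENat.isOpen_singleton hn).preimage continuous_fst).mem_nhds rfl
      filter_upwards [mem_nhdsWithin_of_mem_nhds h3] with y hy
      have hy' : y.1 = n := hy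
      simp [f0, hy', hn]
  obtain ⟨V, hZV, hVc, hZi, g, hg⟩ := hX (ℕ∞ × closedBall (0:ℂ) 1) inferInstance inferInstance inferInstance
    Z hZ ⟨Z.domRestrict f0, hf0.domRestrict⟩
  obtain ⟨a, b, ha, hb, hta, htb, hab⟩ := generalized_tube_lemma (isCompact_singleton (x := (⊤ : ℕ∞)))
    (isCompact_univ (X := closedBall (0:ℂ) 1)) (isOpen_interior (s := V)) (by
      rintro ⟨n, d⟩ ⟨hn, -⟩
      exact hZi (Or.inl hn))
  have hev : ∀ᶠ n : ℕ in atTop, (n : ℕ∞) ∈ a :=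
    ENat.tendsto_natCast_nhds_top.eventually (ha.mem_nhds (hta rfl))
  obtain ⟨n, hn⟩ := hev.exists
  have hV : ∀ d : closedBall (0:ℂ) 1, ((n : ℕ∞), d) ∈ V := fun d =>
    interior_subset (hab ⟨hn, htb (mem_univ d)⟩)
  refine ⟨ι n, hι n, ⟨fun d => g ⟨((n : ℕ∞), d), hV d⟩, by fun_prop⟩, ?_⟩
  intro z
  have h1 := hg ((n : ℕ∞), ⟨z, by simp [Circle.norm_coe]⟩) (Or.inr (by simp [Circle.norm_coe]))
  simp only [ContinuousMap.coe_mk]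
  rw [h1]
  simp [f0, Set.domRestrict, hu]

theorem ward_part_one (X : Type) [MetricSpace X] [CompactSpace X]
    (h : ∀ ε > (0 : ℝ), ∃ ι : Circle → X, Topology.IsEmbedding ι ∧
        Metric.diam (Set.range ι) < ε) : ¬ (IsANRSpace X ∧ CovDimLE X 1) := by
  rintro ⟨hA, hd⟩
  obtain ⟨ι, hι, e, he⟩ := small_circle_disc hA h
  have hcl : IsClosedEmbedding ι := hι.continuous.isClosedEmbedding hι.injective
  let H := hι.toHomeomorph
  obtain ⟨r, hr1, hr2⟩ := dim_one_extend hd (range ι) hcl.isClosed_range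
    ⟨fun a => (H.symm a : ℂ), by fun_prop⟩ (fun a => by simp [Circle.norm_coe])
  have hr3 : ∀ z, r (ι z) = z := by
    intro z
    have := hr2 ⟨ι z, mem_range_self z⟩
    rw [this]
    have h2 : H.symm ⟨ι z, mem_range_self z⟩ = z := by
      rw [Homeomorph.symm_apply_eq]; rfl
    simp [h2]
  let k : ℂ → closedBall (0:ℂ) 1 := fun z => ⟨z / (max 1 ‖z‖ : ℝ), by
    have : 0 < max 1 ‖z‖ := by positivity
    rw [mem_closedBall_zero_iff, norm_div, Complex.norm_real, Real.norm_of_nonneg this.le, div_le_one this]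
    exact le_max_right _ _⟩
  have hk : Continuous k := by
    refine Continuous.subtype_mk (continuous_id.div (by fun_prop) fun z => ?_) _
    have : 0 < max 1 ‖z‖ := by positivity
    exact_mod_cast this.ne'
  refine no_retraction_circle (fun z => ⟨r (e (k z)), by simpa [Submonoid.unitSphere] using hr1 _⟩) ?_ ?_
  · refine Continuous.subtype_mk ?_ _
    fun_prop
  · intro z
    refine Subtype.ext ?_
    have h1 : k z = ⟨z, by simp [Circle.norm_coe]⟩ := by
      refine Subtype.ext ?_
      simp [k, Circle.norm_coe]
    show r (e (k z)) = z
    rw [h1, he, hr3]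

theorem unif_loc_conn {X : Type*} [MetricSpace X] [CompactSpace X] [LocallyConnectedSpace X]
    (ε : ℝ) (hε : 0 < ε) : ∃ δ > 0, ∀ x y : X, dist x y < δ →
      ∃ C : Set X, IsPreconnected C ∧ x ∈ C ∧ y ∈ C ∧ C ⊆ ball x ε := by
  have h : ∀ x : X, ∃ O : Set X, IsOpen O ∧ x ∈ O ∧ IsPreconnected O ∧ O ⊆ ball x (ε / 2) := by
    intro x
    obtain ⟨O, h1, h2, h3, h4⟩ := locallyConnectedSpace_iff_subsets_isOpen_isConnected.1 ‹_› x
      (ball x (ε / 2)) (ball_mem_nhds x (by positivity))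
    exact ⟨O, h2, h3, h4.isPreconnected, h1⟩
  choose O h1 h2 h3 h4 using h
  obtain ⟨δ, hδ, h5⟩ := lebesgue_number_lemma_of_metric (isCompact_univ (X := X)) h1
    (fun x _ => mem_iUnion.2 ⟨x, h2 x⟩)
  refine ⟨δ, hδ, fun x y hxy => ?_⟩
  obtain ⟨i, hi⟩ := h5 x (mem_univ x)
  refine ⟨O i, h3 i, hi (mem_ball_self hδ), hi (by rwa [mem_ball, dist_comm]), fun z hz => ?_⟩
  have h6 : dist z i < ε / 2 := h4 i hz
  have h7 : dist x i < ε / 2 := h4 i (hi (mem_ball_self hδ))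
  have := dist_triangle_right z x i
  rw [mem_ball]; linarith

theorem exists_chain {X : Type*} [MetricSpace X] {C : Set X} (hC : IsPreconnected C) (δ : ℝ)
    (hδ : 0 < δ) {x y : X} (hx : x ∈ C) (hy : y ∈ C) :
    ∃ (n : ℕ) (z : ℕ → X), z 0 = x ∧ (∀ i ≥ n, z i = y) ∧ (∀ i, z i ∈ C) ∧
      ∀ i, dist (z i) (z (i + 1)) < δ := by
  let P : X → X → Prop := fun x y => x ∈ C → y ∈ C → ∃ (n : ℕ) (z : ℕ → X), z 0 = x ∧ (∀ i ≥ n, z i = y) ∧ (∀ i, z i ∈ C) ∧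
      ∀ i, dist (z i) (z (i + 1)) < δ
  have hstep : ∀ x y, dist x y < δ → P x y := by
    intro x y h hx hy
    refine ⟨1, fun i => if i = 0 then x else y, by simp, fun i hi => by simp; omega, fun i => ?_, fun i => ?_⟩
    · dsimp only; split_ifs <;> assumption
    · by_cases hi : i = 0
      · simpa [hi] using h
      · simpa [hi] using hδ
  refine hC.induction₂' P ?_ ?_ hx hy hx hy
  · intro x hx
    filter_upwards [mem_nhdsWithin_of_mem_nhds (ball_mem_nhds x hδ)] with y hy
    exact ⟨hstep x y (by rwa [dist_comm]), hstep y x hy⟩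
  · intro x y w hx hy hw h1 h2 _ _
    obtain ⟨n, z, a1, a2, a3, a4⟩ := h1 hx hy
    obtain ⟨m, z', b1, b2, b3, b4⟩ := h2 hy hw
    refine ⟨n + m, fun i => if i < n then z i else z' (i - n), ?_, ?_, ?_, ?_⟩
    · by_cases hn : 0 < n
      · simp [hn, a1]
      · have : n = 0 := by omega
        subst this
        simp [b1, ← a1, ← a2 0 le_rfl]
    · intro i hi
      have : ¬ i < n := by omega
      simp only [this, if_false]
      exact b2 _ (by omega)
    · intro i; dsimp only; split_ifs
      · exact a3 _
      · exact b3 _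
    · intro i
      by_cases h1 : i + 1 < n
      · have : i < n := by omega
        simp only [h1, this, if_true]; exact a4 i
      · by_cases h2 : i < n
        · have h3 : i + 1 = n := by omega
          simp only [h2, if_true, h3, lt_irrefl, if_false, le_refl, Nat.sub_self, b1, ← a2 n le_rfl]
          rw [← h3]; exact a4 i
        · simp only [h1, h2, if_false]
          rw [show i + 1 - n = i - n + 1 by omega]; exact b4 _

theorem refine_chain {X : Type*} [MetricSpace X] {δ ε δ' : ℝ} (hδ' : 0 < δ')
    (hε : 0 < ε)
    (h : ∀ x y : X, dist x y < δ → ∃ C : Set X, IsPreconnected C ∧ x ∈ C ∧ y ∈ C ∧ C ⊆ ball x ε)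
    (M : ℕ) (z : ℕ → X) (x y : X) (hM : 0 < M) (h0 : z 0 = x) (hz1 : ∀ i ≥ M, z i = y)
    (hz : ∀ i, dist (z i) (z (i + 1)) < δ) :
    ∃ (m : ℕ) (z' : ℕ → X), 0 < m ∧ z' 0 = x ∧ (∀ i ≥ M * m, z' i = y) ∧
      (∀ i, dist (z' i) (z' (i + 1)) < δ') ∧ ∀ k, dist (z (k / m)) (z' k) ≤ ε := by
  have h1 : ∀ i, ∃ (n : ℕ) (c : ℕ → X), c 0 = z i ∧ (∀ j ≥ n, c j = z (i + 1)) ∧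
      (∀ j, c j ∈ ball (z i) ε) ∧ ∀ j, dist (c j) (c (j + 1)) < δ' := by
    intro i
    obtain ⟨C, hC, a1, a2, a3⟩ := h _ _ (hz i)
    obtain ⟨n, c, b1, b2, b3, b4⟩ := exists_chain hC δ' hδ' a1 a2
    exact ⟨n, c, b1, b2, fun j => a3 (b3 j), b4⟩
  choose L c c1 c2 c3 c4 using h1
  obtain ⟨m, hm⟩ : ∃ m : ℕ, 0 < m ∧ ∀ i < M, L i ≤ m := by
    refine ⟨(∑ i ∈ Finset.range M, L i) + 1, by omega, fun i hi => ?_⟩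
    have := Finset.single_le_sum (f := L) (fun _ _ => Nat.zero_le _) (Finset.mem_range.2 hi)
    omega
  obtain ⟨hm0, hm⟩ := hm
  refine ⟨m, fun k => if k / m < M then c (k / m) (k % m) else y, hm0, ?_, ?_, ?_, ?_⟩
  · simp [hM, c1, h0]
  · intro i hi
    have : ¬ i / m < M := by
      rw [Nat.div_lt_iff_lt_mul hm0]; omega
    simp [this]
  · intro k
    dsimp only
    by_cases hk : k % m + 1 < m
    · have e1 : (k + 1) / m = k / m := by
        rw [Nat.add_div hm0]
        have : 1 % m = 1 := Nat.mod_eq_of_lt (by omega)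
        have h3 : 1 / m = 0 := Nat.div_eq_of_lt (by omega)
        rw [this, h3, if_neg (by omega)]; rfl
      have e2 : (k + 1) % m = k % m + 1 := by
        rw [Nat.add_mod, Nat.mod_eq_of_lt (a := 1) (by omega), Nat.mod_eq_of_lt hk]
      rw [e1, e2]
      split_ifs
      · exact c4 _ _
      · simpa using hδ'
    · have hlt := Nat.mod_lt k hm0
      have e0 : k % m + 1 = m := by omega
      have hk1 : k + 1 = (k / m + 1) * m := by
        have := Nat.div_add_mod k m
        rw [add_mul, one_mul, mul_comm]; omega
      have e1 : (k + 1) / m = k / m + 1 := by rw [hk1]; exact Nat.mul_div_cancel _ hm0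
      have e2 : (k + 1) % m = 0 := by rw [hk1]; exact Nat.mul_mod_left _ _
      rw [e1, e2]
      by_cases h5 : k / m < M
      · have h6 := c4 (k / m) (k % m)
        rw [e0, c2 _ _ (hm _ h5)] at h6
        rw [if_pos h5]
        split_ifs with h7
        · rw [c1]; exact h6
        · rw [← hz1 _ (by omega : k / m + 1 ≥ M)]; exact h6
      · rw [if_neg h5, if_neg (by omega)]; simpa using hδ'
  · intro k
    dsimp only
    split_ifs with h5
    · rw [dist_comm]; exact (c3 (k / m) (k % m)).le
    · rw [hz1 _ (by omega)]; simpa using hε.le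

theorem small_paths {X : Type*} [MetricSpace X] [CompactSpace X] [LocallyConnectedSpace X]
    (ε : ℝ) (hε : 0 < ε) : ∃ δ > 0, ∀ x y : X, dist x y < δ →
      ∃ γ : ℝ → X, Continuous γ ∧ γ 0 = x ∧ γ 1 = y ∧ ∀ t, dist (γ t) x < ε := by
  set C := ε / 2 with hCdef
  have hC : 0 < C := by positivity
  have hεn : ∀ n : ℕ, 0 < C / 2 / 2 ^ n := fun n => by positivity
  have := fun n : ℕ => unif_loc_conn (X := X) (C / 2 / 2 ^ n) (hεn n)
  choose δ0 hδ0 hδ1 using this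
  let δ : ℕ → ℝ := fun n => min (δ0 n) (C / 2 / 2 ^ n)
  have hδ : ∀ n, 0 < δ n := fun n => lt_min (hδ0 n) (hεn n)
  refine ⟨δ 0, hδ 0, fun x y hxy => ?_⟩
  let S : ℕ → Type _ := fun n => {p : ℕ × (ℕ → X) // 0 < p.1 ∧ p.2 0 = x ∧ (∀ i ≥ p.1, p.2 i = y) ∧
    ∀ i, dist (p.2 i) (p.2 (i + 1)) < δ n}
  have hnext : ∀ n (p : S n), ∃ q : S (n + 1), ∃ m : ℕ, 0 < m ∧ q.1.1 = p.1.1 * m ∧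
      ∀ k, dist (p.1.2 (k / m)) (q.1.2 k) ≤ C / 2 / 2 ^ n := by
    rintro n ⟨⟨M, z⟩, hM, h0, h1, h2⟩
    obtain ⟨m, z', a1, a2, a3, a4, a5⟩ := refine_chain (hδ (n + 1)) (hεn n) (hδ1 n) M z x y hM h0 h1
      (fun i => (h2 i).trans_le (min_le_left _ _))
    exact ⟨⟨⟨M * m, z'⟩, Nat.mul_pos hM a1, a2, a3, a4⟩, m, a1, rfl, a5⟩
  choose nxt hnxt using hnext
  let s0 : S 0 := ⟨⟨1, fun i => if i = 0 then x else y⟩, one_pos, by simp, fun i hi => by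
    have : i ≠ 0 := by dsimp only at hi; omega
    simp [this], fun i => by
      by_cases hi : i = 0
      · simpa [hi] using hxy
      · simpa [hi] using hδ 0⟩
  let s : ∀ n, S n := fun n => Nat.rec s0 (fun n p => nxt n p) n
  have hs : ∀ n, s (n + 1) = nxt n (s n) := fun n => rfl
  let f : ℕ → ℝ → X := fun n t => (s n).1.2 ⌊t * (s n).1.1⌋₊
  have hf : ∀ n t, dist (f n t) (f (n + 1) t) ≤ C / 2 / 2 ^ n := by
    intro n t
    obtain ⟨m, hm, h1, h2⟩ := hnxt n (s n)
    have h3 := h2 ⌊t * (s (n + 1)).1.1⌋₊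
    rw [← Nat.floor_div_natCast, hs, h1] at h3
    have h4 : t * ((((s n).1.1 * m : ℕ)) : ℝ) / m = t * (s n).1.1 := by
      have : (m : ℝ) ≠ 0 := by exact_mod_cast hm.ne'
      push_cast; field_simp
    rw [h4] at h3
    simp only [f, hs, h1]
    exact h3
  have hlim : ∀ t, ∃ a, Tendsto (fun n => f n t) atTop (𝓝 a) := fun t =>
    cauchySeq_tendsto_of_complete (cauchySeq_of_le_geometric_two (hf · t))
  choose γ hγ using hlim
  have hd : ∀ n t, dist (f n t) (γ t) ≤ C / 2 ^ n := fun n t =>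
    dist_le_of_le_geometric_two_of_tendsto (hf · t) (hγ t) n
  refine ⟨γ, ?_, ?_, ?_, ?_⟩
  · rw [Metric.continuous_iff]
    intro t e he
    obtain ⟨n, hn⟩ : ∃ n : ℕ, 3 * C / 2 ^ n < e := by
      have : Tendsto (fun n : ℕ => 3 * C / (2:ℝ) ^ n) atTop (𝓝 0) :=
        tendsto_const_nhds.div_atTop (tendsto_pow_atTop_atTop_of_one_lt (by norm_num))
      exact (this.eventually_lt_const he).exists
    have hM : (0:ℝ) < (s n).1.1 := by exact_mod_cast (s n).2.1
    have hz := (s n).2.2.2.2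
    refine ⟨1 / (s n).1.1, by positivity, fun u hu => ?_⟩
    have key : ∀ a b : ℝ, a ≤ b → b - a < 1 → dist ((s n).1.2 ⌊a⌋₊) ((s n).1.2 ⌊b⌋₊) < δ n := by
      intro a b hab hba
      have h1 : ⌊a⌋₊ ≤ ⌊b⌋₊ := Nat.floor_mono hab
      have h2 : ⌊b⌋₊ ≤ ⌊a⌋₊ + 1 := by
        rcases le_or_gt 0 a with ha | ha
        · rw [← Nat.floor_add_one ha]
          exact Nat.floor_mono (by linarith)
        · have : ⌊b⌋₊ < 1 := (Nat.floor_lt' one_ne_zero).2 (by push_cast; linarith)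
          omega
      rcases (by omega : ⌊b⌋₊ = ⌊a⌋₊ ∨ ⌊b⌋₊ = ⌊a⌋₊ + 1) with h | h
      · rw [h]; simpa using hδ n
      · rw [h]; exact hz _
    have hu' : |u * (s n).1.1 - t * (s n).1.1| < 1 := by
      rw [Real.dist_eq, lt_div_iff₀ hM] at hu
      rwa [← sub_mul, abs_mul, abs_of_pos hM]
    have h1 : dist (f n u) (f n t) < δ n := by
      rcases le_total (u * (s n).1.1) (t * (s n).1.1) with h | h
      · refine key _ _ h ?_
        linarith [neg_le_abs (u * (s n).1.1 - t * (s n).1.1)]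
      · rw [dist_comm]; refine key _ _ h ?_
        linarith [le_abs_self (u * (s n).1.1 - t * (s n).1.1)]
    have h2 : δ n ≤ C / 2 / 2 ^ n := min_le_right _ _
    have h3 := dist_triangle4 (γ u) (f n u) (f n t) (γ t)
    have h4 := hd n u
    have h5 := hd n t
    rw [dist_comm] at h4
    have h6 : C / 2 / 2 ^ n ≤ C / 2 ^ n := by gcongr; linarith
    have h7 : 3 * C / 2 ^ n = C / 2 ^ n + C / 2 ^ n + C / 2 ^ n := by ring
    linarith
  · refine tendsto_nhds_unique (hγ 0) ?_
    have : (fun n => f n 0) = fun n => x := by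
      funext n; simp only [f, zero_mul, Nat.floor_zero]; exact (s n).2.2.1
    rw [this]; exact tendsto_const_nhds
  · refine tendsto_nhds_unique (hγ 1) ?_
    have : (fun n => f n 1) = fun n => y := by
      funext n; simp only [f, one_mul, Nat.floor_natCast]; exact (s n).2.2.2.1 _ le_rfl
    rw [this]; exact tendsto_const_nhds
  · intro t
    have h1 := hd 0 t
    rw [dist_comm] at h1
    have h2 : dist (f 0 t) x < C / 2 := by
      have h3 : dist x y < C / 2 := by
        refine hxy.trans_le ((min_le_right _ _).trans ?_); simp
      have : f 0 t = if ⌊t * ((1 : ℕ) : ℝ)⌋₊ = 0 then x else y := rfl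
      rw [this]
      split_ifs
      · simpa using hC
      · rwa [dist_comm]
    have := dist_triangle (γ t) (f 0 t) x
    simp only [pow_zero, div_one] at h1
    linarith

theorem whitney_map (X : Type*) [MetricSpace X] [CompactSpace X] [Nonempty X] :
    ∃ W : Set X → ℝ, (∀ (A B : Set X) (δ : ℝ), A.Nonempty → B.Nonempty →
      (∀ x ∈ A, ∃ y ∈ B, dist x y ≤ δ) → W A ≤ W B + 2 * δ) ∧
      ∀ (A B : Set X) (x : X), IsClosed A → A.Nonempty → A ⊆ B → x ∈ B → x ∉ A → W A < W B := by
  let a := TopologicalSpace.denseSeq X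
  have ha : DenseRange a := TopologicalSpace.denseRange_denseSeq X
  have hsum : ∀ A : Set X, A.Nonempty → Summable fun k : ℕ => (1/2 : ℝ) ^ k * infDist (a k) A := by
    intro A hA
    refine Summable.of_nonneg_of_le (fun k => mul_nonneg (by positivity) infDist_nonneg) (fun k => ?_)
      ((summable_geometric_two).mul_right (diam (univ : Set X)))
    refine mul_le_mul_of_nonneg_left ?_ (by positivity)
    obtain ⟨x, hx⟩ := hA
    exact (infDist_le_dist_of_mem hx).trans
      (dist_le_diam_of_mem isCompact_univ.isBounded (mem_univ _) (mem_univ _))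
  refine ⟨fun A => - ∑' k : ℕ, (1/2 : ℝ) ^ k * infDist (a k) A, ?_, ?_⟩
  · intro A B δ hA hB h
    have h1 : ∀ k, infDist (a k) B ≤ infDist (a k) A + δ := by
      intro k
      refine le_of_forall_pos_lt_add fun e he => ?_
      obtain ⟨x, hx, hx2⟩ := (infDist_lt_iff hA).1 (lt_add_of_pos_right (infDist (a k) A) he)
      obtain ⟨y, hy, hxy⟩ := h x hx
      have := infDist_le_dist_of_mem (x := a k) hy
      have := dist_triangle (a k) x y
      linarith
    have h2 : ∑' k : ℕ, (1/2 : ℝ) ^ k * infDist (a k) B ≤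
        ∑' k : ℕ, ((1/2 : ℝ) ^ k * infDist (a k) A + (1/2 : ℝ) ^ k * δ) := by
      refine Summable.tsum_le_tsum (fun k => ?_) (hsum B hB)
        ((hsum A hA).add (summable_geometric_two.mul_right δ))
      rw [← mul_add]
      exact mul_le_mul_of_nonneg_left (h1 k) (by positivity)
    rw [Summable.tsum_add (hsum A hA) (summable_geometric_two.mul_right δ), tsum_mul_right,
      tsum_geometric_two] at h2
    linarith
  · intro A B x hA hAne hAB hxB hxA
    have hd : 0 < infDist x A := (hA.notMem_iff_infDist_pos hAne).1 hxA
    obtain ⟨k, hk⟩ := ha.exists_dist_lt x (half_pos hd)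
    refine neg_lt_neg (Summable.tsum_lt_tsum (i := k) (fun j => ?_) ?_ (hsum B ⟨x, hxB⟩) (hsum A hAne))
    · exact mul_le_mul_of_nonneg_left (infDist_le_infDist_of_subset hAB hAne) (by positivity)
    · refine mul_lt_mul_of_pos_left ?_ (by positivity)
      have h1 := infDist_le_dist_of_mem (x := a k) hxB
      have h2 := infDist_le_infDist_add_dist (s := A) (x := x) (y := a k)
      rw [dist_comm] at h1
      linarith

def IsArc {X : Type*} [TopologicalSpace X] (A : Set X) (a b : X) : Prop :=
  ∃ (T : ℝ) (p : ℝ → X), 0 ≤ T ∧ ContinuousOn p (Icc 0 T) ∧ InjOn p (Icc 0 T) ∧ p 0 = a ∧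
    p T = b ∧ p '' Icc 0 T = A

def GapSet {X : Type*} (γ : ℝ → X) (T : ℝ) (K : Set ℝ) : Prop :=
  IsClosed K ∧ K ⊆ Icc 0 T ∧ 0 ∈ K ∧ T ∈ K ∧
    ∀ a ∈ K, ∀ b ∈ K, a < b → (∀ x ∈ K, a < x → ¬ x < b) → γ a = γ b

theorem gapSet_minimal {X : Type*} [MetricSpace X] (γ : ℝ → X) (T : ℝ) (hT : 0 ≤ T)
    (hγ : ContinuousOn γ (Icc 0 T)) :
    ∃ K, GapSet γ T K ∧ ∀ s ∈ K, ∀ t ∈ K, s < t → γ s = γ t → ∀ x ∈ K, s < x → ¬ x < t := by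
  obtain ⟨K, -, hK⟩ := zorn_superset_nonempty {K | GapSet γ T K} (by
    intro c hc hchain hne
    refine ⟨⋂₀ c, ⟨isClosed_sInter fun K hK => (hc hK).1, ?_, ?_, ?_, ?_⟩, fun s hs => sInter_subset_of_mem hs⟩
    · obtain ⟨K, hK⟩ := hne
      exact (sInter_subset_of_mem hK).trans (hc hK).2.1
    · exact fun K hK => (hc hK).2.2.1
    · exact fun K hK => (hc hK).2.2.2.1
    · intro a ha b hb hab hgap
      obtain ⟨K0, hK0⟩ := hne
      have haT : a ∈ Icc 0 T := (hc hK0).2.1 (ha K0 hK0)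
      have hbT : b ∈ Icc 0 T := (hc hK0).2.1 (hb K0 hK0)
      by_contra hne'
      have he : 0 < dist (γ a) (γ b) := dist_pos.2 hne'
      obtain ⟨η, hη, hu⟩ := Metric.uniformContinuousOn_iff.1
        (isCompact_Icc.uniformContinuousOn_of_continuous hγ) _ (half_pos he)
      set η' := min (η / 2) ((b - a) / 4) with hη'
      have hη'0 : 0 < η' := lt_min (by positivity) (by linarith)
      have hη'1 : η' ≤ η / 2 := min_le_left _ _
      have hη'2 : η' ≤ (b - a) / 4 := min_le_right _ _
      have : Nonempty c := ⟨⟨K0, hK0⟩⟩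
      obtain ⟨⟨K, hKc⟩, hK⟩ := (isCompact_Icc (a := a + η') (b := b - η')).elim_directed_family_closed
        (fun K : c => (K : Set ℝ)) (fun K => (hc K.2).1) (by
          rw [← sInter_eq_iInter]
          refine eq_empty_of_forall_notMem ?_
          rintro x ⟨hx1, hx2⟩
          exact hgap x hx2 (by linarith [hx1.1]) (by linarith [hx1.2]))
        (by
          intro K L
          rcases hchain.total K.2 L.2 with h | h
          · exact ⟨K, subset_rfl, h⟩
          · exact ⟨L, h, subset_rfl⟩)
      have hKg := hc hKc
      obtain ⟨a', ⟨ha'K, ha'1⟩, ha'2⟩ := ((isCompact_Icc (a := a) (b := a + η')).inter_left hKg.1).exists_isGreatest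
        ⟨a, ha K hKc, le_rfl, by linarith⟩
      obtain ⟨b', ⟨hb'K, hb'1⟩, hb'2⟩ := ((isCompact_Icc (a := b - η') (b := b)).inter_left hKg.1).exists_isLeast
        ⟨b, hb K hKc, by linarith, le_rfl⟩
      have h1 : γ a' = γ b' := by
        refine hKg.2.2.2.2 a' ha'K b' hb'K (by linarith [ha'1.2, hb'1.1]) ?_
        intro x hx hx1 hx2
        rcases le_or_gt x (a + η') with h | h
        · exact absurd (ha'2 ⟨hx, by linarith [ha'1.1], h⟩) (not_le.2 hx1)
        · rcases le_or_gt (b - η') x with h' | h'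
          · exact absurd (hb'2 ⟨hx, h', by linarith [hb'1.2]⟩) (not_le.2 hx2)
          · exact (eq_empty_iff_forall_notMem.1 hK) x ⟨⟨h.le, h'.le⟩, hx⟩
      have h2 := hu a haT a' (hKg.2.1 ha'K) (by
        rw [Real.dist_eq, abs_lt]; constructor <;> linarith [ha'1.1, ha'1.2])
      have h3 := hu b' (hKg.2.1 hb'K) b hbT (by
        rw [Real.dist_eq, abs_lt]; constructor <;> linarith [hb'1.1, hb'1.2])
      rw [h1] at h2
      have := dist_triangle (γ a) (γ b') (γ b)
      linarith) (Icc 0 T) ⟨isClosed_Icc, subset_rfl, ⟨le_rfl, hT⟩, ⟨hT, le_rfl⟩, by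
        intro a ha b hb hab h
        exact absurd (h ((a + b) / 2) ⟨by linarith [ha.1, hb.1], by linarith [ha.2, hb.2]⟩ (by linarith)) (not_not.2 (by linarith))⟩
  have hKg : GapSet γ T K := hK.prop
  refine ⟨K, hKg, ?_⟩
  intro s hs t ht hst hγst x hx hsx hxt
  obtain ⟨h1, h2, h3, h4, h5⟩ := hKg
  have hmem : GapSet γ T (K \ Ioo s t) := by
    refine ⟨h1.sdiff isOpen_Ioo, diff_subset.trans h2, ⟨h3, fun h => absurd h.1 (not_lt.2 (h2 hs).1)⟩,
      ⟨h4, fun h => absurd h.2 (not_lt.2 (h2 ht).2)⟩, ?_⟩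
    rintro a ⟨ha, ha'⟩ b ⟨hb, hb'⟩ hab hgap
    by_cases hgK : ∀ x ∈ K, a < x → ¬ x < b
    · exact h5 a ha b hb hab hgK
    · push Not at hgK
      obtain ⟨y, hy, hay, hyb⟩ := hgK
      have hy' : y ∈ Ioo s t := by
        by_contra h
        exact hgap y ⟨hy, h⟩ hay hyb
      have has : a ≤ s := by
        by_contra! h
        exact ha' ⟨h, hay.trans hy'.2⟩
      have hbt : t ≤ b := by
        by_contra! h
        exact hb' ⟨hy'.1.trans hyb, h⟩
      have e1 : a = s := by
        by_contra h
        exact hgap s ⟨hs, fun h => lt_irrefl _ h.1⟩ (lt_of_le_of_ne has h) (hy'.1.trans hyb)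
      have e2 : t = b := by
        by_contra h
        exact hgap t ⟨ht, fun h => lt_irrefl _ h.2⟩ (hay.trans hy'.2) (lt_of_le_of_ne hbt h)
      rw [e1, ← e2]; exact hγst
  have := hK.le_of_le hmem diff_subset hx
  exact this.2 ⟨hsx, hxt⟩

theorem path_to_arc {X : Type*} [MetricSpace X] [CompactSpace X] (γ : ℝ → X) (T : ℝ) (hT : 0 ≤ T)
    (hγ : ContinuousOn γ (Icc 0 T)) : ∃ A ⊆ γ '' Icc 0 T, IsArc A (γ 0) (γ T) := by
  have : Nonempty X := ⟨γ 0⟩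
  obtain ⟨W, hW1, hW2⟩ := whitney_map X
  obtain ⟨K, ⟨h1, h2, h3, h4, h5⟩, hmin⟩ := gapSet_minimal γ T hT hγ
  let Kt : ℝ → Set ℝ := fun t => K ∩ Icc 0 t
  have hKtT : ∀ t, Kt t ⊆ Icc 0 T := fun t => inter_subset_left.trans h2
  have hKtc : ∀ t, IsCompact (Kt t) := fun t => isCompact_Icc.inter_left h1
  have hKtne : ∀ t, 0 ≤ t → (Kt t).Nonempty := fun t ht => ⟨0, h3, le_rfl, ht⟩
  let h : ℝ → ℝ := fun t => W (γ '' Kt t)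
  have hmono : ∀ s t, 0 ≤ s → s ≤ t → h s ≤ h t := by
    intro s t hs hst
    have := hW1 (γ '' Kt s) (γ '' Kt t) 0 ((hKtne s hs).image _) ((hKtne t (hs.trans hst)).image _) (by
      intro x hx
      refine ⟨x, image_mono (inter_subset_inter_right _ (Icc_subset_Icc_right hst)) hx, by simp⟩)
    simpa using this
  have hpre : ∀ t ∈ Icc 0 T, ∃ a ∈ K, a ≤ t ∧ ∀ x ∈ K, x ≤ t → x ≤ a := by
    intro t ht
    obtain ⟨a, ⟨ha, ha1⟩, ha2⟩ := (hKtc t).exists_isGreatest (hKtne t ht.1)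
    exact ⟨a, ha, ha1.2, fun x hx hxt => ha2 ⟨hx, (h2 hx).1, hxt⟩⟩
  have hcont : ContinuousOn h (Icc 0 T) := by
    have key : ∀ e > 0, ∃ d > 0, ∀ s ∈ Icc 0 T, ∀ t ∈ Icc 0 T, s ≤ t → t - s < d → h t ≤ h s + 2 * e := by
      intro e he
      obtain ⟨d, hd, hu⟩ := Metric.uniformContinuousOn_iff.1
        (isCompact_Icc.uniformContinuousOn_of_continuous hγ) e he
      refine ⟨d, hd, fun s hs t ht hst hd' => ?_⟩
      refine hW1 _ _ e ((hKtne t ht.1).image _) ((hKtne s hs.1).image _) ?_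
      rintro _ ⟨u, ⟨huK, hu1⟩, rfl⟩
      rcases le_or_gt u s with hus | hus
      · exact ⟨γ u, ⟨u, ⟨huK, hu1.1, hus⟩, rfl⟩, by simpa using he.le⟩
      · obtain ⟨a, ha, has, ha2⟩ := hpre s hs
        obtain ⟨b, ⟨hb, hb1⟩, hb2⟩ := ((isCompact_Icc (a := s) (b := u)).inter_left h1).exists_isLeast
          ⟨u, huK, hus.le, le_rfl⟩
        have hab : γ a = γ b := by
          rcases (has.trans hb1.1).eq_or_lt with h | h
          · rw [h]
          · refine h5 a ha b hb h fun x hx hax hxb => ?_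
            rcases le_or_gt x s with h' | h'
            · exact absurd (ha2 x hx h') (not_le.2 hax)
            · exact absurd (hb2 ⟨hx, h'.le, (hxb.trans_le hb1.2).le⟩) (not_le.2 hxb)
        refine ⟨γ a, ⟨a, ⟨ha, (h2 ha).1, has⟩, rfl⟩, ?_⟩
        rw [hab]
        refine (hu u (h2 huK) b (h2 hb) ?_).le
        rw [Real.dist_eq, abs_lt]
        constructor <;> linarith [hb1.1, hb1.2, hu1.2]
    rw [Metric.continuousOn_iff]
    intro t ht e he
    obtain ⟨d, hd, hk⟩ := key (e / 4) (by positivity)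
    refine ⟨d, hd, fun s hs hst => ?_⟩
    rw [Real.dist_eq, abs_lt] at hst
    rw [Real.dist_eq, abs_lt]
    rcases le_total s t with h' | h'
    · have := hk s hs t ht h' (by linarith)
      have := hmono s t hs.1 h'
      constructor <;> linarith
    · have := hk t ht s hs h' (by linarith)
      have := hmono t s ht.1 h'
      constructor <;> linarith
  have hinj1 : ∀ s ∈ K, ∀ t ∈ K, s < t → h s = h t → γ s = γ t := by
    intro s hs t ht hst hh
    by_contra hne
    have hnot : γ t ∉ γ '' Kt s := by
      rintro ⟨u, ⟨huK, hu⟩, hut⟩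
      rcases hu.2.eq_or_lt with e | e
      · exact hne (e ▸ hut)
      · exact hmin u huK t ht (e.trans hst) hut s hs e hst
    have := hW2 (γ '' Kt s) (γ '' Kt t) (γ t) ((hKtc s).image_of_continuousOn (hγ.mono (hKtT s))).isClosed
      ((hKtne s (h2 hs).1).image _) (image_mono (inter_subset_inter_right _ (Icc_subset_Icc_right hst.le)))
      ⟨t, ⟨ht, (h2 ht).1, le_rfl⟩, rfl⟩ hnot
    exact this.ne hh
  have hinj : ∀ s ∈ K, ∀ t ∈ K, h s = h t → γ s = γ t := by
    intro s hs t ht hh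
    rcases lt_trichotomy s t with e | e | e
    · exact hinj1 s hs t ht e hh
    · rw [e]
    · exact (hinj1 t ht s hs e hh.symm).symm
  have hwd1 : ∀ s ∈ K, ∀ t ∈ K, s < t → γ s = γ t → h s = h t := by
    intro s hs t ht hst hh
    have : γ '' Kt s = γ '' Kt t := by
      refine (image_mono (inter_subset_inter_right _ (Icc_subset_Icc_right hst.le))).antisymm ?_
      rintro _ ⟨u, ⟨huK, hu⟩, rfl⟩
      rcases le_or_gt u s with e | e
      · exact ⟨u, ⟨huK, hu.1, e⟩, rfl⟩
      · have hut : u = t := by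
          by_contra hne
          exact hmin s hs t ht hst hh u huK e (lt_of_le_of_ne hu.2 hne)
        exact ⟨s, ⟨hs, (h2 hs).1, le_rfl⟩, by rw [hut, hh]⟩
    simp only [h, this]
  have hwd : ∀ s ∈ K, ∀ t ∈ K, γ s = γ t → h s = h t := by
    intro s hs t ht hh
    rcases lt_trichotomy s t with e | e | e
    · exact hwd1 s hs t ht e hh
    · rw [e]
    · exact (hwd1 t ht s hs e hh.symm).symm
  have hsurj : ∀ v ∈ Icc (0 : ℝ) (h T - h 0), ∃ t ∈ K, h t = h 0 + v := by
    intro v hv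
    obtain ⟨t, ht, htv⟩ := intermediate_value_Icc hT hcont
      (show h 0 + v ∈ Icc (h 0) (h T) from ⟨by linarith [hv.1], by linarith [hv.2]⟩)
    obtain ⟨a, ha, hat, ha2⟩ := hpre t ht
    refine ⟨a, ha, ?_⟩
    rw [← htv]
    have : Kt a = Kt t := by
      refine Subset.antisymm (inter_subset_inter_right _ (Icc_subset_Icc_right hat)) ?_
      rintro u ⟨huK, hu⟩
      exact ⟨huK, hu.1, ha2 u huK hu.2⟩
    simp only [h, this]
  choose! τ hτK hτ using hsurj
  have h0T : 0 ≤ h T - h 0 := by linarith [hmono 0 T le_rfl hT]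
  refine ⟨γ '' K, image_mono h2, h T - h 0, fun v => γ (τ v), h0T, ?_, ?_, ?_, ?_, ?_⟩
  · rw [continuousOn_iff_isClosed]
    intro F hF
    have hKF : IsCompact (K ∩ γ ⁻¹' F) :=
      isCompact_Icc.of_isClosed_subset ((hγ.mono h2).preimage_isClosed_of_isClosed h1 hF)
        (inter_subset_left.trans h2)
    refine ⟨(fun t => h t - h 0) '' (K ∩ γ ⁻¹' F), ((hKF.image_of_continuousOn
      ((hcont.mono (inter_subset_left.trans h2)).sub continuousOn_const))).isClosed, ?_⟩
    ext v
    constructor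
    · rintro ⟨hvF, hv⟩
      exact ⟨⟨τ v, ⟨hτK v hv, hvF⟩, by simp [hτ v hv]⟩, hv⟩
    · rintro ⟨⟨t, ⟨htK, htF⟩, htv⟩, hv⟩
      refine ⟨?_, hv⟩
      have : γ (τ v) = γ t := hinj _ (hτK v hv) _ htK (by rw [hτ v hv, ← htv]; ring)
      show γ (τ v) ∈ F
      rw [this]; exact htF
  · intro v hv w hw hvw
    have := hwd _ (hτK v hv) _ (hτK w hw) hvw
    rw [hτ v hv, hτ w hw] at this
    linarith
  · have h0 : (0:ℝ) ∈ Icc 0 (h T - h 0) := ⟨le_rfl, h0T⟩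
    exact hinj _ (hτK 0 h0) _ h3 (by rw [hτ 0 h0, add_zero])
  · have h0 : (h T - h 0) ∈ Icc 0 (h T - h 0) := ⟨h0T, le_rfl⟩
    exact hinj _ (hτK _ h0) _ h4 (by rw [hτ _ h0]; ring)
  · refine Subset.antisymm ?_ ?_
    · rintro _ ⟨v, hv, rfl⟩
      exact ⟨τ v, hτK v hv, rfl⟩
    · rintro _ ⟨t, ht, rfl⟩
      have hv : h t - h 0 ∈ Icc 0 (h T - h 0) :=
        ⟨by linarith [hmono 0 t le_rfl (h2 ht).1], by linarith [hmono t T (h2 ht).1 (h2 ht).2]⟩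
      exact ⟨h t - h 0, hv, hinj _ (hτK _ hv) _ ht (by rw [hτ _ hv]; ring)⟩

section Arcs
variable {X : Type*} [MetricSpace X] [CompactSpace X]

theorem icc_glue {p q : ℝ → X} {a b c : ℝ} (hab : a ≤ b) (hbc : b ≤ c)
    (hp : ContinuousOn p (Icc a b)) (hq : ContinuousOn q (Icc b c)) (h : p b = q b) :
    ContinuousOn (fun t => if t ≤ b then p t else q t) (Icc a c) := by
  rw [← Icc_union_Icc_eq_Icc hab hbc]
  refine ContinuousOn.union_of_isClosed ?_ ?_ isClosed_Icc isClosed_Icc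
  · exact hp.congr (fun t ht => by simp [ht.2])
  · refine hq.congr (fun t ht => ?_)
    by_cases e : t ≤ b
    · have : t = b := le_antisymm e ht.1
      simp [this, h]
    · simp [e]

theorem isArc_sub {p : ℝ → X} {a b s t : ℝ} (hp : ContinuousOn p (Icc a b))
    (hi : InjOn p (Icc a b)) (h1 : a ≤ s) (h2 : s ≤ t) (h3 : t ≤ b) :
    IsArc (p '' Icc s t) (p s) (p t) := by
  refine ⟨t - s, fun u => p (s + u), by linarith, ?_, ?_, by simp, by simp, ?_⟩
  · refine hp.comp (by fun_prop) (fun u hu => ⟨by linarith [hu.1], by linarith [hu.2]⟩)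
  · intro u hu v hv huv
    have := hi (⟨by linarith [hu.1], by linarith [hu.2]⟩ : s + u ∈ Icc a b)
      (⟨by linarith [hv.1], by linarith [hv.2]⟩ : s + v ∈ Icc a b) huv
    linarith
  · ext x
    constructor
    · rintro ⟨u, hu, rfl⟩
      exact ⟨s + u, ⟨by linarith [hu.1], by linarith [hu.2]⟩, rfl⟩
    · rintro ⟨u, hu, rfl⟩
      exact ⟨u - s, ⟨by linarith [hu.1], by linarith [hu.2]⟩, by simp⟩

theorem IsArc.symm {A : Set X} {a b : X} (h : IsArc A a b) : IsArc A b a := by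
  obtain ⟨T, p, hT, hc, hi, h0, h1, him⟩ := h
  refine ⟨T, fun u => p (T - u), hT, ?_, ?_, by simpa, by simpa, ?_⟩
  · refine hc.comp (by fun_prop) (fun u hu => ⟨by linarith [hu.2], by linarith [hu.1]⟩)
  · intro u hu v hv huv
    have := hi (⟨by linarith [hu.2], by linarith [hu.1]⟩ : T - u ∈ Icc 0 T)
      (⟨by linarith [hv.2], by linarith [hv.1]⟩ : T - v ∈ Icc 0 T) huv
    linarith
  · rw [← him]
    ext x
    constructor
    · rintro ⟨u, hu, rfl⟩
      exact ⟨T - u, ⟨by linarith [hu.2], by linarith [hu.1]⟩, rfl⟩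
    · rintro ⟨u, hu, rfl⟩
      exact ⟨T - u, ⟨by linarith [hu.2], by linarith [hu.1]⟩, by simp⟩

theorem isArc_refl (a : X) : IsArc {a} a a :=
  ⟨0, fun _ => a, le_rfl, continuousOn_const, by simp, rfl, rfl, by simp⟩

theorem IsArc.left_mem {A : Set X} {a b : X} (h : IsArc A a b) : a ∈ A := by
  obtain ⟨T, p, hT, hc, hi, h0, h1, him⟩ := h
  rw [← him, ← h0]; exact ⟨0, ⟨le_rfl, hT⟩, rfl⟩

theorem IsArc.right_mem {A : Set X} {a b : X} (h : IsArc A a b) : b ∈ A := h.symm.left_mem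

theorem IsArc.isCompact {A : Set X} {a b : X} (h : IsArc A a b) : IsCompact A := by
  obtain ⟨T, p, hT, hc, hi, h0, h1, him⟩ := h
  rw [← him]; exact isCompact_Icc.image_of_continuousOn hc

theorem IsArc.isPreconnected {A : Set X} {a b : X} (h : IsArc A a b) : IsPreconnected A := by
  obtain ⟨T, p, hT, hc, hi, h0, h1, him⟩ := h
  rw [← him]; exact isPreconnected_Icc.image p hc

theorem IsArc.eq_singleton {A : Set X} {a : X} (h : IsArc A a a) : A = {a} := by
  obtain ⟨T, p, hT, hc, hi, h0, h1, him⟩ := h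
  have : 0 = T := hi ⟨le_rfl, hT⟩ ⟨hT, le_rfl⟩ (h0.trans h1.symm)
  subst this
  rw [← him]; simp [h0]

theorem IsArc.trans {A B : Set X} {a b c : X} (h : IsArc A a b) (h' : IsArc B b c) :
    ∃ C ⊆ A ∪ B, IsArc C a c := by
  obtain ⟨T, p, hT, hc, hi, h0, h1, him⟩ := h
  obtain ⟨S, q, hS, hc', hi', h0', h1', him'⟩ := h'
  have hg := icc_glue (p := p) (q := fun t => q (t - T)) hT (show T ≤ T + S by linarith) hc
    (hc'.comp (by fun_prop) (fun u hu => ⟨by linarith [hu.1], by linarith [hu.2]⟩))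
    (by simp [h1, h0'])
  obtain ⟨C, hC, hA⟩ := path_to_arc _ (T + S) (by linarith) hg
  refine ⟨C, hC.trans ?_, ?_⟩
  · rintro _ ⟨t, ht, rfl⟩
    by_cases e : t ≤ T
    · left; simp only [e, if_true]; rw [← him]; exact ⟨t, ⟨ht.1, e⟩, rfl⟩
    · right; simp only [e, if_false]; rw [← him']
      exact ⟨t - T, ⟨by linarith, by linarith [ht.2]⟩, rfl⟩
  · have e0 : (if (0:ℝ) ≤ T then p 0 else q (0 - T)) = a := by simp [hT, h0]
    have e1 : (if T + S ≤ T then p (T + S) else q (T + S - T)) = c := by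
      by_cases e : T + S ≤ T
      · have : S = 0 := by linarith
        subst this
        simp [h1, ← h0', ← h1']
      · simp [e, h1']
    rwa [e0, e1] at hA

theorem IsArc.exists_mid {A : Set X} {a b : X} (h : IsArc A a b) (hab : a ≠ b) :
    ∃ c ∈ A, c ≠ a ∧ c ≠ b := by
  obtain ⟨T, p, hT, hc, hi, h0, h1, him⟩ := h
  have hT' : 0 < T := by
    rcases hT.eq_or_lt with e | e
    · subst e; exact absurd (h0.symm.trans h1) hab
    · exact e
  refine ⟨p (T/2), him ▸ ⟨T/2, ⟨by linarith, by linarith⟩, rfl⟩, ?_, ?_⟩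
  · rw [← h0]; intro e
    have := hi (⟨by linarith, by linarith⟩ : T/2 ∈ Icc 0 T) ⟨le_rfl, hT⟩ e
    linarith
  · rw [← h1]; intro e
    have := hi (⟨by linarith, by linarith⟩ : T/2 ∈ Icc 0 T) ⟨hT, le_rfl⟩ e
    linarith

theorem IsArc.split {A : Set X} {a b z : X} (h : IsArc A a b) (hz : z ∈ A) :
    ∃ A' ⊆ A, IsArc A' a z ∧ (b ∈ A' → z = b) ∧
      ∀ w ∈ A, w ∉ A' → ∃ A'' ⊆ A, IsArc A'' a w ∧ z ∈ A'' := by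
  obtain ⟨T, p, hT, hc, hi, h0, h1, him⟩ := h
  rw [← him] at hz
  obtain ⟨s, hs, rfl⟩ := hz
  rw [← him]
  refine ⟨p '' Icc 0 s, image_mono (Icc_subset_Icc_right hs.2), ?_, ?_, ?_⟩
  · rw [← h0]; exact isArc_sub hc hi le_rfl hs.1 hs.2
  · rintro ⟨u, hu, hub⟩
    have := hi ⟨hu.1, hu.2.trans hs.2⟩ ⟨hT, le_rfl⟩ (hub.trans h1.symm)
    have : s = T := le_antisymm hs.2 (this ▸ hu.2)
    rw [this, h1]
  · rintro _ ⟨u, hu, rfl⟩ hn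
    have hsu : s ≤ u := by
      by_contra e
      exact hn ⟨u, ⟨hu.1, by linarith⟩, rfl⟩
    exact ⟨p '' Icc 0 u, image_mono (Icc_subset_Icc_right hu.2),
      by rw [← h0]; exact isArc_sub hc hi le_rfl hu.1 hu.2, ⟨s, ⟨hs.1, hsu⟩, rfl⟩⟩

/-- Two arcs meeting only at endpoints form a circle. -/
theorem two_arcs_circle {A B : Set X} {a b : X} (hA : IsArc A a b) (hB : IsArc B a b)
    (hab : a ≠ b) (hAB : ∀ x ∈ A, x ∈ B → x = a ∨ x = b) :
    ∃ ι : Circle → X, Topology.IsEmbedding ι ∧ range ι ⊆ A ∪ B := by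
  obtain ⟨T, p, hT, hc, hi, h0, h1, him⟩ := hA
  obtain ⟨S, q, hS, hc', hi', h0', h1', him'⟩ := hB.symm
  have hT' : 0 < T := by
    rcases hT.eq_or_lt with e | e
    · subst e; exact absurd (h0.symm.trans h1) hab
    · exact e
  have hS' : 0 < S := by
    rcases hS.eq_or_lt with e | e
    · subst e; exact absurd (h0'.symm.trans h1').symm hab
    · exact e
  set l : ℝ → X := fun t => if t ≤ T then p t else q (t - T) with hl
  have hlc : ContinuousOn l (Icc 0 (T + S)) := 
    icc_glue (p := p) (q := fun t => q (t - T)) hT (show T ≤ T + S by linarith) hc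
    (hc'.comp (by fun_prop) (fun u hu => ⟨by linarith [hu.1], by linarith [hu.2]⟩))
    (by simp [h1, h0'])
  have hmem : ∀ t ∈ Icc 0 (T+S), l t ∈ A ∪ B := by
    intro t ht
    simp only [hl]
    split_ifs with e
    · left; rw [← him]; exact ⟨t, ⟨ht.1, e⟩, rfl⟩
    · right; rw [← him']; exact ⟨t - T, ⟨by linarith, by linarith [ht.2]⟩, rfl⟩
  have key : ∀ s ∈ Ico 0 (T+S), ∀ t ∈ Ico 0 (T+S), s ≤ T → T < t → l s ≠ l t := by
    intro s hs t ht e1 e2 hst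
    simp only [hl, e1, if_true, not_le.2 e2, if_false] at hst
    have hsA : p s ∈ A := him ▸ ⟨s, ⟨hs.1, e1⟩, rfl⟩
    have hsB : p s ∈ B := by
      rw [hst]; exact him' ▸ ⟨t - T, ⟨by linarith, by linarith [ht.2]⟩, rfl⟩
    have hm : t - T ∈ Icc 0 S := ⟨by linarith, by linarith [ht.2]⟩
    rcases hAB _ hsA hsB with e | e
    · have := hi' hm ⟨hS, le_rfl⟩ (by rw [← hst, e, h1'])
      linarith [ht.2]
    · have := hi' hm ⟨le_rfl, hS⟩ (by rw [← hst, e, h0'])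
      linarith
  have hli : InjOn l (Ico 0 (T+S)) := by
    intro s hs t ht hst
    rcases le_or_gt s T with e1 | e1 <;> rcases le_or_gt t T with e2 | e2
    · simp only [hl, e1, e2, if_true] at hst
      exact hi ⟨hs.1, e1⟩ ⟨ht.1, e2⟩ hst
    · exact absurd hst (key s hs t ht e1 e2)
    · exact absurd hst.symm (key t ht s hs e2 e1)
    · simp only [hl, not_le.2 e1, not_le.2 e2, if_false] at hst
      have := hi' (⟨by linarith, by linarith [hs.2]⟩ : s - T ∈ Icc 0 S)
        (⟨by linarith, by linarith [ht.2]⟩ : t - T ∈ Icc 0 S) hst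
      linarith
  have hTS : 0 < T + S := by linarith
  haveI : Fact (0 < T + S) := ⟨hTS⟩
  set L : AddCircle (T+S) → X := AddCircle.liftIco (T+S) 0 l with hL
  have hLc : Continuous L := by
    apply AddCircle.liftIco_continuous
    · simp only [hl, zero_add, hT, if_true, show ¬ (T + S ≤ T) by linarith, if_false]
      rw [h0, show T + S - T = S by ring, h1']
    · simpa using hlc
  have hrep : ∀ x : AddCircle (T+S), ∃ t ∈ Ico 0 (T+S), (t : AddCircle (T+S)) = x := by
    intro x
    have := AddCircle.coe_image_Ico_eq (T+S) 0
    have h2 : x ∈ (QuotientAddGroup.mk '' Ico 0 (0 + (T+S)) : Set (AddCircle (T+S))) := by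
      rw [this]; trivial
    obtain ⟨t, ht, h3⟩ := h2
    exact ⟨t, by simpa using ht, h3⟩
  have hval : ∀ t ∈ Ico 0 (T+S), L (t : AddCircle (T+S)) = l t := by
    intro t ht
    exact AddCircle.liftIco_coe_apply (by simpa using ht)
  have hLi : Function.Injective L := by
    intro x y hxy
    obtain ⟨s, hs, rfl⟩ := hrep x
    obtain ⟨t, ht, rfl⟩ := hrep y
    rw [hval s hs, hval t ht] at hxy
    rw [hli hs ht hxy]
  refine ⟨L ∘ (AddCircle.homeomorphCircle hTS.ne').symm, ?_, ?_⟩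
  · refine Topology.IsEmbedding.comp ?_ (Homeomorph.isEmbedding _)
    exact (hLc.isClosedEmbedding hLi).isEmbedding
  · rintro _ ⟨c, rfl⟩
    obtain ⟨t, ht, h⟩ := hrep ((AddCircle.homeomorphCircle hTS.ne').symm c)
    simp only [Function.comp]
    rw [← h, hval t ht]
    exact hmem t ⟨ht.1, ht.2.le⟩

theorem arcs_circle {A B : Set X} {a b : X} (hA : IsArc A a b) (hB : IsArc B a b)
    (hAB : ¬ A ⊆ B) :
    ∃ ι : Circle → X, Topology.IsEmbedding ι ∧ range ι ⊆ A ∪ B := by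
  obtain ⟨x, hxA, hxB⟩ := not_subset.1 hAB
  have hBc := hB.isCompact.isClosed
  have haB := hB.left_mem
  have hbB := hB.right_mem
  obtain ⟨T, p, hT, hc, hi, h0, h1, him⟩ := hA
  obtain ⟨S, q, hS, hc', hi', h0', h1', him'⟩ := hB
  rw [← him] at hxA
  obtain ⟨t0, ht0, rfl⟩ := hxA
  have hK1 : IsCompact (Icc 0 t0 ∩ p ⁻¹' B) :=
    isCompact_Icc.of_isClosed_subset ((hc.mono (Icc_subset_Icc_right ht0.2)).preimage_isClosed_of_isClosed isClosed_Icc hBc) inter_subset_left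
  have hK2 : IsCompact (Icc t0 T ∩ p ⁻¹' B) :=
    isCompact_Icc.of_isClosed_subset ((hc.mono (Icc_subset_Icc_left ht0.1)).preimage_isClosed_of_isClosed isClosed_Icc hBc) inter_subset_left
  obtain ⟨s1, ⟨hs1, hs1B⟩, hs1m⟩ := hK1.exists_isGreatest ⟨0, ⟨le_rfl, ht0.1⟩, by
    show p 0 ∈ B
    rw [h0]; exact haB⟩
  obtain ⟨s2, ⟨hs2, hs2B⟩, hs2m⟩ := hK2.exists_isLeast ⟨T, ⟨ht0.2, le_rfl⟩, by
    show p T ∈ B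
    rw [h1]; exact hbB⟩
  have hs1B' : p s1 ∈ B := hs1B
  have hs2B' : p s2 ∈ B := hs2B
  have l1 : s1 < t0 := lt_of_le_of_ne hs1.2 (by rintro rfl; exact hxB hs1B)
  have l2 : t0 < s2 := lt_of_le_of_ne hs2.1 (by rintro rfl; exact hxB hs2B)
  have hne : p s1 ≠ p s2 := by
    intro e
    have := hi ⟨hs1.1, by linarith [ht0.2]⟩ ⟨by linarith [ht0.1], hs2.2⟩ e
    linarith
  have hA1 : IsArc (p '' Icc s1 s2) (p s1) (p s2) := isArc_sub hc hi hs1.1 (by linarith) hs2.2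
  have hB1 : ∃ B' ⊆ B, IsArc B' (p s1) (p s2) := by
    rw [← him'] at hs1B' hs2B'
    obtain ⟨u1, hu1, e1⟩ := hs1B'
    obtain ⟨u2, hu2, e2⟩ := hs2B'
    rw [← e1, ← e2]
    rcases le_total u1 u2 with e | e
    · exact ⟨q '' Icc u1 u2, him' ▸ image_mono (Icc_subset_Icc hu1.1 hu2.2),
        isArc_sub hc' hi' hu1.1 e hu2.2⟩
    · exact ⟨q '' Icc u2 u1, him' ▸ image_mono (Icc_subset_Icc hu2.1 hu1.2),
        (isArc_sub hc' hi' hu2.1 e hu1.2).symm⟩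
  obtain ⟨B', hB'B, hB'⟩ := hB1
  obtain ⟨ι, hι, hr⟩ := two_arcs_circle hA1 hB' hne (by
    rintro _ ⟨u, hu, rfl⟩ huB
    have huB := hB'B huB
    rcases le_total u t0 with e | e
    · left
      have : u ≤ s1 := hs1m ⟨⟨hs1.1.trans hu.1, e⟩, huB⟩
      rw [le_antisymm this hu.1]
    · right
      have : s2 ≤ u := hs2m ⟨⟨e, hu.2.trans hs2.2⟩, huB⟩
      rw [le_antisymm this hu.2])
  refine ⟨ι, hι, hr.trans (union_subset_union ?_ hB'B)⟩
  rw [← him]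
  exact image_mono (Icc_subset_Icc hs1.1 hs2.2)

theorem small_arcs [LocallyConnectedSpace X] (ε : ℝ) (hε : 0 < ε) :
    ∃ δ > 0, ∀ x y : X, dist x y < δ → ∃ A ⊆ ball x ε, IsArc A x y := by
  obtain ⟨δ, hδ, h⟩ := small_paths (X := X) ε hε
  refine ⟨δ, hδ, fun x y hxy => ?_⟩
  obtain ⟨γ, hc, h0, h1, hb⟩ := h x y hxy
  obtain ⟨A, hA, hAr⟩ := path_to_arc γ 1 zero_le_one hc.continuousOn
  rw [h0, h1] at hAr
  refine ⟨A, hA.trans ?_, hAr⟩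
  rintro _ ⟨t, -, rfl⟩
  exact hb t

theorem arc_unique {ε : ℝ} (hX : ∀ ι : Circle → X, Topology.IsEmbedding ι →
        ε ≤ Metric.diam (Set.range ι)) {A B : Set X} {a b : X}
    (hA : IsArc A a b) (hB : IsArc B a b) (hd : diam A + diam B < ε) : A = B := by
  have hU : diam (A ∪ B) < ε := 
    (diam_union' ⟨a, hA.left_mem, hB.left_mem⟩).trans_lt hd
  have key : ∀ ι : Circle → X, Topology.IsEmbedding ι → ¬ range ι ⊆ A ∪ B := by
    intro ι hι hr
    have := diam_mono hr (hA.isCompact.union hB.isCompact).isBounded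
    linarith [hX ι hι]
  apply Subset.antisymm
  · by_contra hc
    obtain ⟨ι, hι, hr⟩ := arcs_circle hA hB hc
    exact key ι hι hr
  · by_contra hc
    obtain ⟨ι, hι, hr⟩ := arcs_circle hB hA hc
    exact key ι hι (by rwa [union_comm])

end Arcs

section Seg
variable {X : Type*} [MetricSpace X] [CompactSpace X]

def SegD (η : ℝ) (a : X) : Set X := {x | ∃ A, IsArc A a x ∧ diam A < η}
def Seg (η : ℝ) (a x : X) : Set X := ⋃₀ {A | IsArc A a x ∧ diam A < η}
def ArcUniq (X : Type*) [MetricSpace X] (η : ℝ) : Prop :=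
  ∀ (A B : Set X) (a b : X), IsArc A a b → IsArc B a b → diam A + diam B < 4 * η → A = B

theorem seg_eq {η : ℝ} (hη : 0 < η) (hu : ArcUniq X η) {A : Set X} {a x : X} (hA : IsArc A a x)
    (hd : diam A < η) : x ∈ SegD η a ∧ Seg η a x = A := by
  refine ⟨⟨A, hA, hd⟩, Subset.antisymm ?_ (subset_sUnion_of_mem ⟨hA, hd⟩)⟩
  apply sUnion_subset
  rintro B ⟨hB, hBd⟩
  rw [hu A B a x hA hB (by linarith)]

theorem seg_arc {η : ℝ} (hη : 0 < η) (hu : ArcUniq X η) {a x : X} (hx : x ∈ SegD η a) :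
    IsArc (Seg η a x) a x ∧ diam (Seg η a x) < η := by
  obtain ⟨A, hA, hd⟩ := hx
  rw [(seg_eq hη hu hA hd).2]
  exact ⟨hA, hd⟩

theorem seg_near [LocallyConnectedSpace X] {η : ℝ} (hη : 0 < η) (hu : ArcUniq X η) {a x : X}
    (hx : x ∈ SegD η a) (e : ℝ) (he : 0 < e) :
    ∀ᶠ x' in 𝓝 x, x' ∈ SegD η a ∧ Seg η a x' ⊆ Seg η a x ∪ ball x e ∧
      Seg η a x ⊆ Seg η a x' ∪ ball x e := by
  obtain ⟨hA, hd⟩ := seg_arc hη hu hx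
  set d := diam (Seg η a x) with hdd
  have hd0 : 0 ≤ d := diam_nonneg
  have he2 : 0 < min e ((η - d) / 3) := lt_min he (by linarith)
  obtain ⟨δ, hδ, h⟩ := small_arcs (X := X) (min e ((η - d) / 3)) he2
  rw [Metric.eventually_nhds_iff]
  refine ⟨δ, hδ, fun x' hx' => ?_⟩
  obtain ⟨B, hBb, hB⟩ := h x x' (by rwa [dist_comm])
  have hBe : B ⊆ ball x e := hBb.trans (ball_subset_ball (min_le_left _ _))
  have hBd : diam B ≤ 2 * ((η - d) / 3) :=
    (diam_mono hBb isBounded_ball).trans ((diam_ball he2.le).trans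
      (by linarith [min_le_right e ((η - d) / 3)]))
  obtain ⟨C, hC, hCA⟩ := hA.trans hB
  have hCd : diam C < η := by
    have h1 := diam_mono hC (hA.isCompact.union hB.isCompact).isBounded
    have h2 := diam_union' (s := Seg η a x) (t := B) ⟨x, hA.right_mem, hB.left_mem⟩
    linarith
  obtain ⟨hx'D, hSC⟩ := seg_eq hη hu hCA hCd
  refine ⟨hx'D, ?_, ?_⟩
  · rw [hSC]; exact hC.trans (union_subset_union_right _ hBe)
  · rw [hSC]
    obtain ⟨C', hC', hCA'⟩ := hCA.trans hB.symm
    have h1 := diam_mono hC' (hCA.isCompact.union hB.isCompact).isBounded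
    have h2 := diam_union' (s := C) (t := B) ⟨x', hCA.right_mem, hB.right_mem⟩
    have := hu _ _ _ _ hA hCA' (by linarith)
    rw [this]
    exact hC'.trans (union_subset_union_right _ hBe)

theorem segD_open [LocallyConnectedSpace X] {η : ℝ} (hη : 0 < η) (hu : ArcUniq X η) (a : X) :
    IsOpen (SegD η a) := by
  rw [isOpen_iff_eventually]
  intro x hx
  exact (seg_near hη hu hx 1 one_pos).mono fun _ h => h.1

theorem seg_sub {η : ℝ} (hη : 0 < η) (hu : ArcUniq X η) {a x z : X} (hx : x ∈ SegD η a)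
    (hz : z ∈ Seg η a x) : z ∈ SegD η a ∧ Seg η a z ⊆ Seg η a x ∧ (x ∈ Seg η a z → z = x) ∧
      ∀ w ∈ Seg η a x, w ∈ Seg η a z ∨ z ∈ Seg η a w := by
  obtain ⟨hA, hd⟩ := seg_arc hη hu hx
  obtain ⟨A', hA', hA1, hA2, hA3⟩ := hA.split hz
  have key : ∀ B ⊆ Seg η a x, diam B < η := fun B hB =>
    (diam_mono hB hA.isCompact.isBounded).trans_lt hd
  obtain ⟨h1, h2⟩ := seg_eq hη hu hA1 (key _ hA')
  rw [h2]
  refine ⟨h1, hA', hA2, fun w hw => ?_⟩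
  by_cases hwA : w ∈ A'
  · exact Or.inl hwA
  · obtain ⟨A'', hs, hA'', hz''⟩ := hA3 w hw hwA
    rw [(seg_eq hη hu hA'' (key _ hs)).2]
    exact Or.inr hz''

theorem seg_not_mem [LocallyConnectedSpace X] {η : ℝ} (hη : 0 < η) (hu : ArcUniq X η) {a x z : X}
    (hx : x ∈ SegD η a) (hz : z ∉ Seg η a x) :
    ∃ s ∈ 𝓝 x, ∃ t ∈ 𝓝 z, ∀ x' ∈ s, ∀ z' ∈ t, z' ∉ Seg η a x' := by
  have hA := (seg_arc hη hu hx).1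
  have hzx : z ≠ x := by rintro rfl; exact hz hA.right_mem
  have hpos : 0 < dist z x / 2 := by have := dist_pos.2 hzx; linarith
  refine ⟨_, seg_near hη hu hx (dist z x / 2) hpos, (Seg η a x)ᶜ ∩ ball z (dist z x / 2), ?_, ?_⟩
  · exact inter_mem (hA.isCompact.isClosed.isOpen_compl.mem_nhds hz) (ball_mem_nhds _ hpos)
  · rintro x' ⟨-, h2, -⟩ z' ⟨hz1, hz2⟩ hz'
    rcases h2 hz' with e | e
    · exact hz1 e
    · rw [mem_ball] at e hz2
      have := dist_triangle z z' x
      rw [dist_comm z z'] at this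
      linarith

theorem small_frontier [LocallyConnectedSpace X] {η : ℝ} (hη : 0 < η) (hu : ArcUniq X η) (p : X)
    (r : ℝ) (hr : 0 < r) : ∃ W : Set X, IsOpen W ∧ p ∈ W ∧ W ⊆ ball p r ∧ (frontier W).Finite := by
  obtain ⟨δ, hδ, hsm⟩ := small_arcs (X := X) (η / 3) (by linarith)
  obtain ⟨r', hr', hr'r, hr'δ⟩ : ∃ r' > 0, r' ≤ r ∧ r' < δ :=
    ⟨min r (δ/2), lt_min hr (by linarith), min_le_left _ _,
      (min_le_right _ _).trans_lt (by linarith)⟩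
  have hD : closedBall p r' ⊆ SegD η p := by
    intro x hx
    obtain ⟨A, hAb, hA⟩ := hsm p x (by rw [dist_comm]; exact (mem_closedBall.1 hx).trans_lt hr'δ)
    exact ⟨A, hA, ((diam_mono hAb isBounded_ball).trans (diam_ball (by linarith))).trans_lt
      (by linarith)⟩
  have hOo : ∀ c : X, IsOpen {y | y ∈ SegD η p ∧ c ∈ Seg η p y ∧ y ≠ c} := by
    intro c
    rw [isOpen_iff_eventually]
    rintro y ⟨hy, hcy, hyc⟩
    filter_upwards [seg_near hη hu hy (dist c y) (dist_pos.2 hyc.symm),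
      isOpen_ne.mem_nhds hyc] with y' h1 h2
    refine ⟨h1.1, ?_, h2⟩
    rcases h1.2.2 hcy with e | e
    · exact e
    · exact absurd (mem_ball.1 e) (lt_irrefl _)
  have hK : IsCompact (sphere p r') := isClosed_sphere.isCompact
  have hex : ∀ x ∈ sphere p r', ∃ c, c ≠ p ∧ x ∈ {y | y ∈ SegD η p ∧ c ∈ Seg η p y ∧ y ≠ c} := by
    intro x hx
    have hxD := hD (sphere_subset_closedBall hx)
    obtain ⟨c, hc, h1, h2⟩ := (seg_arc hη hu hxD).1.exists_mid (by
      rintro rfl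
      simp at hx
      linarith)
    exact ⟨c, h1, hxD, hc, h2.symm⟩
  choose! c hcp hc using hex
  obtain ⟨t, hcov⟩ := hK.elim_nhds_subcover' (fun x hx => {y | y ∈ SegD η p ∧ c x ∈ Seg η p y ∧ y ≠ c x})
    (fun x hx => (hOo (c x)).mem_nhds (hc x hx))
  set F : Set X := (fun x : sphere p r' => c x) '' (t : Set _) with hF
  have hFf : F.Finite := t.finite_toSet.image _
  set W : Set X := {y | y ∈ ball p r' ∧ ∀ d ∈ F, d ∉ Seg η p y} with hW
  have hWo : IsOpen W := by
    rw [isOpen_iff_eventually]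
    rintro y ⟨hy, hyF⟩
    have h1 : ∀ᶠ y' in 𝓝 y, ∀ d ∈ F, d ∉ Seg η p y' := by
      rw [eventually_all_finite hFf]
      intro d hd
      obtain ⟨s, hs, u, hu', h⟩ := seg_not_mem hη hu (hD (ball_subset_closedBall hy)) (hyF d hd)
      filter_upwards [hs] with y' hy'
      exact h y' hy' d (mem_of_mem_nhds hu')
    filter_upwards [h1, isOpen_ball.mem_nhds hy] with y' h2 h3
    exact ⟨h3, h2⟩
  refine ⟨W, hWo, ⟨mem_ball_self hr', ?_⟩, fun y hy => ball_subset_ball hr'r hy.1, hFf.subset ?_⟩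
  · have : IsArc ({p} : Set X) p p := isArc_refl p
    rw [(seg_eq hη hu this (by simpa)).2]
    rintro _ ⟨x, hx, rfl⟩ h
    exact hcp x x.2 h
  · intro y hy
    rw [hWo.frontier_eq] at hy
    obtain ⟨hycl, hyW⟩ := hy
    have hycb : y ∈ closedBall p r' :=
      closure_ball_subset_closedBall (closure_mono (fun z hz => hz.1) hycl)
    have key : ∀ d ∈ F, ¬ (y ∈ SegD η p ∧ d ∈ Seg η p y ∧ y ≠ d) := by
      intro d hd h
      obtain ⟨y', h1, h2⟩ := mem_closure_iff.1 hycl _ (hOo d) h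
      exact h2.2 d hd h1.2.1
    by_cases hyb : y ∈ ball p r'
    · have : ∃ d ∈ F, d ∈ Seg η p y := by
        by_contra hcon
        push Not at hcon
        exact hyW ⟨hyb, hcon⟩
      obtain ⟨d, hd, hdy⟩ := this
      by_cases e : y = d
      · rw [e]; exact hd
      · exact absurd ⟨hD hycb, hdy, e⟩ (key d hd)
    · have hys : y ∈ sphere p r' := by
        rw [mem_ball, not_lt] at hyb
        exact le_antisymm hycb hyb
      obtain ⟨x, hx, hxy⟩ := mem_iUnion₂.1 (hcov hys)
      exact absurd hxy (key _ ⟨x, hx, rfl⟩)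

theorem exists_contraction [LocallyConnectedSpace X] [Nonempty X] {η : ℝ} (hη : 0 < η)
    (hu : ArcUniq X η) : ∃ Λ : X → X → ℝ → X, (∀ a x, Λ a x 0 = x) ∧ (∀ a x, Λ a x 1 = a) ∧
      ∃ r₀ > 0, ∀ r > 0, r < r₀ → ∃ C : X → Set X, ∃ δ > 0, ∀ c, C c ⊆ ball c r ∧ ball c δ ⊆ C c ∧
        ∀ a ∈ C c, ∀ x ∈ C c, ∀ t ∈ Icc (0:ℝ) 1, Λ a x t ∈ C c ∧
          ∀ (α : Type) (l : Filter α) (f : α → X) (s : α → ℝ), Tendsto f l (𝓝 x) →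
            Tendsto s l (𝓝 t) → (∀ y, s y ∈ Icc (0:ℝ) 1) →
            Tendsto (fun y => Λ a (f y) (s y)) l (𝓝 (Λ a x t)) := by
  classical
  obtain ⟨W, hW1, hW2⟩ := whitney_map X
  set h : X → X → ℝ := fun a x => W (Seg η a x) with hh
  have hcont : ∀ a, ∀ x ∈ SegD η a, Tendsto (h a) (𝓝 x) (𝓝 (h a x)) := by
    intro a x hx
    rw [Metric.tendsto_nhds]
    intro e he
    filter_upwards [seg_near hη hu hx (e/8) (by linarith), ball_mem_nhds x (show 0 < e/8 by linarith)]
      with x' ⟨hx', h1, h2⟩ h3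
    have hA := (seg_arc hη hu hx).1
    have hA' := (seg_arc hη hu hx').1
    have i1 : h a x' ≤ h a x + 2 * (e/4) := by
      refine hW1 _ _ _ ⟨_, hA'.left_mem⟩ ⟨_, hA.left_mem⟩ (fun z hz => ?_)
      rcases h1 hz with q | q
      · exact ⟨z, q, by simp; linarith⟩
      · exact ⟨x, hA.right_mem, by have := mem_ball.1 q; linarith⟩
    have i2 : h a x ≤ h a x' + 2 * (e/4) := by
      refine hW1 _ _ _ ⟨_, hA.left_mem⟩ ⟨_, hA'.left_mem⟩ (fun z hz => ?_)
      rcases h2 hz with q | q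
      · exact ⟨z, q, by simp; linarith⟩
      · refine ⟨x', hA'.right_mem, ?_⟩
        have := mem_ball.1 q
        have := mem_ball.1 h3
        have := dist_triangle_right z x' x
        linarith
    rw [Real.dist_eq, abs_lt]
    constructor <;> linarith
  have hstrict : ∀ a x z, x ∈ SegD η a → z ∈ Seg η a x → z ≠ x → h a z < h a x := by
    intro a x z hx hz hzx
    obtain ⟨h1, h2, h3, h4⟩ := seg_sub hη hu hx hz
    have hA := (seg_arc hη hu hx).1
    have hA' := (seg_arc hη hu h1).1
    exact hW2 _ _ x hA'.isCompact.isClosed ⟨_, hA'.left_mem⟩ h2 hA.right_mem (fun e => hzx (h3 e))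
  have hinj : ∀ a x z w, x ∈ SegD η a → z ∈ Seg η a x → w ∈ Seg η a x → h a z = h a w → z = w := by
    intro a x z w hx hz hw hzw
    by_contra hne
    obtain ⟨h1, h2, h3, h4⟩ := seg_sub hη hu hx hz
    obtain ⟨h1', -⟩ := seg_sub hη hu hx hw
    rcases h4 w hw with e | e
    · exact (hstrict a z w h1 e (Ne.symm hne)).ne hzw.symm
    · exact (hstrict a w z h1' e hne).ne hzw

  have hex : ∀ a x t, x ∈ SegD η a → t ∈ Icc (0:ℝ) 1 →
      ∃ z ∈ Seg η a x, h a z = (1 - t) * h a x + t * h a a := by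
    intro a x t hx ht
    have hA := (seg_arc hη hu hx).1
    have hle : h a a ≤ h a x := by
      by_cases e : a = x
      · rw [← e]
      · exact (hstrict a x a hx hA.left_mem e).le
    have hc : ContinuousOn (h a) (Seg η a x) := fun z hz =>
      (hcont a z (seg_sub hη hu hx hz).1).mono_left nhdsWithin_le_nhds
    obtain ⟨z, hz, e⟩ := hA.isPreconnected.intermediate_value hA.left_mem hA.right_mem hc
      (show (1 - t) * h a x + t * h a a ∈ Icc (h a a) (h a x) from
        ⟨by nlinarith [ht.1, ht.2], by nlinarith [ht.1, ht.2]⟩)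
    exact ⟨z, hz, e⟩
  choose! L hL1 hL2 using hex
  refine ⟨fun a x t => if x ∈ SegD η a then L a x t else if t = 1 then a else x, ?_, ?_, ?_⟩
  · intro a x
    by_cases hx : x ∈ SegD η a
    · simp only [hx, if_true]
      have h0 : (0:ℝ) ∈ Icc (0:ℝ) 1 := by simp
      exact hinj a x _ _ hx (hL1 a x 0 hx h0) (seg_arc hη hu hx).1.right_mem
        (by rw [hL2 a x 0 hx h0]; ring)
    · simp [hx]
  · intro a x
    by_cases hx : x ∈ SegD η a
    · simp only [hx, if_true]
      have h0 : (1:ℝ) ∈ Icc (0:ℝ) 1 := by simp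
      exact hinj a x _ _ hx (hL1 a x 1 hx h0) (seg_arc hη hu hx).1.left_mem
        (by rw [hL2 a x 1 hx h0]; ring)
    · simp [hx]
  · refine ⟨η / 4, by linarith, fun r hr hr0 => ?_⟩
    obtain ⟨δ, hδ, hsm⟩ := small_arcs (X := X) r hr
    refine ⟨fun c => {x | ∃ A ⊆ ball c r, IsArc A c x}, δ, hδ, fun c => ⟨?_, ?_, ?_⟩⟩
    · rintro x ⟨A, hA, hAr⟩
      exact hA hAr.right_mem
    · intro x hx
      exact hsm c x (by rw [dist_comm]; exact hx)
    rintro a ⟨A, hAb, hA⟩ x ⟨B, hBb, hB⟩ t ht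
    obtain ⟨E, hE, hEA⟩ := hA.symm.trans hB
    have hEb : E ⊆ ball c r := hE.trans (union_subset hAb hBb)
    obtain ⟨hxD, hxE⟩ := seg_eq hη hu hEA
      (((diam_mono hEb isBounded_ball).trans (diam_ball hr.le)).trans_lt (by linarith))
    simp only [hxD, if_true]
    refine ⟨?_, ?_⟩
    · have h1 := hL1 a x t hxD ht
      rw [hxE] at h1
      rcases hE h1 with e | e
      · obtain ⟨A', hA', hA2, -⟩ := hA.split e
        exact ⟨A', hA'.trans hAb, hA2⟩
      · obtain ⟨A', hA', hA2, -⟩ := hB.split e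
        exact ⟨A', hA'.trans hBb, hA2⟩
    · intro α l f s hf hs hsI
      have hev : ∀ᶠ y in l, f y ∈ SegD η a := hf ((segD_open hη hu a).mem_nhds hxD)
      have : Tendsto (fun y => L a (f y) (s y)) l (𝓝 (L a x t)) := by
        rw [tendsto_iff_ultrafilter]
        intro U hU
        obtain ⟨z', -, hz'⟩ := isCompact_univ.ultrafilter_le_nhds (U.map (fun y => L a (f y) (s y)))
          (by simp)
        have hz'' : Tendsto (fun y => L a (f y) (s y)) U (𝓝 z') := hz'
        have hfU := hf.mono_left hU
        have hsU := hs.mono_left hU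
        have hevU := hev.filter_mono hU
        have hz'S : z' ∈ Seg η a x := by
          by_contra hcon
          obtain ⟨u, hu1, v, hv, huv⟩ := seg_not_mem hη hu hxD hcon
          obtain ⟨y, h1, h2, h3⟩ := ((hfU.eventually_mem hu1).and ((hz''.eventually_mem hv).and hevU)).exists
          exact huv _ h1 _ h2 (hL1 a _ _ h3 (hsI y))
        have e1 : Tendsto (fun y => h a (L a (f y) (s y))) U (𝓝 (h a z')) :=
          (hcont a z' (seg_sub hη hu hxD hz'S).1).comp hz''
        have e2 : Tendsto (fun y => (1 - s y) * h a (f y) + s y * h a a) U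
            (𝓝 ((1 - t) * h a x + t * h a a)) :=
          ((tendsto_const_nhds.sub hsU).mul ((hcont a x hxD).comp hfU)).add
            (hsU.mul tendsto_const_nhds)
        have e3 : (fun y => h a (L a (f y) (s y))) =ᶠ[U] fun y => (1 - s y) * h a (f y) + s y * h a a := by
          filter_upwards [hevU] with y hy
          exact hL2 a _ _ hy (hsI y)
        have e4 := tendsto_nhds_unique (e1.congr' e3) e2
        have : z' = L a x t := hinj a x _ _ hxD hz'S (hL1 a x t hxD ht)
          (by rw [e4, hL2 a x t hxD ht])
        rwa [this] at hz''
      refine this.congr' ?_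
      filter_upwards [hev] with y hy
      simp [hy]

end Seg

theorem glue_aux {X O : Type} [TopologicalSpace X] [TopologicalSpace O] [Nonempty X]
    (s : BumpCovering ℕ O univ)
    (a : ℕ → X) (Λ : X → X → ℝ → X) (h0 : ∀ a x, Λ a x 0 = x) (h1 : ∀ a x, Λ a x 1 = a) :
    ∃ Q : O → X, ∀ C : Set X, (∀ a ∈ C, ∀ x ∈ C, ∀ t ∈ Icc (0:ℝ) 1, Λ a x t ∈ C ∧
          ∀ (α : Type) (l : Filter α) (f : α → X) (s : α → ℝ), Tendsto f l (𝓝 x) →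
            Tendsto s l (𝓝 t) → (∀ y, s y ∈ Icc (0:ℝ) 1) →
            Tendsto (fun y => Λ a (f y) (s y)) l (𝓝 (Λ a x t))) →
      ∀ y, (∀ n, y ∈ tsupport (s n) → a n ∈ C) → Q y ∈ C ∧ ContinuousAt Q y := by
  obtain ⟨x0⟩ := ‹Nonempty X›
  set q : ℕ → O → X := fun n => Nat.rec (fun _ => x0) (fun n g y => Λ (a n) (g y) (s n y)) n with hq
  have hqs : ∀ n y, q (n+1) y = Λ (a n) (q n y) (s n y) := fun n y => rfl
  have hloc : ∀ y, ∃ M, ∀ᶠ y' in 𝓝 y, ∀ n ≥ M, q n y' = q M y' := by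
    intro y
    obtain ⟨N, hN, hfin⟩ := s.locallyFinite y
    obtain ⟨M, hM⟩ := hfin.bddAbove
    refine ⟨M + 1, ?_⟩
    filter_upwards [hN] with y' hy' n hn
    induction n, hn using Nat.le_induction with
    | base => rfl
    | succ n hn ih =>
      rw [hqs]
      have : s n y' = 0 := by
        by_contra hne
        have := hM (show n ∈ _ from ⟨y', hne, hy'⟩)
        omega
      rw [this, h0, ih]
  choose m hm using hloc
  refine ⟨fun y => q (m y) y, fun C hC y hy => ?_⟩
  have hQ : ∀ n ≥ m y, (fun y => q (m y) y) =ᶠ[𝓝 y] q n := by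
    intro n hn
    filter_upwards [hm y] with y' hy'
    have e1 := (hm y').self_of_nhds
    rw [← e1 (max (m y') n) (le_max_left _ _), hy' _ (hn.trans (le_max_right _ _)), hy' n hn]
  obtain ⟨n0, hn0⟩ := s.eventuallyEq_one' y (mem_univ y)
  replace hn0 : (s n0 : O → ℝ) =ᶠ[𝓝 y] 1 := hn0
  have key : ∀ n ≥ n0 + 1, q n y ∈ C ∧ ContinuousAt (q n) y := by
    intro n hn
    induction n, hn using Nat.le_induction with
    | base =>
      have hE : q (n0 + 1) =ᶠ[𝓝 y] fun _ => a n0 := by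
        filter_upwards [hn0] with y' hy'
        rw [hqs, hy']; exact h1 _ _
      refine ⟨?_, (continuousAt_const).congr hE.symm⟩
      rw [hE.self_of_nhds]
      apply hy
      apply subset_tsupport
      rw [Function.mem_support, hn0.self_of_nhds]
      exact one_ne_zero
    | succ n hn ih =>
      by_cases hsup : y ∈ tsupport (s n)
      · obtain ⟨e1, e2⟩ := hC _ (hy n hsup) _ ih.1 (s n y) ⟨s.nonneg n y, s.le_one n y⟩
        exact ⟨e1, e2 O (𝓝 y) (q n) (s n) ih.2 ((s n).continuous.continuousAt)
          (fun y => ⟨s.nonneg n y, s.le_one n y⟩)⟩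
      · have hE : q (n + 1) =ᶠ[𝓝 y] q n := by
          filter_upwards [notMem_tsupport_iff_eventuallyEq.1 hsup] with y' hy'
          rw [hqs, hy']; exact h0 _ _
        exact ⟨by rw [hE.self_of_nhds]; exact ih.1, ih.2.congr hE.symm⟩
  have hE := hQ (max (m y) (n0+1)) (le_max_left _ _)
  have hk := key (max (m y) (n0+1)) (le_max_right _ _)
  exact ⟨by rw [hE.self_of_nhds]; exact hk.1, hk.2.congr hE.symm⟩

theorem anr_of_uniq (X : Type) [MetricSpace X] [CompactSpace X] [LocallyConnectedSpace X] {η : ℝ}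
    (hη : 0 < η) (hu : ArcUniq X η) : IsANRSpace X := by
  classical
  intro Y tY cY mY Z hZ f
  rcases Z.eq_empty_or_nonempty with hZe | hZn
  · subst hZe
    exact ⟨∅, subset_rfl, isClosed_empty, by simp, f, fun z hz => hz.elim⟩
  by_cases hO : Nonempty (Zᶜ : Set Y)
  swap
  · have hZu : Z = univ := by
      rw [nonempty_subtype, not_exists] at hO
      exact eq_univ_of_forall fun y => not_not.1 (hO y)
    subst hZu
    exact ⟨univ, subset_rfl, isClosed_univ, by simp, f, fun z hz => rfl⟩
  letI : MetricSpace Y := TopologicalSpace.metrizableSpaceMetric Y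
  obtain ⟨z0, hz0⟩ := hZn
  haveI : Nonempty X := ⟨f ⟨z0, hz0⟩⟩
  have hZn : Z.Nonempty := ⟨z0, hz0⟩
  obtain ⟨Λ, hΛ0, hΛ1, r₀, hr₀, hΛ⟩ := exists_contraction hη hu
  haveI : TopologicalSpace.SeparableSpace (Zᶜ : Set Y) := inferInstance
  set u : ℕ → (Zᶜ : Set Y) := TopologicalSpace.denseSeq _ with hudef
  have hud : DenseRange u := TopologicalSpace.denseRange_denseSeq _
  have hpos : ∀ y : (Zᶜ : Set Y), 0 < infDist (y:Y) Z := fun y =>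
    (hZ.notMem_iff_infDist_pos hZn).1 y.2
  have hcov : (univ : Set (Zᶜ : Set Y)) ⊆ ⋃ n, ball (u n) (infDist (u n : Y) Z / 2) := by
    intro y _
    obtain ⟨n, hn⟩ := hud.exists_dist_lt y (show 0 < infDist (y:Y) Z / 4 by linarith [hpos y])
    refine mem_iUnion.2 ⟨n, ?_⟩
    rw [mem_ball]
    have h1 := infDist_le_infDist_add_dist (s := Z) (x := (y:Y)) (y := (u n : Y))
    have h2 : dist (y:Y) (u n) = dist y (u n) := rfl
    linarith [hpos y]
  obtain ⟨s, hs⟩ := BumpCovering.exists_isSubordinate isClosed_univ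
    (fun n => ball (u n) (infDist (u n : Y) Z / 2)) (fun n => isOpen_ball) hcov
  have hπ : ∀ y : Y, ∃ z ∈ Z, infDist y Z = dist y z :=
    fun y => hZ.isCompact.exists_infDist_eq_dist hZn y
  choose π hπZ hπ using hπ
  set a : ℕ → X := fun n => f ⟨π (u n), hπZ _⟩ with ha
  obtain ⟨Q, hQ⟩ := glue_aux s a Λ hΛ0 hΛ1
  haveI : CompactSpace Z := isCompact_iff_compactSpace.1 hZ.isCompact
  have huc : UniformContinuous f := CompactSpace.uniformContinuous_of_continuous f.continuous
  rw [Metric.uniformContinuous_iff] at huc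
  -- main local statement
  have main : ∀ r > 0, r < r₀ → ∃ ρ > 0, ∀ z : Z, (∀ z' : Z, dist (z':Y) z < ρ → dist (f z') (f z) < r) ∧
      ∀ y : (Zᶜ : Set Y), dist (y:Y) z < ρ → dist (Q y) (f z) < r ∧ ContinuousAt Q y := by
    intro r hr hrr
    obtain ⟨C, δ, hδ, hC⟩ := hΛ r hr hrr
    obtain ⟨ρ, hρ, hf⟩ := huc δ hδ
    refine ⟨ρ / 8, by linarith, fun z => ⟨fun z' hz' => ?_, fun y hy => ?_⟩⟩
    · have : dist z' z < ρ := by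
        have : dist (z':Y) z = dist z' z := rfl
        linarith
      exact (hC (f z)).1 ((hC (f z)).2.1 (hf this))
    · obtain ⟨h1, h2, h3⟩ := hC (f z)
      have := hQ (C (f z)) h3 y (fun n hn => by
        apply h2
        apply hf
        have e1 := hs n hn
        rw [mem_ball] at e1
        have e2 : dist (y:Y) (u n) = dist y (u n) := rfl
        have e3 := hπ (u n)
        have e4 := infDist_le_infDist_add_dist (s := Z) (x := (u n:Y)) (y := (y : Y))
        have e5 : infDist (y:Y) Z ≤ dist (y:Y) z := infDist_le_dist_of_mem z.2
        show dist (π (u n)) (z:Y) < ρ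
        have e6 := dist_triangle (π (u n)) (u n : Y) (z:Y)
        have e7 := dist_triangle (u n : Y) (y:Y) (z:Y)
        have e8 := dist_comm (π (u n)) (u n : Y)
        rw [dist_comm (u n : Y) (y:Y)] at e7 e4
        linarith)
      exact ⟨h1 this.1, this.2⟩
  obtain ⟨ρ, hρ, hmain⟩ := main (r₀/2) (by linarith) (by linarith)
  set g : Y → X := fun y => if hy : y ∈ Z then f ⟨y, hy⟩ else Q ⟨y, hy⟩ with hg
  have hgc : ∀ y, infDist y Z < ρ → ContinuousAt g y := by
    intro y hy
    by_cases hyZ : y ∈ Z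
    · rw [Metric.continuousAt_iff]
      intro e he
      obtain ⟨ρ', hρ', hm⟩ := main (min (r₀/2) e) (lt_min (by linarith) he)
        ((min_le_left _ _).trans_lt (by linarith))
      refine ⟨ρ', hρ', fun {x} hx => ?_⟩
      have hgy : g y = f ⟨y, hyZ⟩ := by simp [hg, hyZ]
      rw [hgy]
      refine lt_of_lt_of_le ?_ (min_le_right (r₀/2) e)
      by_cases hxZ : x ∈ Z
      · have : g x = f ⟨x, hxZ⟩ := by simp [hg, hxZ]
        rw [this]
        exact (hm ⟨y, hyZ⟩).1 ⟨x, hxZ⟩ hx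
      · have : g x = Q ⟨x, hxZ⟩ := by simp [hg, hxZ]
        rw [this]
        exact ((hm ⟨y, hyZ⟩).2 ⟨x, hxZ⟩ hx).1
    · have h1 := ((hmain ⟨π y, hπZ y⟩).2 ⟨y, hyZ⟩ (by show dist y (π y) < ρ; rw [← hπ]; exact hy)).2
      have h2 : g ∘ (Subtype.val : (Zᶜ : Set Y) → Y) = Q := by
        funext x
        have hx : (x:Y) ∉ Z := x.2
        simp [hg, hx]
      rw [← h2] at h1
      exact (hZ.isOpen_compl.isOpenEmbedding_subtypeVal.continuousAt_iff).1 h1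
  have hsub : {y | infDist y Z < ρ/2} ⊆ {y | infDist y Z ≤ ρ/2} := by
    intro y hy
    exact le_of_lt (show infDist y Z < ρ/2 from hy)
  have hZ0 : ∀ z ∈ Z, infDist z Z = 0 := fun z hz => infDist_zero_of_mem hz
  refine ⟨{y | infDist y Z ≤ ρ/2}, fun z hz => ?_, ?_, ?_, ⟨fun y => g y, ?_⟩, ?_⟩
  · show infDist z Z ≤ ρ/2
    rw [hZ0 z hz]; linarith
  · exact isClosed_le (continuous_infDist_pt Z) continuous_const
  · intro z hz
    refine interior_maximal hsub (isOpen_lt (continuous_infDist_pt Z) continuous_const) ?_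
    show infDist z Z < ρ/2
    rw [hZ0 z hz]; linarith
  · rw [continuous_iff_continuousAt]
    rintro ⟨y, hy⟩
    have hy' : infDist y Z ≤ ρ/2 := hy
    have hgy : ContinuousAt g y := hgc y (by linarith)
    exact Tendsto.comp hgy continuousAt_subtype_val
  · intro z hz
    simp [hg, hz]

theorem dim_of_uniq (X : Type) [MetricSpace X] [CompactSpace X] [LocallyConnectedSpace X] {η : ℝ}
    (hη : 0 < η) (hu : ArcUniq X η) : CovDimLE X 1 := by
  classical
  intro U hUo hUc
  have h1 : ∀ p : X, ∃ u ∈ U, p ∈ u := fun p => by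
    have : p ∈ ⋃₀ U := hUc ▸ mem_univ p
    exact this
  choose u huU hpu using h1
  have h2 : ∀ p : X, ∃ W : Set X, IsOpen W ∧ p ∈ W ∧ W ⊆ u p ∧ (frontier W).Finite := by
    intro p
    obtain ⟨r, hr, hb⟩ := Metric.isOpen_iff.1 (hUo _ (huU p)) p (hpu p)
    obtain ⟨W, a1, a2, a3, a4⟩ := small_frontier hη hu p r hr
    exact ⟨W, a1, a2, a3.trans hb, a4⟩
  choose W hWo hpW hWu hWf using h2
  obtain ⟨t, ht⟩ := isCompact_univ.elim_nhds_subcover W (fun p _ => (hWo p).mem_nhds (hpW p))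
  set F : Set X := ⋃ p ∈ t, frontier (W p) with hF
  have hFf : F.Finite := t.finite_toSet.biUnion (fun p _ => hWf p)
  obtain ⟨N0, hN0, hNd⟩ := hFf.t2_separation
  set N : X → Set X := fun p => N0 p ∩ u p with hN
  set V : X → Set X := fun x => {y | y ∉ F ∧ ∀ p ∈ t, (y ∈ W p ↔ x ∈ W p)} with hV
  have hVo : ∀ x, IsOpen (V x) := by
    intro x
    rw [isOpen_iff_eventually]
    rintro y ⟨hyF, hy⟩
    have e1 : ∀ᶠ y' in 𝓝 y, y' ∉ F := hFf.isClosed.isOpen_compl.mem_nhds hyF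
    have e2 : ∀ᶠ y' in 𝓝 y, ∀ p ∈ t, (y' ∈ W p ↔ x ∈ W p) := by
      rw [Finset.eventually_all]
      intro p hp
      by_cases hyW : y ∈ W p
      · filter_upwards [(hWo p).mem_nhds hyW] with y' hy'
        exact ⟨fun _ => (hy p hp).1 hyW, fun _ => hy'⟩
      · have hcl : y ∉ closure (W p) := by
          intro hc
          apply hyF
          refine mem_iUnion₂.2 ⟨p, hp, ?_⟩
          rw [(hWo p).frontier_eq]
          exact ⟨hc, hyW⟩
        filter_upwards [isClosed_closure.isOpen_compl.mem_nhds hcl] with y' hy'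
        exact ⟨fun h => absurd (subset_closure h) hy', fun h => absurd ((hy p hp).2 h) hyW⟩
    filter_upwards [e1, e2] with y' a b
    exact ⟨a, b⟩
  have hVeq : ∀ x y, y ∈ V x → V x = V y := by
    rintro x y ⟨-, hy⟩
    ext w
    constructor
    · rintro ⟨a, b⟩
      exact ⟨a, fun p hp => (b p hp).trans (hy p hp).symm⟩
    · rintro ⟨a, b⟩
      exact ⟨a, fun p hp => (b p hp).trans (hy p hp)⟩
  refine ⟨V '' Fᶜ ∪ N '' F, ?_, ?_, ?_, ?_⟩
  · rintro v (⟨x, -, rfl⟩ | ⟨x, -, rfl⟩)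
    · exact hVo x
    · exact (hN0 x).2.inter (hUo _ (huU x))
  · refine eq_univ_of_forall fun x => ?_
    by_cases hx : x ∈ F
    · exact ⟨N x, Or.inr ⟨x, hx, rfl⟩, (hN0 x).1, hpu x⟩
    · exact ⟨V x, Or.inl ⟨x, hx, rfl⟩, hx, fun _ _ => Iff.rfl⟩
  · rintro v (⟨x, -, rfl⟩ | ⟨x, -, rfl⟩)
    · obtain ⟨p, hp, hxp⟩ := mem_iUnion₂.1 (ht.2 (mem_univ x))
      exact ⟨u p, huU p, fun y hy => hWu p ((hy.2 p hp).2 hxp)⟩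
    · exact ⟨u x, huU x, inter_subset_right⟩
  · intro x
    have hex : ∃ A B : Set X, {v ∈ V '' Fᶜ ∪ N '' F | x ∈ v} ⊆ {A, B} := by
      by_cases hxN : ∃ p ∈ F, x ∈ N p
      · obtain ⟨p, hp, hxp⟩ := hxN
        refine ⟨V x, N p, ?_⟩
        rintro v ⟨⟨y, hy, rfl⟩ | ⟨y, hy, rfl⟩, hxv⟩
        · left; exact hVeq y x hxv
        · right
          by_contra hne
          have : y ≠ p := by rintro rfl; exact hne rfl
          exact disjoint_left.1 (hNd hy hp this) hxv.1 hxp.1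
      · refine ⟨V x, V x, ?_⟩
        rintro v ⟨⟨y, hy, rfl⟩ | ⟨y, hy, rfl⟩, hxv⟩
        · left; exact hVeq y x hxv
        · exact absurd ⟨y, hy, hxv⟩ hxN
    obtain ⟨A, B, hAB⟩ := hex
    have hfin : ({A, B} : Set (Set X)).Finite := by simp
    exact ⟨hfin.subset hAB, (ncard_le_ncard hAB hfin).trans ((ncard_insert_le A {B}).trans (by rw [ncard_singleton]))⟩

theorem arcUniq_of {X : Type} [MetricSpace X] [CompactSpace X] {ε : ℝ}
    (hX : ∀ ι : Circle → X, Topology.IsEmbedding ι → ε ≤ Metric.diam (Set.range ι)) :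
    ArcUniq X (ε / 4) := by
  intro A B a b hA hB hd
  exact arc_unique hX hA hB (by linarith)

end WardProof

/-- Ward's theorem: a Peano space (compact, locally connected metric space)
containing arbitrarily small circles is not a one-dimensional ANR; conversely,
a Peano space containing no arbitrarily small circles is an ANR of covering
dimension at most one. -/
theorem ward_small_circles
    (X : Type) [MetricSpace X] [CompactSpace X] [LocallyConnectedSpace X] :
    ((∀ ε > (0 : ℝ), ∃ ι : Circle → X, Topology.IsEmbedding ι ∧
        Metric.diam (Set.range ι) < ε) → ¬ (IsANRSpace X ∧ CovDimLE X 1)) ∧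
    ((∃ ε > (0 : ℝ), ∀ ι : Circle → X, Topology.IsEmbedding ι →
        ε ≤ Metric.diam (Set.range ι)) → (IsANRSpace X ∧ CovDimLE X 1)) := by
  refine ⟨ward_part_one X, ?_⟩
  rintro ⟨ε, hε, hX⟩
  have hη : 0 < ε / 4 := by linarith
  exact ⟨anr_of_uniq X hη (arcUniq_of hX), dim_of_uniq X hη (arcUniq_of hX)⟩
end

section
/- Let 0 → I → A → B → 0 be a short exact sequence of C*-algebras where I is N-subhomogeneous, and let τ : B → M(I)/I be the associated Busby map. Then the boundary of Prim(I) in Prim(A) is finite if and only if the image τ(B) is a finite-dimensional C*-algebra. -/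
/-- A representation of a C*-algebra `A` on a Hilbert space. -/
structure HilbertRep (A : Type) [NonUnitalNormedRing A] [StarRing A]
    [NormedSpace ℂ A] [IsScalarTower ℂ A A] [SMulCommClass ℂ A A] where
  carrier : Type
  [ng : NormedAddCommGroup carrier]
  [ip : InnerProductSpace ℂ carrier]
  [cs : CompleteSpace carrier]
  π : A →⋆ₙₐ[ℂ] (carrier →L[ℂ] carrier)

attribute [instance] HilbertRep.ng HilbertRep.ip HilbertRep.cs

variable {A : Type} [NonUnitalNormedRing A] [StarRing A] [CStarRing A]
  [NormedSpace ℂ A] [IsScalarTower ℂ A A] [SMulCommClass ℂ A A]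
  [StarModule ℂ A] [CompleteSpace A]

/-- A representation is (topologically) irreducible if it is nonzero and has
no nontrivial closed invariant subspaces. -/
def HilbertRep.IsIrreducible (ρ : HilbertRep A) : Prop :=
  ρ.π ≠ 0 ∧ ∀ V : Submodule ℂ ρ.carrier, IsClosed (V : Set ρ.carrier) →
    (∀ a : A, ∀ v ∈ V, ρ.π a v ∈ V) → V = ⊥ ∨ V = ⊤

/-- A subset of `A` is a primitive ideal if it is the kernel of an irreducible
representation on some Hilbert space. -/
def IsPrimitive (P : Set A) : Prop :=
  ∃ ρ : HilbertRep A, ρ.IsIrreducible ∧ P = {a : A | ρ.π a = 0}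

/-- The primitive ideal space of `A`. -/
def PrimSpace (A : Type) [NonUnitalNormedRing A] [StarRing A] [CStarRing A]
    [NormedSpace ℂ A] [IsScalarTower ℂ A A] [SMulCommClass ℂ A A]
    [StarModule ℂ A] [CompleteSpace A] : Type :=
  {P : Set A // IsPrimitive P}

/-- The Jacobson (hull-kernel) topology on the primitive ideal space: the open
sets are generated by the complements of hulls of subsets. -/
instance : TopologicalSpace (PrimSpace A) :=
  TopologicalSpace.generateFrom
    {U : Set (PrimSpace A) | ∃ S : Set A, U = {J : PrimSpace A | ¬ S ⊆ J.1}}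

open scoped Pointwise

section StatesAndIrreps

open scoped ComplexOrder InnerProductSpace

/-- A norm-one unital functional on a C*-algebra is positive. -/
theorem aux_pos {D : Type} [CStarAlgebra D] [PartialOrder D] [StarOrderedRing D]
    (φ : StrongDual ℂ D) (hφ : ‖φ‖ ≤ 1) (h1 : φ 1 = 1) (x : D) (hx : 0 ≤ x) : 0 ≤ φ x := by
  have hle : ∀ y : D, ‖φ y‖ ≤ ‖y‖ := fun y => by
    simpa using φ.le_of_opNorm_le hφ y
  have hsa : IsSelfAdjoint x := IsSelfAdjoint.of_nonneg hx
  have him : (φ x).im = 0 := by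
    have key : ∀ t : ℝ, (φ x).im ^ 2 + 2 * (φ x).im * t ≤ ‖x‖ ^ 2 * ‖(1 : D)‖ ^ 0
        + t ^ 2 * ‖(1 : D)‖ - t ^ 2 := by
      intro t
      have h2 := hle (x + (t * Complex.I : ℂ) • (1 : D))
      have h3 : ‖x + (t * Complex.I : ℂ) • (1 : D)‖ ^ 2 ≤ ‖x‖ ^ 2 + t ^ 2 * ‖(1 : D)‖ := by
        rw [sq, ← CStarRing.norm_star_mul_self]
        have : star (x + (t * Complex.I : ℂ) • (1 : D)) * (x + (t * Complex.I : ℂ) • (1 : D))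
            = x * x + ((t ^ 2 : ℝ) : ℂ) • (1 : D) := by
          simp only [star_add, star_smul, hsa.star_eq, star_one, add_mul, mul_add, smul_mul_assoc,
            mul_smul_comm, one_mul, mul_one]
          have e1 : star ((t : ℂ) * Complex.I) = -(t * Complex.I) := by simp
          have e2 : -((t : ℂ) * Complex.I) * (t * Complex.I) = ((t ^ 2 : ℝ) : ℂ) := by
            push_cast; linear_combination (-(t:ℂ)^2) * Complex.I_mul_I
          rw [e1, ← e2]
          module
        rw [this]
        refine (norm_add_le _ _).trans ?_
        rw [norm_smul]
        have := norm_mul_le x x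
        simp only [Complex.norm_real, norm_pow, Real.norm_eq_abs, sq_abs]
        nlinarith
      have h4 : ‖φ (x + (t * Complex.I : ℂ) • (1 : D))‖ ^ 2 ≤ ‖x + (t * Complex.I : ℂ) • (1 : D)‖ ^ 2 := by
        gcongr
      have h5 : ((φ x).im + t) ^ 2 ≤ ‖φ (x + (t * Complex.I : ℂ) • (1 : D))‖ ^ 2 := by
        rw [map_add, map_smul, h1, ← Complex.normSq_eq_norm_sq, Complex.normSq_apply]
        simp
        nlinarith [mul_self_nonneg (φ x).re]
      nlinarith
    have hone : ‖(1 : D)‖ ≤ 1 := by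
      rcases subsingleton_or_nontrivial D with h | h
      · simp [Subsingleton.elim (1 : D) 0]
      · simp
    have key2 : ∀ t : ℝ, (φ x).im ^ 2 + 2 * (φ x).im * t ≤ ‖x‖ ^ 2 := by
      intro t
      have := key t
      have : t ^ 2 * ‖(1 : D)‖ ≤ t ^ 2 * 1 := by gcongr
      simp only [pow_zero, mul_one] at *
      linarith
    by_contra hne
    have := key2 ((‖x‖ ^ 2 + 1) / (φ x).im)
    have e : 2 * (φ x).im * ((‖x‖ ^ 2 + 1) / (φ x).im) = 2 * (‖x‖ ^ 2 + 1) := by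
      field_simp
    rw [e] at this
    nlinarith [sq_nonneg (φ x).im, sq_nonneg ‖x‖]
  have hre : 0 ≤ (φ x).re := by
    have h0 : ‖algebraMap ℝ D ‖x‖ - x‖ ≤ ‖x‖ := by
      rw [CStarAlgebra.norm_le_iff_le_algebraMap _ (norm_nonneg x)
        (sub_nonneg.2 (IsSelfAdjoint.le_algebraMap_norm_self hsa))]
      simpa using hx
    have h2 := (hle (algebraMap ℝ D ‖x‖ - x)).trans h0
    have h3 : φ (algebraMap ℝ D ‖x‖) = (‖x‖ : ℂ) := by
      rw [Algebra.algebraMap_eq_smul_one, ← Complex.coe_smul, map_smul, h1]; simp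
    rw [map_sub, h3] at h2
    have h4 := (Complex.re_le_norm _).trans h2
    simp at h4
    exact h4
  rw [Complex.nonneg_iff]
  exact ⟨hre, him.symm⟩

/-- The extreme functional norming a positive element of norm one. -/
theorem aux_extreme {D : Type} [CStarAlgebra D] (a : D) (ha : ‖a‖ = 1) :
    ∃ φ : StrongDual ℂ D, ‖φ‖ ≤ 1 ∧ φ a = 1 ∧
      ∀ (ψ₁ ψ₂ : StrongDual ℂ D) (s t : ℝ), ‖ψ₁‖ ≤ 1 → ‖ψ₂‖ ≤ 1 → 0 < s → 0 < t → s + t = 1 →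
        (∀ x, (s : ℂ) * ψ₁ x + (t : ℂ) * ψ₂ x = φ x) → ψ₁ = φ := by
  let K : Set (WeakDual ℂ D) :=
    (WeakDual.toStrongDual ⁻¹' Metric.closedBall 0 1) ∩ {φ | φ a = 1}
  have hK : IsCompact K := (WeakDual.isCompact_closedBall 0 1).inter_right
    (isClosed_eq (WeakDual.eval_continuous a) continuous_const)
  let T : Set (D → ℂ) := (fun (x : WeakDual ℂ D) y => x y) '' K
  have hT : IsCompact T := hK.image WeakDual.coeFn_continuous
  have hTne : T.Nonempty := by
    obtain ⟨g, hg, hga⟩ := exists_dual_vector ℂ a (by simp [ha])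
    refine ⟨_, StrongDual.toWeakDual g, ⟨?_, ?_⟩, rfl⟩
    · simp [hg]
    · simp [hga, ha]
  obtain ⟨f, hf⟩ := hT.extremePoints_nonempty hTne
  rw [mem_extremePoints] at hf
  obtain ⟨⟨φ, ⟨hφ1, hφa⟩, rfl⟩, hext⟩ := hf
  have hmem : ∀ ψ : StrongDual ℂ D, ‖ψ‖ ≤ 1 → ψ a = 1 → (ψ : D → ℂ) ∈ T := by
    intro ψ h1 h2
    exact ⟨StrongDual.toWeakDual ψ, ⟨by simpa using h1, h2⟩, rfl⟩
  refine ⟨WeakDual.toStrongDual φ, by simpa using hφ1, hφa, ?_⟩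
  intro ψ₁ ψ₂ s t h1 h2 hs ht hst hsum
  have n1 : ‖ψ₁ a‖ ≤ 1 := by simpa [ha] using ψ₁.le_of_opNorm_le h1 a
  have n2 : ‖ψ₂ a‖ ≤ 1 := by simpa [ha] using ψ₂.le_of_opNorm_le h2 a
  have hsa := hsum a
  have hφa' : WeakDual.toStrongDual φ a = 1 := hφa
  rw [hφa'] at hsa
  have hsr := congrArg Complex.re hsa
  simp at hsr
  have r1 := (Complex.re_le_norm (ψ₁ a)).trans n1
  have r2 := (Complex.re_le_norm (ψ₂ a)).trans n2
  have q1 : (ψ₁ a).re = 1 := by nlinarith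
  have q2 : (ψ₂ a).re = 1 := by nlinarith
  have full : ∀ z : ℂ, ‖z‖ ≤ 1 → z.re = 1 → z = 1 := by
    intro z hz hr
    have := Complex.sq_norm z
    rw [Complex.normSq_apply, hr] at this
    have : z.im = 0 := by nlinarith [norm_nonneg z, mul_self_nonneg z.im]
    apply Complex.ext <;> simp [*]
  have := hext _ (hmem ψ₁ h1 (full _ n1 q1)) _ (hmem ψ₂ h2 (full _ n2 q2))
    ⟨s, t, hs, ht, hst, by
      funext x
      have := hsum x
      simpa using this⟩
  ext x
  exact congrFun this.1 x

end StatesAndIrreps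

section IrrepExistence

open scoped ComplexOrder InnerProductSpace

theorem aux_inner_star {D : Type} [NonUnitalCStarAlgebra D] {H : Type} [NormedAddCommGroup H]
    [InnerProductSpace ℂ H] [CompleteSpace H] (π : D →⋆ₙₐ[ℂ] (H →L[ℂ] H)) (x : D) (v w : H) :
    ⟪v, π x w⟫_ℂ = ⟪π (star x) v, w⟫_ℂ := by
  rw [map_star, ContinuousLinearMap.star_eq_adjoint, ContinuousLinearMap.adjoint_inner_left]

theorem aux_norm_le {D : Type} [NonUnitalCStarAlgebra D] {H : Type} [NormedAddCommGroup H]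
    [InnerProductSpace ℂ H] [CompleteSpace H] (π : D →⋆ₙₐ[ℂ] (H →L[ℂ] H)) (x : D) :
    ‖π x‖ ≤ ‖x‖ := NonUnitalStarAlgHom.norm_apply_le π x

theorem aux_vector_functional {D : Type} [NonUnitalCStarAlgebra D] {H : Type}
    [NormedAddCommGroup H] [InnerProductSpace ℂ H] [CompleteSpace H]
    (π : D →⋆ₙₐ[ℂ] (H →L[ℂ] H)) (v : H) (hv : v ≠ 0) :
    ∃ ψ : StrongDual ℂ D, ‖ψ‖ ≤ 1 ∧ ∀ x, ((‖v‖ ^ 2 : ℝ) : ℂ) * ψ x = ⟪v, π x v⟫_ℂ := by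
  have hv' : 0 < ‖v‖ := norm_pos_iff.2 hv
  let l : D →ₗ[ℂ] ℂ :=
    { toFun := fun x => (((‖v‖ ^ 2)⁻¹ : ℝ) : ℂ) * ⟪v, π x v⟫_ℂ
      map_add' := fun x y => by simp [mul_add]
      map_smul' := fun r x => by simp; ring }
  refine ⟨l.mkContinuous 1 ?_, LinearMap.mkContinuous_norm_le _ zero_le_one _, ?_⟩
  · intro x
    have h1 : ‖⟪v, π x v⟫_ℂ‖ ≤ ‖v‖ * (‖x‖ * ‖v‖) := by
      refine (norm_inner_le_norm _ _).trans ?_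
      gcongr
      exact (π x).le_of_opNorm_le (aux_norm_le π x) v
    change ‖(((‖v‖ ^ 2)⁻¹ : ℝ) : ℂ) * ⟪v, π x v⟫_ℂ‖ ≤ _
    rw [norm_mul, Complex.norm_real, Real.norm_of_nonneg (by positivity)]
    calc (‖v‖ ^ 2)⁻¹ * ‖⟪v, π x v⟫_ℂ‖ ≤ (‖v‖ ^ 2)⁻¹ * (‖v‖ * (‖x‖ * ‖v‖)) := by gcongr
      _ = 1 * ‖x‖ := by field_simp
  · intro x
    change ((‖v‖ ^ 2 : ℝ) : ℂ) * ((((‖v‖ ^ 2)⁻¹ : ℝ) : ℂ) * ⟪v, π x v⟫_ℂ) = _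
    have : ((‖v‖ : ℝ) : ℂ) ≠ 0 := by exact_mod_cast hv'.ne'
    push_cast
    field_simp

theorem aux_irred {D : Type} [NonUnitalCStarAlgebra D] {H : Type} [NormedAddCommGroup H]
    [InnerProductSpace ℂ H] [CompleteSpace H] (π : D →⋆ₙₐ[ℂ] (H →L[ℂ] H)) (ξ : H)
    (hξ : ‖ξ‖ = 1)
    (hcyc : ∀ V : Submodule ℂ H, IsClosed (V : Set H) → (∀ x, π x ξ ∈ V) → V = ⊤)
    (φ : StrongDual ℂ D) (hφ : ∀ x, φ x = ⟪ξ, π x ξ⟫_ℂ)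
    (hext : ∀ (ψ₁ ψ₂ : StrongDual ℂ D) (s t : ℝ), ‖ψ₁‖ ≤ 1 → ‖ψ₂‖ ≤ 1 → 0 < s → 0 < t →
      s + t = 1 → (∀ x, (s : ℂ) * ψ₁ x + (t : ℂ) * ψ₂ x = φ x) → ψ₁ = φ)
    (V : Submodule ℂ H) (hV : IsClosed (V : Set H)) (hinv : ∀ x, ∀ v ∈ V, π x v ∈ V) :
    V = ⊥ ∨ V = ⊤ := by
  have : CompleteSpace V := hV.completeSpace_coe
  have hinv' : ∀ x, ∀ v ∈ Vᗮ, π x v ∈ Vᗮ := by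
    intro x v hv
    rw [Submodule.mem_orthogonal]
    intro u hu
    rw [aux_inner_star]
    exact (Submodule.mem_orthogonal V v).1 hv _ (hinv _ _ hu)
  obtain ⟨u, hu, w, hw, huw⟩ := V.exists_add_mem_mem_orthogonal ξ
  have orth : ⟪u, w⟫_ℂ = 0 := (Submodule.mem_orthogonal V w).1 hw u hu
  by_cases hu0 : u = 0
  · left
    have : Vᗮ = ⊤ := hcyc _ (Submodule.isClosed_orthogonal V) (by
      intro x; rw [huw, hu0, zero_add]; exact hinv' x w hw)
    rwa [Submodule.orthogonal_eq_top_iff] at this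
  by_cases hw0 : w = 0
  · right
    exact hcyc _ hV (by intro x; rw [huw, hw0, add_zero]; exact hinv x u hu)
  exfalso
  obtain ⟨ψ₁, h1, e1⟩ := aux_vector_functional π u hu0
  obtain ⟨ψ₂, h2, e2⟩ := aux_vector_functional π w hw0
  have hst : ‖u‖ ^ 2 + ‖w‖ ^ 2 = 1 := by
    have := norm_add_sq_eq_norm_sq_add_norm_sq_of_inner_eq_zero (𝕜 := ℂ) u w orth
    rw [← huw, hξ] at this
    nlinarith
  have hu' : 0 < ‖u‖ := norm_pos_iff.2 hu0
  have hw' : 0 < ‖w‖ := norm_pos_iff.2 hw0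
  have cross1 : ∀ x, ⟪u, π x w⟫_ℂ = 0 := fun x =>
    (Submodule.mem_orthogonal V _).1 (hinv' x w hw) u hu
  have cross2 : ∀ x, ⟪w, π x u⟫_ℂ = 0 := fun x =>
    (Submodule.mem_orthogonal' V _).1 hw _ (hinv x u hu)
  have hψ := hext ψ₁ ψ₂ _ _ h1 h2 (by positivity) (by positivity) hst (by
    intro x
    rw [e1, e2, hφ, huw, map_add, inner_add_left, inner_add_right, inner_add_right, cross1, cross2]
    ring)
  -- now `u - ‖u‖^2 ξ` is orthogonal to the cyclic subspace
  set r : ℂ := ((‖u‖ ^ 2 : ℝ) : ℂ) with hr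
  have hrstar : (starRingEnd ℂ) r = r := by rw [hr, Complex.conj_ofReal]
  have hz : ∀ x, ⟪u - r • ξ, π x ξ⟫_ℂ = 0 := by
    intro x
    have := e1 x
    rw [hψ, hφ] at this
    rw [inner_sub_left, inner_smul_left, hrstar, this, huw, map_add, inner_add_right, cross1]
    ring
  have htop : (ℂ ∙ (u - r • ξ))ᗮ = ⊤ := hcyc _ (Submodule.isClosed_orthogonal _) (by
    intro x
    rw [Submodule.mem_orthogonal_singleton_iff_inner_right]
    exact hz x)
  rw [Submodule.orthogonal_eq_top_iff, Submodule.span_singleton_eq_bot, sub_eq_zero] at htop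
  -- so `w = (1 - r) ξ`, and `⟪u,w⟫ = 0` is contradictory
  have horth' : ⟪w, u⟫_ℂ = 0 := inner_eq_zero_symm.1 orth
  have hwu : ⟪w, r • ξ⟫_ℂ = 0 := by rw [← htop]; exact horth'
  rw [inner_smul_right, huw, inner_add_right, horth', zero_add, mul_eq_zero] at hwu
  rcases hwu with h | h
  · have : r ≠ 0 := by rw [hr]; exact_mod_cast (by positivity : ‖u‖ ^ 2 ≠ 0)
    exact this h
  · exact hw0 (inner_self_eq_zero.1 h)

theorem aux_unital_irrep {D : Type} [CStarAlgebra D] (c : D) (hc : c ≠ 0) :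
    ∃ ρ : HilbertRep D, ρ.IsIrreducible ∧ ρ.π c ≠ 0 := by
  let _ : PartialOrder D := CStarAlgebra.spectralOrder D
  have : StarOrderedRing D := CStarAlgebra.spectralOrderedRing D
  have : Nontrivial D := ⟨c, 0, hc⟩
  have hc' : 0 < ‖c‖ := norm_pos_iff.2 hc
  let a : D := ((‖c‖ ^ 2)⁻¹ : ℝ) • (star c * c)
  have ha0 : 0 ≤ a := smul_nonneg (by positivity) (star_mul_self_nonneg c)
  have ha1 : ‖a‖ = 1 := by
    simp only [a, norm_smul, CStarRing.norm_star_mul_self]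
    rw [Real.norm_of_nonneg (by positivity)]
    field_simp
  obtain ⟨φ, hφ, hφa, hext⟩ := aux_extreme a ha1
  have hle1 : a ≤ 1 := by
    have := (CStarAlgebra.norm_le_one_iff_of_nonneg a ha0).1 ha1.le
    exact this
  have h2a : ‖(2 : ℂ) • a - 1‖ ≤ 1 := by
    have hsa : IsSelfAdjoint ((2 : ℂ) • a - 1) := by
      have : IsSelfAdjoint a := IsSelfAdjoint.of_nonneg ha0
      rw [IsSelfAdjoint, star_sub, star_smul, this.star_eq]; simp
    have h4 : ((2 : ℂ) • a - 1) * ((2 : ℂ) • a - 1) ≤ 1 := by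
      have e : ((2 : ℂ) • a - 1) * ((2 : ℂ) • a - 1) = 1 - (4 : ℝ) • (a - a * a) := by
        simp only [two_smul, sub_mul, mul_sub, add_mul, mul_add, one_mul, mul_one]
        module
      rw [e, sub_le_self_iff]
      apply smul_nonneg (by norm_num)
      have hcom : Commute a (1 - a) := (Commute.one_right a).sub_right (Commute.refl a)
      have := hcom.mul_nonneg ha0 (sub_nonneg.2 hle1)
      rwa [mul_sub, mul_one] at this
    have h5 : ‖((2 : ℂ) • a - 1) * ((2 : ℂ) • a - 1)‖ ≤ 1 := by
      have h0 := star_mul_self_nonneg ((2 : ℂ) • a - 1)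
      rw [hsa.star_eq] at h0
      exact (CStarAlgebra.norm_le_one_iff_of_nonneg _ h0).2 h4
    have h6 := CStarRing.norm_star_mul_self (x := (2 : ℂ) • a - 1)
    rw [hsa.star_eq] at h6
    nlinarith [norm_nonneg ((2 : ℂ) • a - 1)]
  have hφ1 : φ 1 = 1 := by
    have n1 : ‖φ 1‖ ≤ 1 := by simpa using φ.le_of_opNorm_le hφ 1
    have n2 : ‖φ ((2 : ℂ) • a - 1)‖ ≤ 1 := by
      have := φ.le_of_opNorm_le hφ ((2 : ℂ) • a - 1)
      linarith
    rw [map_sub, map_smul, hφa] at n2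
    have r2 := (Complex.re_le_norm _).trans n2
    simp at r2
    have r1 := (Complex.re_le_norm (φ 1)).trans n1
    have r3 : (φ 1).re = 1 := by linarith
    have := Complex.sq_norm (φ 1)
    rw [Complex.normSq_apply, r3] at this
    have : (φ 1).im = 0 := by nlinarith [norm_nonneg (φ 1), mul_self_nonneg (φ 1).im]
    apply Complex.ext <;> simp [*]
  let f : D →ₚ[ℂ] ℂ := PositiveLinearMap.mk₀ (φ : D →ₗ[ℂ] ℂ) (aux_pos φ hφ hφ1)
  have hf : ∀ x, f x = φ x := fun x => rfl
  let π : D →⋆ₙₐ[ℂ] (f.GNS →L[ℂ] f.GNS) := f.gnsNonUnitalStarAlgHom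
  let ξ : f.GNS := ((f.toPreGNS 1 : f.PreGNS) : f.GNS)
  have hπ : ∀ x, π x ξ = ((f.toPreGNS x : f.PreGNS) : f.GNS) := by
    intro x
    simp [π, ξ]
  have hin : ∀ x, φ x = ⟪ξ, π x ξ⟫_ℂ := by
    intro x
    rw [hπ]
    simp only [ξ]
    rw [UniformSpace.Completion.inner_coe, PositiveLinearMap.preGNS_inner_def]
    simp [hf]
  have hξ1 : π 1 ξ = ξ := by rw [hπ]
  have hξ : ‖ξ‖ = 1 := by
    have := hin 1
    rw [hφ1, hξ1] at this
    have h2 : ‖ξ‖ ^ 2 = 1 := by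
      rw [@norm_sq_eq_re_inner ℂ, ← this]; simp
    nlinarith [norm_nonneg ξ]
  have hcyc : ∀ V : Submodule ℂ f.GNS, IsClosed (V : Set f.GNS) → (∀ x, π x ξ ∈ V) → V = ⊤ := by
    intro V hV h
    rw [eq_top_iff]
    rintro y -
    induction y using UniformSpace.Completion.induction_on with
    | hp => exact hV
    | ih y =>
      have := h (f.ofPreGNS y)
      rw [hπ] at this
      simpa using this
  have hcne : π c ≠ 0 := by
    intro h0
    have h1 : π a = 0 := by
      simp only [a]
      rw [← Complex.coe_smul, map_smul, map_mul, h0, mul_zero, smul_zero]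
    have := hin a
    rw [hφa, h1] at this
    simp at this
  refine ⟨⟨f.GNS, π⟩, ⟨?_, ?_⟩, hcne⟩
  · intro h
    exact hcne (by rw [show π = 0 from h]; rfl)
  · intro V hV hinv
    exact aux_irred π ξ hξ hcyc φ hin hext V hV hinv

end IrrepExistence

section IrrepLemmas

open scoped InnerProductSpace

theorem aux_null_eq_bot {D : Type} [NonUnitalCStarAlgebra D] (ρ : HilbertRep D)
    (hρ : ρ.IsIrreducible) (w : ρ.carrier) (hw : ∀ x, ρ.π x w = 0) : w = 0 := by
  let K : Submodule ℂ ρ.carrier := ⨅ x : D, LinearMap.ker (ρ.π x : ρ.carrier →ₗ[ℂ] ρ.carrier)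
  have hmem : ∀ v, v ∈ K ↔ ∀ x, ρ.π x v = 0 := by intro v; simp [K, Submodule.mem_iInf]
  have hcl : IsClosed (K : Set ρ.carrier) := by
    have : (K : Set ρ.carrier) = ⋂ x : D, {v | ρ.π x v = 0} := by
      ext v; simp [hmem]
    rw [this]
    exact isClosed_iInter fun x => isClosed_eq (ρ.π x).continuous continuous_const
  rcases hρ.2 K hcl (by
    intro a v hv
    rw [hmem] at hv ⊢
    intro x
    rw [hv a, map_zero]) with h | h
  · have : w ∈ K := (hmem w).2 hw
    rw [h] at this
    simpa using this
  · exfalso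
    apply hρ.1
    ext x v
    have : v ∈ K := by rw [h]; trivial
    exact (hmem v).1 this x

theorem aux_cyclic {D : Type} [NonUnitalCStarAlgebra D] (ρ : HilbertRep D)
    (hρ : ρ.IsIrreducible) (w : ρ.carrier) (hw : w ≠ 0) (V : Submodule ℂ ρ.carrier)
    (hV : IsClosed (V : Set ρ.carrier)) (h : ∀ x, ρ.π x w ∈ V) : V = ⊤ := by
  let l : D →ₗ[ℂ] ρ.carrier :=
    { toFun := fun x => ρ.π x w
      map_add' := fun x y => by simp
      map_smul' := fun r x => by simp }
  let W : Submodule ℂ ρ.carrier := (LinearMap.range l).topologicalClosure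
  have hWV : W ≤ V := Submodule.topologicalClosure_minimal _ (by
    rintro _ ⟨x, rfl⟩
    exact h x) hV
  rcases hρ.2 W (Submodule.isClosed_topologicalClosure _) (by
    intro a v hv
    have : W ≤ W.comap (ρ.π a : ρ.carrier →ₗ[ℂ] ρ.carrier) := by
      refine Submodule.topologicalClosure_minimal _ ?_ ?_
      · rintro _ ⟨x, rfl⟩
        refine Submodule.le_topologicalClosure _ ⟨a * x, ?_⟩
        simp [l]
      · exact (Submodule.isClosed_topologicalClosure (LinearMap.range l)).preimage
          (ρ.π a).continuous
    exact this hv) with h0 | h0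
  · exfalso
    apply hw
    apply aux_null_eq_bot ρ hρ
    intro x
    have : ρ.π x w ∈ W := Submodule.le_topologicalClosure _ ⟨x, rfl⟩
    rw [h0] at this
    simpa using this
  · rw [h0] at hWV
    exact top_le_iff.1 hWV

theorem aux_prime {D : Type} [NonUnitalCStarAlgebra D] (ρ : HilbertRep D)
    (hρ : ρ.IsIrreducible) (a b : D) (ha : ρ.π a ≠ 0) (hb : ρ.π b ≠ 0) :
    ∃ x, ρ.π (a * x * b) ≠ 0 := by
  by_contra! hcon
  obtain ⟨v, hv⟩ : ∃ v, ρ.π b v ≠ 0 := by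
    by_contra! h
    exact hb (by ext v; simpa using h v)
  have := aux_cyclic ρ hρ _ hv (LinearMap.ker (ρ.π a : ρ.carrier →ₗ[ℂ] ρ.carrier))
    (isClosed_eq (ρ.π a).continuous continuous_const) (by
      intro x
      have := congrArg (fun T => T v) (hcon x)
      simpa using this)
  apply ha
  ext u
  have hu : u ∈ LinearMap.ker (ρ.π a : ρ.carrier →ₗ[ℂ] ρ.carrier) := by rw [this]; trivial
  simpa using hu

/-- Pull back a representation. -/
noncomputable def HilbertRep.pull {D E : Type} [NonUnitalCStarAlgebra D] [NonUnitalCStarAlgebra E]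
    (ρ : HilbertRep D) (j : E →⋆ₙₐ[ℂ] D) : HilbertRep E :=
  ⟨ρ.carrier, ρ.π.comp j⟩

theorem HilbertRep.pull_apply {D E : Type} [NonUnitalCStarAlgebra D] [NonUnitalCStarAlgebra E]
    (ρ : HilbertRep D) (j : E →⋆ₙₐ[ℂ] D) (x : E) : (ρ.pull j).π x = ρ.π (j x) := rfl

theorem aux_restrict {D E : Type} [NonUnitalCStarAlgebra D] [NonUnitalCStarAlgebra E]
    (ρ : HilbertRep D) (hρ : ρ.IsIrreducible) (j : E →⋆ₙₐ[ℂ] D)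
    (hl : ∀ d e, ∃ e', j e' = d * j e) (hr : ∀ d e, ∃ e', j e' = j e * d)
    (hne : ∃ e, ρ.π (j e) ≠ 0) : (ρ.pull j).IsIrreducible := by
  obtain ⟨e₀, he₀⟩ := hne
  have hnull : ∀ w, (∀ e, ρ.π (j e) w = 0) → w = 0 := by
    intro w hw
    by_contra hw0
    have := aux_cyclic ρ hρ w hw0 (LinearMap.ker (ρ.π (j e₀) : ρ.carrier →ₗ[ℂ] ρ.carrier))
      (isClosed_eq (ρ.π (j e₀)).continuous continuous_const) (by
        intro x
        obtain ⟨e', he'⟩ := hr x e₀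
        have := hw e'
        rw [he', map_mul] at this
        simpa using this)
    apply he₀
    ext u
    have hu : u ∈ LinearMap.ker (ρ.π (j e₀) : ρ.carrier →ₗ[ℂ] ρ.carrier) := by rw [this]; trivial
    simpa using hu
  refine ⟨?_, ?_⟩
  · intro h
    exact he₀ (by rw [← HilbertRep.pull_apply, h]; rfl)
  · intro V hV hinv
    change Submodule ℂ ρ.carrier at V
    by_cases hV0 : V = ⊥
    · exact Or.inl hV0
    right
    obtain ⟨v, hv, hv0⟩ := (Submodule.ne_bot_iff V).1 hV0
    obtain ⟨e, he⟩ : ∃ e, ρ.π (j e) v ≠ 0 := by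
      by_contra! h
      exact hv0 (hnull v h)
    refine aux_cyclic ρ hρ _ he V hV ?_
    intro x
    obtain ⟨e', he'⟩ := hl x e
    have := hinv e' v hv
    rw [HilbertRep.pull_apply, he', map_mul] at this
    exact this

theorem aux_continuous {D : Type} [NonUnitalCStarAlgebra D] {H : Type} [NormedAddCommGroup H]
    [InnerProductSpace ℂ H] [CompleteSpace H] (π : D →⋆ₙₐ[ℂ] (H →L[ℂ] H)) : Continuous π :=
  AddMonoidHomClass.continuous_of_bound π 1 (by simpa only [one_mul] using aux_norm_le π)

theorem aux_dense {D E : Type} [NonUnitalCStarAlgebra D] [NonUnitalCStarAlgebra E]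
    (ρ : HilbertRep D) (hρ : ρ.IsIrreducible) (j : E →⋆ₙₐ[ℂ] D)
    (hj : DenseRange j) : (ρ.pull j).IsIrreducible := by
  refine ⟨?_, ?_⟩
  · intro h
    apply hρ.1
    have hc : Set.EqOn ρ.π (fun _ => 0) (Set.range j) := by
      rintro _ ⟨x, rfl⟩
      rw [← HilbertRep.pull_apply, h]; rfl
    have := Continuous.ext_on hj (aux_continuous ρ.π) continuous_const hc
    ext x : 1
    exact congrFun this x
  · intro V hV hinv
    change Submodule ℂ ρ.carrier at V
    apply hρ.2 V hV
    intro a v hv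
    have hcl : IsClosed {d : D | ρ.π d v ∈ V} :=
      hV.preimage ((ContinuousLinearMap.apply ℂ ρ.carrier v).continuous.comp (aux_continuous ρ.π))
    exact hj.induction_on (p := fun d => ρ.π d v ∈ V) a hcl (fun x => hinv x v hv)

theorem aux_irrep {D : Type} [NonUnitalCStarAlgebra D] (c : D) (hc : c ≠ 0) :
    ∃ ρ : HilbertRep D, ρ.IsIrreducible ∧ ρ.π c ≠ 0 := by
  obtain ⟨ρ, hρ, hρc⟩ := aux_unital_irrep (Unitization.inr c : Unitization ℂ D)
    (fun h => hc (Unitization.inr_injective (R := ℂ) (h.trans (Unitization.inr_zero ℂ).symm)))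
  refine ⟨ρ.pull (Unitization.inrNonUnitalStarAlgHom ℂ D), ?_, ?_⟩
  · apply aux_restrict ρ hρ
    · intro d e
      refine ⟨(d * (Unitization.inr e : Unitization ℂ D)).snd, ?_⟩
      ext <;> simp
    · intro d e
      refine ⟨((Unitization.inr e : Unitization ℂ D) * d).snd, ?_⟩
      ext <;> simp
    · exact ⟨c, hρc⟩
  · exact hρc

end IrrepLemmas

section Topology

theorem aux_open_nhd {D : Type} [NonUnitalCStarAlgebra D] (J : PrimSpace D) (U : Set (PrimSpace D))
    (hU : IsOpen U) (hJ : J ∈ U) : ∃ x, x ∉ J.1 ∧ ∀ J' : PrimSpace D, x ∉ J'.1 → J' ∈ U := by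
  obtain ⟨ρ, hρ, hJρ⟩ := J.2
  have hm : ∀ x, x ∈ J.1 ↔ ρ.π x = 0 := by intro x; rw [hJρ]; rfl
  induction hU with
  | basic s hs =>
    obtain ⟨S, rfl⟩ := hs
    obtain ⟨x, hxS, hxJ⟩ := Set.not_subset.1 hJ
    exact ⟨x, hxJ, fun J' hJ' h => hJ' (h hxS)⟩
  | univ =>
    obtain ⟨x, hx⟩ : ∃ x, ρ.π x ≠ 0 := by
      by_contra! h
      exact hρ.1 (by ext x : 1; exact h x)
    exact ⟨x, by rwa [hm], fun _ _ => trivial⟩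
  | inter s t _ _ ihs iht =>
    obtain ⟨x, hx, hx'⟩ := ihs hJ.1
    obtain ⟨y, hy, hy'⟩ := iht hJ.2
    rw [hm] at hx hy
    obtain ⟨z, hz⟩ := aux_prime ρ hρ x y hx hy
    refine ⟨x * z * y, by rwa [hm], ?_⟩
    intro J' hJ'
    obtain ⟨ρ', hρ', hJρ'⟩ := J'.2
    have hm' : ∀ x, x ∈ J'.1 ↔ ρ'.π x = 0 := by intro x; rw [hJρ']; rfl
    rw [hm'] at hJ'
    refine ⟨hx' J' ?_, hy' J' ?_⟩
    · rw [hm']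
      intro h
      exact hJ' (by rw [map_mul, map_mul, h, zero_mul, zero_mul])
    · rw [hm']
      intro h
      exact hJ' (by rw [map_mul, map_mul, h, mul_zero])
  | sUnion S _ ih =>
    obtain ⟨s, hs, hJs⟩ := hJ
    obtain ⟨x, hx, hx'⟩ := ih s hs hJs
    exact ⟨x, hx, fun J' hJ' => ⟨s, hs, hx' J' hJ'⟩⟩

theorem aux_isOpen {D : Type} [NonUnitalCStarAlgebra D] (S : Set D) :
    IsOpen {J : PrimSpace D | ¬ S ⊆ J.1} :=
  TopologicalSpace.isOpen_generateFrom_of_mem ⟨S, rfl⟩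

end Topology

section Spectral

open scoped InnerProductSpace

/-- A tent function. -/
noncomputable def auxTent (l δ x : ℝ) : ℝ := max 0 (1 - |x - l| / δ)

theorem auxTent_cont (l δ : ℝ) : Continuous (auxTent l δ) := by
  unfold auxTent; fun_prop

theorem auxTent_self (l δ : ℝ) : auxTent l δ l = 1 := by simp [auxTent]

theorem auxTent_zero_of_le (l δ x : ℝ) (hδ : 0 < δ) (h : δ ≤ |x - l|) : auxTent l δ x = 0 := by
  have : 1 ≤ |x - l| / δ := by rwa [le_div_iff₀ hδ, one_mul]
  simp [auxTent, this]

theorem auxTent_mul (l m δ : ℝ) (hδ : 0 < δ) (h : 2 * δ ≤ |l - m|) (x : ℝ) :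
    auxTent l δ x * auxTent m δ x = 0 := by
  by_cases h1 : δ ≤ |x - l|
  · rw [auxTent_zero_of_le _ _ _ hδ h1, zero_mul]
  · have h2 : δ ≤ |x - m| := by
      have := abs_sub_le l x m
      rw [abs_sub_comm l x] at this
      linarith
    rw [auxTent_zero_of_le _ _ _ hδ h2, mul_zero]

theorem aux_sep (s : Set ℝ) (hs : s.Finite) :
    ∃ δ > 0, ∀ x ∈ s, ∀ y ∈ s, x ≠ y → 2 * δ ≤ |x - y| := by
  have hfin : ((fun p : ℝ × ℝ => |p.1 - p.2|) '' ((s ×ˢ s) ∩ {p | p.1 ≠ p.2})).Finite :=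
    ((hs.prod hs).subset Set.inter_subset_left).image _
  obtain ⟨ε, hε, h⟩ : ∃ ε > 0, ∀ r ∈ ((fun p : ℝ × ℝ => |p.1 - p.2|) ''
      ((s ×ˢ s) ∩ {p | p.1 ≠ p.2})), ε ≤ r := by
    rcases Set.eq_empty_or_nonempty ((fun p : ℝ × ℝ => |p.1 - p.2|) ''
      ((s ×ˢ s) ∩ {p | p.1 ≠ p.2})) with he | he
    · exact ⟨1, one_pos, by rw [he]; simp⟩
    · obtain ⟨m, hm, hmin⟩ := hfin.exists_minimalFor id _ he
      refine ⟨m, ?_, ?_⟩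
      · obtain ⟨p, ⟨_, hp⟩, rfl⟩ := hm
        exact abs_pos.2 (sub_ne_zero.2 hp)
      · intro r hr
        rcases le_total m r with h | h
        · exact h
        · exact hmin hr h
  refine ⟨ε / 2, by positivity, ?_⟩
  intro x hx y hy hxy
  have := h _ ⟨(x, y), ⟨⟨hx, hy⟩, hxy⟩, rfl⟩
  simp at this
  linarith

theorem aux_map_cfc {D : Type} [NonUnitalCStarAlgebra D] {H : Type} [NormedAddCommGroup H]
    [InnerProductSpace ℂ H] [CompleteSpace H] (π : D →⋆ₙₐ[ℂ] (H →L[ℂ] H)) (f : ℝ → ℝ)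
    (hf : Continuous f) (hf0 : f 0 = 0) (h : D) (hh : IsSelfAdjoint h) :
    π (cfcₙ f h) = cfcₙ f (π h) := by
  have hπ := aux_continuous π
  have : IsSelfAdjoint (π h) := hh.map π
  exact NonUnitalStarAlgHomClass.map_cfcₙ (R := ℝ) (S := ℂ) π f h hf.continuousOn hf0 hπ hh this

theorem aux_spec_card {D : Type} [NonUnitalCStarAlgebra D] (N : ℕ) (P : Set (PrimSpace D))
    (hP : ∀ J ∈ P, ∃ σ : HilbertRep D, J.1 = {a | σ.π a = 0} ∧ Module.rank ℂ σ.carrier ≤ N)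
    (J : PrimSpace D) (hJ : J ∈ closure P) (ρ : HilbertRep D) (hJρ : J.1 = {a | ρ.π a = 0})
    (h : D) (hh : IsSelfAdjoint h) (s : Finset ℝ) (hs : ∀ x ∈ s, x ∈ quasispectrum ℝ (ρ.π h))
    (hs0 : (0 : ℝ) ∉ s) : s.card ≤ N := by
  classical
  obtain ⟨δ, hδ, hsep⟩ := aux_sep (insert 0 s : Finset ℝ) (Finset.finite_toSet _)
  let e : ℝ → D := fun l => cfcₙ (auxTent l δ) h
  have ht0 : ∀ l ∈ s, auxTent l δ 0 = 0 := by
    intro l hl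
    apply auxTent_zero_of_le _ _ _ hδ
    have := hsep 0 (by simp) l (by simp [hl]) (by rintro rfl; exact hs0 hl)
    linarith
  have he : ∀ l ∈ s, ρ.π (e l) ≠ 0 := by
    intro l hl h0
    have hsa : IsSelfAdjoint (ρ.π h) := hh.map ρ.π
    simp only [e] at h0
    rw [aux_map_cfc ρ.π _ (auxTent_cont l δ) (ht0 l hl) h hh] at h0
    have := norm_apply_le_norm_cfcₙ (auxTent l δ) (ρ.π h) (hs l hl)
      (auxTent_cont l δ).continuousOn (ht0 l hl) hsa
    rw [h0, auxTent_self] at this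
    simp at this
    linarith
  have hesa : ∀ l, IsSelfAdjoint (e l) := fun l => cfcₙ_predicate _ _
  have hort : ∀ l ∈ s, ∀ m ∈ s, l ≠ m → e l * e m = 0 := by
    intro l hl m hm hlm
    simp only [e]
    rw [← cfcₙ_mul (auxTent l δ) (auxTent m δ) h (auxTent_cont l δ).continuousOn (ht0 l hl)
      (auxTent_cont m δ).continuousOn (ht0 m hm)]
    have : (fun x => auxTent l δ x * auxTent m δ x) = fun _ => 0 := by
      funext x
      exact auxTent_mul l m δ hδ (hsep l (by simp [hl]) m (by simp [hm]) hlm) x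
    rw [this]
    simp
  -- a common point of `P` at which none of these elements vanishes
  obtain ⟨J', hJ'U, hJ'P⟩ : ((⋂ l ∈ s, {J : PrimSpace D | ¬ ({e l} : Set D) ⊆ J.1}) ∩ P).Nonempty := by
    rw [mem_closure_iff] at hJ
    apply hJ
    · exact isOpen_biInter_finset fun l _ => aux_isOpen _
    · simp only [Set.mem_iInter, Set.mem_ofPred_eq, Set.singleton_subset_iff]
      intro l hl
      rw [hJρ]
      exact he l hl
  simp only [Set.mem_iInter, Set.mem_ofPred_eq, Set.singleton_subset_iff] at hJ'U
  obtain ⟨σ, hσ, hrank⟩ := hP J' hJ'P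
  have hv : ∀ l : s, ∃ v, σ.π (e l) v ≠ 0 := by
    intro l
    by_contra! hcon
    apply hJ'U l l.2
    rw [hσ]
    change σ.π (e l) = 0
    ext v
    simpa using hcon v
  choose v hv using hv
  have hli : LinearIndependent ℂ (fun l : s => σ.π (e l) (v l)) := by
    apply linearIndependent_of_ne_zero_of_inner_eq_zero hv
    intro l m hlm
    change ⟪σ.π (e l) (v l), σ.π (e m) (v m)⟫_ℂ = 0
    rw [aux_inner_star, (hesa m).star_eq]
    have : σ.π (e m) (σ.π (e l) (v l)) = σ.π (e m * e l) (v l) := by rw [map_mul]; rfl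
    rw [this, hort m m.2 l l.2 (fun h => hlm (Subtype.ext h.symm)), map_zero]
    simp
  have := hli.cardinal_le_rank.trans hrank
  simpa using this

end Spectral

section FiniteDim

open scoped InnerProductSpace

/-- A nonzero projection in the range of the representation. -/
def AuxProj {D : Type} [NonUnitalCStarAlgebra D] (ρ : HilbertRep D)
    (T : ρ.carrier →L[ℂ] ρ.carrier) : Prop :=
  (∃ a, ρ.π a = T) ∧ IsSelfAdjoint T ∧ T * T = T ∧ T ≠ 0

/-- Bounded number of nonzero spectral values. -/
def AuxSC {D : Type} [NonUnitalCStarAlgebra D] (ρ : HilbertRep D) (N : ℕ) : Prop :=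
  ∀ h : D, IsSelfAdjoint h → ∀ s : Finset ℝ, (∀ x ∈ s, x ∈ quasispectrum ℝ (ρ.π h)) →
    (0 : ℝ) ∉ s → s.card ≤ N

variable {D : Type} [NonUnitalCStarAlgebra D] (ρ : HilbertRep D) (N : ℕ)

theorem aux_lift_sa (T : ρ.carrier →L[ℂ] ρ.carrier) (hT : IsSelfAdjoint T) (a : D)
    (ha : ρ.π a = T) : ∃ h, IsSelfAdjoint h ∧ ρ.π h = T := by
  refine ⟨((1 / 2 : ℝ) : ℂ) • (a + star a), ?_, ?_⟩
  · rw [IsSelfAdjoint, star_smul, star_add, star_star, add_comm]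
    congr 1
    simp
  · rw [map_smul, map_add, map_star, ha, hT.star_eq, ← two_smul ℂ, smul_smul]
    norm_num

theorem aux_eigen (T : ρ.carrier →L[ℂ] ρ.carrier) (r : ℝ) (v : ρ.carrier) (hv : v ≠ 0)
    (hT : T v = (r : ℂ) • v) : r ∈ quasispectrum ℝ T := by
  apply spectrum_subset_quasispectrum
  rw [spectrum.mem_iff]
  rintro ⟨u, hu⟩
  have h1 : (u : ρ.carrier →L[ℂ] ρ.carrier) v = 0 := by
    rw [hu]
    simp [hT, Algebra.algebraMap_eq_smul_one]
  have h2 : ((↑u⁻¹ : ρ.carrier →L[ℂ] ρ.carrier) * u) v = v := by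
    rw [Units.inv_mul]; rfl
  rw [ContinuousLinearMap.mul_apply, h1, map_zero] at h2
  exact hv h2.symm

theorem aux_bound (hSC : AuxSC ρ N) (k : ℕ) (p : Fin k → (ρ.carrier →L[ℂ] ρ.carrier))
    (hp : ∀ i, AuxProj ρ (p i)) (hort : ∀ i j, i ≠ j → p i * p j = 0) : k ≤ N := by
  classical
  choose a ha using fun i => (hp i).1
  let T : ρ.carrier →L[ℂ] ρ.carrier := ∑ i : Fin k, (((i : ℕ) + 1 : ℝ) : ℂ) • p i
  have hTa : ρ.π (∑ i : Fin k, (((i : ℕ) + 1 : ℝ) : ℂ) • a i) = T := by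
    simp only [T, map_sum, map_smul, ha]
  have hTsa : IsSelfAdjoint T := by
    simp only [T, IsSelfAdjoint, star_sum, star_smul]
    refine Finset.sum_congr rfl fun i _ => ?_
    rw [(hp i).2.1.star_eq]
    congr 1
    exact Complex.conj_ofReal _
  obtain ⟨h, hh, hhT⟩ := aux_lift_sa ρ T hTsa _ hTa
  have := hSC h hh (Finset.univ.image fun i : Fin k => ((i : ℕ) + 1 : ℝ)) (by
    intro x hx
    obtain ⟨i, -, rfl⟩ := Finset.mem_image.1 hx
    obtain ⟨w, hw⟩ : ∃ w, p i w ≠ 0 := by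
      by_contra! hcon
      exact (hp i).2.2.2 (by ext v; simpa using hcon v)
    rw [hhT]
    refine aux_eigen ρ T _ (p i w) hw ?_
    have : T * p i = (((i : ℕ) + 1 : ℝ) : ℂ) • p i := by
      simp only [T, Finset.sum_mul, smul_mul_assoc]
      rw [Finset.sum_eq_single i]
      · rw [(hp i).2.2.1]
      · intro j _ hj
        rw [hort j i hj, smul_zero]
      · simp
    have := congrArg (fun S : ρ.carrier →L[ℂ] ρ.carrier => S w) this
    simpa using this) (by
    intro h0
    obtain ⟨i, -, hi⟩ := Finset.mem_image.1 h0
    have : (0 : ℝ) ≤ (i : ℕ) := Nat.cast_nonneg _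
    linarith)
  rwa [Finset.card_image_of_injective, Finset.card_univ, Fintype.card_fin] at this
  intro i j hij
  simp only [add_left_inj, Nat.cast_inj] at hij
  exact Fin.ext hij

theorem aux_specproj (hSC : AuxSC ρ N) (T : ρ.carrier →L[ℂ] ρ.carrier) (hTsa : IsSelfAdjoint T)
    (a : D) (ha : ρ.π a = T) (hT0 : T ≠ 0) :
    ∃ Q, AuxProj ρ Q ∧ ∃ l : ℂ, l ≠ 0 ∧ T * Q = l • Q := by
  obtain ⟨h, hh, hhT⟩ := aux_lift_sa ρ T hTsa _ ha
  have hfin : (quasispectrum ℝ T).Finite := by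
    by_contra hinf
    have hinf' : (quasispectrum ℝ T \ {0}).Infinite :=
      Set.Infinite.diff hinf (Set.finite_singleton 0)
    obtain ⟨s, hs, hcard⟩ := hinf'.exists_subset_card_eq (N + 1)
    have := hSC h hh s (by intro x hx; rw [hhT]; exact (hs hx).1) (fun h0 => (hs h0).2 rfl)
    omega
  obtain ⟨l, hl, hl0⟩ : ∃ l ∈ quasispectrum ℝ T, l ≠ 0 := by
    by_contra! hcon
    apply hT0
    rw [← cfcₙ_id ℝ T]
    rw [cfcₙ_congr (f := id) (g := fun _ => 0) (fun x hx => hcon x hx)]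
    simp
  obtain ⟨δ, hδ, hsep⟩ := aux_sep (insert 0 (quasispectrum ℝ T)) (hfin.insert 0)
  have hother : ∀ x ∈ insert 0 (quasispectrum ℝ T), x ≠ l → auxTent l δ x = 0 := by
    intro x hx hxl
    apply auxTent_zero_of_le _ _ _ hδ
    have := hsep x hx l (Or.inr hl) hxl
    linarith
  have h00 : auxTent l δ 0 = 0 := hother 0 (Or.inl rfl) hl0.symm
  have hc := auxTent_cont l δ
  refine ⟨cfcₙ (auxTent l δ) T, ⟨⟨cfcₙ (auxTent l δ) h, ?_⟩, cfcₙ_predicate _ _, ?_, ?_⟩, (l : ℂ),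
    by exact_mod_cast hl0, ?_⟩
  · rw [aux_map_cfc ρ.π _ hc h00 h hh, hhT]
  · rw [← cfcₙ_mul (auxTent l δ) (auxTent l δ) T hc.continuousOn h00 hc.continuousOn h00]
    apply cfcₙ_congr
    intro x hx
    by_cases hxl : x = l
    · simp [hxl, auxTent_self]
    · simp [hother x (Or.inr hx) hxl]
  · intro h0
    have := norm_apply_le_norm_cfcₙ (auxTent l δ) T hl hc.continuousOn h00 hTsa
    rw [h0, auxTent_self] at this
    simp at this
    linarith
  · have e1 : T * cfcₙ (auxTent l δ) T = cfcₙ (fun x => x * auxTent l δ x) T := by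
      rw [cfcₙ_mul (fun x : ℝ => x) (auxTent l δ) T continuous_id.continuousOn rfl
        hc.continuousOn h00, cfcₙ_id' ℝ T]
    have e2 : cfcₙ (fun x => x * auxTent l δ x) T = cfcₙ (fun x => l * auxTent l δ x) T := by
      apply cfcₙ_congr
      intro x hx
      by_cases hxl : x = l
      · simp [hxl]
      · simp [hother x (Or.inr hx) hxl]
    rw [e1, e2, cfcₙ_const_mul l (auxTent l δ) T hc.continuousOn h00]
    rfl

theorem aux_minproj (hρ : ρ.IsIrreducible) (hSC : AuxSC ρ N) :
    ∃ P, AuxProj ρ P ∧ ∀ Q, AuxProj ρ Q → P * Q = Q → Q = P := by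
  by_contra! hcon
  have hstep : ∀ n : ℕ, ∀ P, AuxProj ρ P → ∃ p : Fin n → (ρ.carrier →L[ℂ] ρ.carrier),
      (∀ i, AuxProj ρ (p i)) ∧ (∀ i j, i ≠ j → p i * p j = 0) ∧ ∀ i, P * p i = p i := by
    intro n
    induction n with
    | zero => intro P _; exact ⟨Fin.elim0, fun i => i.elim0, fun i => i.elim0, fun i => i.elim0⟩
    | succ n ih =>
      intro P hP
      obtain ⟨Q, hQ, hPQ, hne⟩ := hcon P hP
      have hQP : Q * P = Q := by
        have := congrArg star hPQ
        rwa [star_mul, hQ.2.1.star_eq, hP.2.1.star_eq] at this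
      obtain ⟨p, hp, hort, hle⟩ := ih Q hQ
      have hR : AuxProj ρ (P - Q) := by
        obtain ⟨a, ha⟩ := hP.1
        obtain ⟨b, hb⟩ := hQ.1
        refine ⟨⟨a - b, by rw [map_sub, ha, hb]⟩, hP.2.1.sub hQ.2.1, ?_, ?_⟩
        · rw [sub_mul, mul_sub, mul_sub, hP.2.2.1, hQ.2.2.1, hPQ, hQP]; simp
        · intro h; exact hne (sub_eq_zero.1 h).symm
      have hPp : ∀ i, P * p i = p i := by
        intro i
        rw [← hle i, ← mul_assoc, hPQ]
      have h1 : ∀ i, (P - Q) * p i = 0 := by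
        intro i
        rw [sub_mul, hPp, hle, sub_self]
      have h2 : ∀ i, p i * (P - Q) = 0 := by
        intro i
        have := congrArg star (h1 i)
        rwa [star_mul, (hp i).2.1.star_eq, hR.2.1.star_eq, star_zero] at this
      refine ⟨Fin.cons (P - Q) p, ?_, ?_, ?_⟩
      · intro i
        refine Fin.cases ?_ (fun i => ?_) i
        · simpa using hR
        · simpa using hp i
      · intro i j
        refine Fin.cases ?_ (fun i => ?_) i <;> refine Fin.cases ?_ (fun j => ?_) j
        · simp
        · intro _; simpa using h1 j
        · intro _; simpa using h2 i
        · intro hij; simpa using hort i j (fun h => hij (by rw [h]))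
      · intro i
        refine Fin.cases ?_ (fun i => ?_) i
        · simp [mul_sub, hP.2.2.1, hPQ]
        · simpa using hPp i
  obtain ⟨a, ha⟩ : ∃ a, ρ.π a ≠ 0 := by
    by_contra! h
    exact hρ.1 (by ext x : 1; exact h x)
  obtain ⟨P, hP, -⟩ := aux_specproj ρ N hSC (ρ.π (star a * a))
    ((IsSelfAdjoint.star_mul_self a).map ρ.π) _ rfl (by
      rw [map_mul, map_star]
      exact (CStarRing.star_mul_self_ne_zero_iff _).2 ha)
  obtain ⟨p, hp, hort, -⟩ := hstep (N + 1) P hP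
  have := aux_bound ρ N hSC (N + 1) p hp hort
  omega

theorem aux_compress (hSC : AuxSC ρ N) (P : ρ.carrier →L[ℂ] ρ.carrier) (hP : AuxProj ρ P)
    (hmin : ∀ Q, AuxProj ρ Q → P * Q = Q → Q = P) (a : D) :
    ∃ c : ℂ, P * ρ.π a * P = c • P := by
  have hsa : ∀ a : D, IsSelfAdjoint a → ∃ c : ℂ, P * ρ.π a * P = c • P := by
    intro a ha
    by_cases h0 : P * ρ.π a * P = 0
    · exact ⟨0, by rw [h0, zero_smul]⟩
    obtain ⟨q, hq⟩ := hP.1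
    obtain ⟨Q, hQ, l, hl, hTQ⟩ := aux_specproj ρ N hSC (P * ρ.π a * P) (by
      rw [IsSelfAdjoint, star_mul, star_mul, hP.2.1.star_eq, (ha.map ρ.π).star_eq, mul_assoc])
      (q * a * q) (by rw [map_mul, map_mul, hq]) h0
    have hPQ : P * Q = Q := by
      have h1 : P * (l • Q) = l • Q := by
        rw [← hTQ, ← mul_assoc, ← mul_assoc, ← mul_assoc, hP.2.2.1]
      rw [mul_smul_comm] at h1
      exact smul_right_injective _ hl h1
    have hQeq := hmin Q hQ hPQ
    rw [hQeq, mul_assoc, hP.2.2.1] at hTQ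
    exact ⟨l, hTQ⟩
  obtain ⟨c, hc⟩ := hsa (realPart a : D) (realPart a).2
  obtain ⟨d, hd⟩ := hsa (imaginaryPart a : D) (imaginaryPart a).2
  refine ⟨c + Complex.I * d, ?_⟩
  conv_lhs => rw [← realPart_add_I_smul_imaginaryPart a]
  rw [map_add, map_smul, mul_add, add_mul, mul_smul_comm, smul_mul_assoc, hc, hd]
  module

theorem aux_finiteDim (hρ : ρ.IsIrreducible) (hSC : AuxSC ρ N) :
    FiniteDimensional ℂ ρ.carrier := by
  obtain ⟨P, hP, hmin⟩ := aux_minproj ρ N hρ hSC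
  obtain ⟨w₀, hw₀⟩ : ∃ w, P w ≠ 0 := by
    by_contra! hcon
    exact hP.2.2.2 (by ext v; simpa using hcon v)
  let ξ : ρ.carrier := ((‖P w₀‖⁻¹ : ℝ) : ℂ) • P w₀
  have hnpos : 0 < ‖P w₀‖ := norm_pos_iff.2 hw₀
  have hξ : ‖ξ‖ = 1 := by
    simp only [ξ, norm_smul, Complex.norm_real, norm_inv, norm_norm]
    field_simp
  have hξ0 : ξ ≠ 0 := by intro h; rw [h] at hξ; simp at hξ
  have hPP : ∀ v, P (P v) = P v := fun v => by
    have := congrArg (fun S : ρ.carrier →L[ℂ] ρ.carrier => S v) hP.2.2.1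
    simpa using this
  have hPξ : P ξ = ξ := by simp only [ξ, map_smul, hPP]
  have hrank : ∀ v, P v ∈ ℂ ∙ ξ := by
    have := aux_cyclic ρ hρ ξ hξ0 ((ℂ ∙ ξ).comap (P : ρ.carrier →ₗ[ℂ] ρ.carrier))
      ((Submodule.closed_of_finiteDimensional (ℂ ∙ ξ)).preimage P.continuous) (by
        intro x
        obtain ⟨c, hc⟩ := aux_compress ρ N hSC P hP hmin x
        have := congrArg (fun S : ρ.carrier →L[ℂ] ρ.carrier => S ξ) hc
        simp only [ContinuousLinearMap.mul_apply, ContinuousLinearMap.smul_apply, hPξ] at this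
        exact Submodule.mem_span_singleton.2 ⟨c, this.symm⟩)
    intro v
    have hv : v ∈ (ℂ ∙ ξ).comap (P : ρ.carrier →ₗ[ℂ] ρ.carrier) := by rw [this]; trivial
    exact hv
  have hPadj : ∀ v w, ⟪v, P w⟫_ℂ = ⟪P v, w⟫_ℂ := by
    intro v w
    have := hP.2.1.star_eq
    rw [ContinuousLinearMap.star_eq_adjoint] at this
    conv_rhs => rw [← this, ContinuousLinearMap.adjoint_inner_left]
  have hPform : ∀ v, P v = ⟪ξ, v⟫_ℂ • ξ := by
    intro v
    obtain ⟨c, hc⟩ := Submodule.mem_span_singleton.1 (hrank v)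
    have h1 : ⟪ξ, P v⟫_ℂ = ⟪ξ, v⟫_ℂ := by rw [hPadj, hPξ]
    rw [← hc, inner_smul_right, inner_self_eq_norm_sq_to_K, hξ] at h1
    rw [← hc, ← h1]
    simp
  let l : D →ₗ[ℂ] ρ.carrier :=
    { toFun := fun x => ρ.π x ξ
      map_add' := fun x y => by simp
      map_smul' := fun r x => by simp }
  have hon : ∀ (k : ℕ) (v : Fin k → ρ.carrier), Orthonormal ℂ v →
      (∀ i, v i ∈ LinearMap.range l) → k ≤ N := by
    intro k v hv hvl
    choose x hx using hvl
    obtain ⟨q, hq⟩ := hP.1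
    have hform : ∀ i w, ρ.π (x i * q * star (x i)) w = ⟪v i, w⟫_ℂ • v i := by
      intro i w
      rw [map_mul, map_mul, hq, ContinuousLinearMap.mul_apply, ContinuousLinearMap.mul_apply,
        hPform, map_smul, aux_inner_star, star_star]
      have : ρ.π (x i) ξ = v i := hx i
      rw [this]
    have hone : ∀ i, ⟪v i, v i⟫_ℂ = 1 := by
      intro i
      rw [inner_self_eq_norm_sq_to_K, hv.1 i]; simp
    apply aux_bound ρ N hSC k (fun i => ρ.π (x i * q * star (x i)))
    · intro i
      refine ⟨⟨_, rfl⟩, ?_, ?_, ?_⟩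
      · rw [IsSelfAdjoint, map_mul, map_mul, map_star, hq, star_mul, star_mul, star_star,
          hP.2.1.star_eq, mul_assoc]
      · ext w
        rw [ContinuousLinearMap.mul_apply, hform, hform, inner_smul_right, hone, mul_one]
      · intro h0
        have := hform i (v i)
        rw [h0, hone, one_smul] at this
        have h2 := hv.1 i
        rw [← this] at h2
        simp at h2
    · intro i j hij
      ext w
      rw [ContinuousLinearMap.mul_apply, hform, hform, inner_smul_right, hv.2 hij]
      simp
  have hfd : FiniteDimensional ℂ (LinearMap.range l) := by
    by_contra hinf
    have hr : ((N + 1 : ℕ) : Cardinal) ≤ Module.rank ℂ (LinearMap.range l) := by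
      have h : ¬ Module.rank ℂ (LinearMap.range l) < Cardinal.aleph0 :=
        fun h => hinf (Module.rank_lt_aleph0_iff.1 h)
      exact (Cardinal.natCast_lt_aleph0).le.trans (not_lt.1 h)
    obtain ⟨v, hv⟩ := exists_linearIndependent_of_le_rank hr
    have hv' : LinearIndependent ℂ (fun i => (v i : ρ.carrier)) :=
      hv.map' (LinearMap.range l).subtype (Submodule.ker_subtype _)
    let W := Submodule.span ℂ (Set.range fun i => (v i : ρ.carrier))
    have : FiniteDimensional ℂ W := FiniteDimensional.span_of_finite ℂ (Set.finite_range _)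
    have hdim : Module.finrank ℂ W = N + 1 := by
      rw [finrank_span_eq_card hv', Fintype.card_fin]
    have hWle : W ≤ LinearMap.range l := by
      rw [Submodule.span_le]
      rintro _ ⟨i, rfl⟩
      exact (v i).2
    let b := stdOrthonormalBasis ℂ W
    have := hon _ (fun i => (b i : ρ.carrier))
      (b.orthonormal.comp_linearIsometry W.subtypeₗᵢ) (fun i => hWle (b i).2)
    omega
  have htop := aux_cyclic ρ hρ ξ hξ0 (LinearMap.range l)
    (Submodule.closed_of_finiteDimensional _) (fun x => ⟨x, rfl⟩)
  rw [htop] at hfd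
  exact Module.Finite.equiv (Submodule.topEquiv (R := ℂ) (M := ρ.carrier))

end FiniteDim

section Main

open scoped Pointwise

theorem aux_finite_primes {R : Type} [NonUnitalRing R] [Module ℂ R] (K : Submodule ℂ R)
    [FiniteDimensional ℂ (R ⧸ K)] (S : Set (Submodule ℂ R)) (hK : ∀ J ∈ S, K ≤ J)
    (hl : ∀ J ∈ S, ∀ a, ∀ b ∈ J, a * b ∈ J) (hr : ∀ J ∈ S, ∀ a, ∀ b ∈ J, b * a ∈ J)
    (hprime : ∀ J ∈ S, ∀ a b, a ∉ J → b ∉ J → ∃ x, a * x * b ∉ J) : S.Finite := by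
  let e := Submodule.comapMkQRelIso K
  have hgt : WellFoundedGT (Set.Ici K) := e.symm.toOrderEmbedding.wellFoundedGT
  have hlt : WellFoundedLT (Set.Ici K) := e.symm.toOrderEmbedding.wellFoundedLT
  have key : ∀ L : Set.Ici K, {J | J ∈ S ∧ L.1 ≤ J}.Finite := by
    intro L
    induction L using WellFoundedGT.induction with
    | ind L ih =>
    have ih' : ∀ M : Submodule ℂ R, L.1 < M → {J | J ∈ S ∧ M ≤ J}.Finite := fun M hM =>
      ih ⟨M, le_trans L.2 hM.le⟩ hM
    by_cases hp : ∀ a b, a ∉ L.1 → b ∉ L.1 → ∃ x, a * x * b ∉ L.1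
    · by_cases hX : ∃ X : Set.Ici K, L.1 < X.1 ∧ ∀ a, ∀ b ∈ X.1, b * a ∈ X.1
      · obtain ⟨X, ⟨hLX, hXr⟩, hmin⟩ := hlt.wf.has_min
          {X : Set.Ici K | L.1 < X.1 ∧ ∀ a, ∀ b ∈ X.1, b * a ∈ X.1} hX
        refine ((ih' X.1 hLX).union (Set.finite_singleton L.1)).subset ?_
        rintro J ⟨hJS, hLJ⟩
        by_cases hJL : J = L.1
        · exact Or.inr hJL
        refine Or.inl ⟨hJS, ?_⟩
        have hlt' : L.1 < J := lt_of_le_of_ne hLJ (Ne.symm hJL)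
        by_contra hXJ
        obtain ⟨a, haX, haL⟩ := SetLike.exists_of_lt hLX
        obtain ⟨b, hbJ, hbL⟩ := SetLike.exists_of_lt hlt'
        obtain ⟨x, hx⟩ := hp a b haL hbL
        refine hmin ⟨X.1 ⊓ J, le_inf X.2 (hK J hJS)⟩ ⟨?_, ?_⟩ ?_
        · refine lt_of_le_of_ne (le_inf hLX.le hLJ) ?_
          intro h
          apply hx
          rw [h]
          exact ⟨by rw [mul_assoc]; exact hXr _ _ haX, hl J hJS _ _ hbJ⟩
        · intro c d hd
          exact ⟨hXr _ _ hd.1, hr J hJS _ _ hd.2⟩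
        · show X.1 ⊓ J < X.1
          exact lt_of_le_of_ne inf_le_left (fun h => hXJ (inf_eq_left.1 h))
      · refine (Set.finite_singleton L.1).subset ?_
        rintro J ⟨hJS, hLJ⟩
        by_contra hJL
        exact hX ⟨⟨J, hK J hJS⟩, lt_of_le_of_ne hLJ (Ne.symm hJL), hr J hJS⟩
    · push Not at hp
      obtain ⟨a, b, ha, hb, hab⟩ := hp
      have hlt1 : ∀ c, c ∉ L.1 → L.1 < L.1 ⊔ Submodule.span ℂ {c} := by
        intro c hc
        refine lt_of_le_of_ne le_sup_left ?_
        intro h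
        apply hc
        rw [h]
        exact Submodule.mem_sup_right (Submodule.mem_span_singleton_self c)
      refine ((ih' _ (hlt1 a ha)).union (ih' _ (hlt1 b hb))).subset ?_
      rintro J ⟨hJS, hLJ⟩
      by_cases haJ : a ∈ J
      · exact Or.inl ⟨hJS, sup_le hLJ (by simpa using haJ)⟩
      by_cases hbJ : b ∈ J
      · exact Or.inr ⟨hJS, sup_le hLJ (by simpa using hbJ)⟩
      obtain ⟨x, hx⟩ := hprime J hJS a b haJ hbJ
      exact absurd (hLJ (hab x)) hx
  refine (key ⟨K, le_refl K⟩).subset fun J hJ => ⟨hJ, hK J hJ⟩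

theorem aux_closure {D Q : Type} [NonUnitalCStarAlgebra D] [NonUnitalCStarAlgebra Q]
    (f : D →⋆ₙₐ[ℂ] Q) : ∃ (C : Type) (_ : NonUnitalCStarAlgebra C) (j : D →⋆ₙₐ[ℂ] C),
      DenseRange j ∧ ∀ x, j x = 0 ↔ f x = 0 := by
  let C : NonUnitalStarSubalgebra ℂ Q := (NonUnitalStarAlgHom.range f).topologicalClosure
  have hCc : IsClosed (C : Set Q) := NonUnitalStarSubalgebra.isClosed_topologicalClosure _
  have hfC : ∀ x, f x ∈ C := fun x => subset_closure ⟨x, rfl⟩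
  let j : D →⋆ₙₐ[ℂ] C := NonUnitalStarAlgHom.codRestrict f C hfC
  have hjd : DenseRange j := by
    intro c
    rw [Topology.IsInducing.subtypeVal.closure_eq_preimage_closure_image]
    have : (Subtype.val '' Set.range j : Set Q) = Set.range f := by
      rw [← Set.range_comp]; rfl
    have h2 : (c : Q) ∈ closure (Subtype.val '' Set.range j : Set Q) := by
      rw [this]
      exact c.2
    exact h2
  refine ⟨C, NonUnitalStarSubalgebra.nonUnitalCStarAlgebra C, j, hjd, fun x => ?_⟩
  exact ⟨fun h => congrArg Subtype.val h, fun h => Subtype.ext h⟩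

theorem aux_main (N : ℕ) {D I B Q : Type} [NonUnitalCStarAlgebra D] [NonUnitalCStarAlgebra I]
    [NonUnitalCStarAlgebra B] [NonUnitalCStarAlgebra Q]
    (ι : I →⋆ₙₐ[ℂ] D)
    (hιideal : ∀ a : D, ∀ i ∈ Set.range ι, a * i ∈ Set.range ι ∧ i * a ∈ Set.range ι)
    (p : D →⋆ₙₐ[ℂ] B) (hpsurj : Function.Surjective p)
    (hsub : ∀ ρ : HilbertRep I, ρ.IsIrreducible → Module.rank ℂ ρ.carrier ≤ N)
    (τ : B →⋆ₙₐ[ℂ] Q)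
    (hBusby : {a : D | τ (p a) = 0} =
      closure (Set.range ι +
        {a : D | ∀ b ∈ Set.range ι, a * b = 0 ∧ b * a = 0})) :
    (frontier {J : PrimSpace D | ¬ Set.range ι ⊆ J.1}).Finite ↔
      FiniteDimensional ℂ ↥(Submodule.span ℂ (Set.range τ)) := by
  set P : Set (PrimSpace D) := {J : PrimSpace D | ¬ Set.range ι ⊆ J.1} with hPdef
  have hPo : IsOpen P := aux_isOpen _
  have hfr : ∀ J : PrimSpace D, J ∈ frontier P ↔ J ∈ closure P ∧ Set.range ι ⊆ J.1 := by
    intro J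
    rw [hPo.frontier_eq]
    constructor
    · rintro ⟨h1, h2⟩
      exact ⟨h1, not_not.1 h2⟩
    · rintro ⟨h1, h2⟩
      exact ⟨h1, fun h => h h2⟩
  let T : D →ₗ[ℂ] Q :=
    { toFun := fun a => τ (p a)
      map_add' := fun x y => by simp
      map_smul' := fun r x => by simp }
  have hT : ∀ a, T a = τ (p a) := fun _ => rfl
  have hrange : Submodule.span ℂ (Set.range τ) = LinearMap.range T := by
    have : Set.range τ = (LinearMap.range T : Set Q) := by
      ext y
      constructor
      · rintro ⟨b, rfl⟩
        obtain ⟨a, rfl⟩ := hpsurj b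
        exact ⟨a, rfl⟩
      · rintro ⟨a, rfl⟩
        exact ⟨p a, rfl⟩
    rw [this, Submodule.span_eq]
  rw [hrange]
  have hzero : (0 : D) ∈ Set.range ι := ⟨0, map_zero _⟩
  have hker : ∀ ρ : HilbertRep D, Set.range ι ⊆ {a | ρ.π a = 0} →
      {a : D | ∀ b ∈ Set.range ι, a * b = 0 ∧ b * a = 0} ⊆ {a | ρ.π a = 0} →
      ∀ a, T a = 0 → ρ.π a = 0 := by
    intro ρ h1 h2 a ha
    have ha' : a ∈ {a : D | τ (p a) = 0} := ha
    rw [hBusby] at ha'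
    have hcl : IsClosed {a | ρ.π a = 0} := isClosed_eq (aux_continuous ρ.π) continuous_const
    refine closure_minimal ?_ hcl ha'
    rintro _ ⟨x, hx, y, hy, rfl⟩
    have e1 : ρ.π x = 0 := h1 hx
    have e2 : ρ.π y = 0 := h2 hy
    show ρ.π (x + y) = 0
    rw [map_add, e1, e2, add_zero]
  have hIT : ∀ a ∈ Set.range ι, T a = 0 := by
    intro a ha
    have : a ∈ {a : D | τ (p a) = 0} := by
      rw [hBusby]
      exact subset_closure ⟨a, ha, 0, by simp, add_zero a⟩
    exact this
  have hIpT : ∀ a, (∀ b ∈ Set.range ι, a * b = 0 ∧ b * a = 0) → T a = 0 := by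
    intro a ha
    have : a ∈ {a : D | τ (p a) = 0} := by
      rw [hBusby]
      exact subset_closure ⟨0, hzero, a, ha, zero_add a⟩
    exact this
  have hfrK : ∀ J ∈ frontier P, ∀ a, T a = 0 → a ∈ J.1 := by
    intro J hJ a ha
    obtain ⟨hJcl, hIJ⟩ := (hfr J).1 hJ
    obtain ⟨ρ, hρ, hJρ⟩ := J.2
    rw [hJρ]
    refine hker ρ (hJρ ▸ hIJ) ?_ a ha
    rw [← hJρ]
    by_contra hcon
    obtain ⟨J', hJ'1, hJ'2⟩ := mem_closure_iff.1 hJcl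
      {J : PrimSpace D | ¬ {a : D | ∀ b ∈ Set.range ι, a * b = 0 ∧ b * a = 0} ⊆ J.1}
      (aux_isOpen _) hcon
    obtain ⟨σ, hσ, hJσ⟩ := J'.2
    obtain ⟨y, hy, hyJ⟩ := Set.not_subset.1 hJ'1
    obtain ⟨x, hx, hxJ⟩ := Set.not_subset.1 hJ'2
    rw [hJσ] at hyJ hxJ
    obtain ⟨z, hz⟩ := aux_prime σ hσ x y hxJ hyJ
    apply hz
    rw [(hy _ (hιideal z x hx).2).2, map_zero]
  constructor
  · intro hfin
    have hfd : ∀ J : frontier P, ∃ ρ : HilbertRep D, J.1.1 = {a | ρ.π a = 0} ∧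
        FiniteDimensional ℂ ρ.carrier := by
      intro J
      obtain ⟨ρ, hρ, hJρ⟩ := J.1.2
      refine ⟨ρ, hJρ, ?_⟩
      refine aux_finiteDim ρ N hρ ?_
      intro h hh s hs hs0
      refine aux_spec_card N P ?_ J.1 ((hfr J.1).1 J.2).1 ρ hJρ h hh s hs hs0
      intro J' hJ'
      obtain ⟨σ, hσ, hJσ⟩ := J'.2
      refine ⟨σ, hJσ, ?_⟩
      refine hsub (σ.pull ι) (aux_restrict σ hσ ι ?_ ?_ ?_)
      · intro d e
        exact (hιideal d (ι e) ⟨e, rfl⟩).1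
      · intro d e
        exact (hιideal d (ι e) ⟨e, rfl⟩).2
      · obtain ⟨x, ⟨e, rfl⟩, hxJ⟩ := Set.not_subset.1 hJ'
        rw [hJσ] at hxJ
        exact ⟨e, hxJ⟩
    choose ρ hρ hρfd using hfd
    have : Finite (frontier P) := hfin
    let Φ : D →ₗ[ℂ] ((J : frontier P) → ((ρ J).carrier →L[ℂ] (ρ J).carrier)) :=
      { toFun := fun a J => (ρ J).π a
        map_add' := fun x y => by ext J; simp
        map_smul' := fun r x => by ext J; simp }
    have hfdJ : ∀ J, FiniteDimensional ℂ ((ρ J).carrier →L[ℂ] (ρ J).carrier) := fun J =>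
      have := hρfd J
      inferInstance
    have hΦfd : FiniteDimensional ℂ
      ((J : frontier P) → ((ρ J).carrier →L[ℂ] (ρ J).carrier)) := inferInstance
    have hle : LinearMap.ker Φ ≤ LinearMap.ker T := by
      intro a ha
      by_contra hTa
      have hTa' : τ (p a) ≠ 0 := hTa
      let f : D →⋆ₙₐ[ℂ] Q := τ.comp p
      obtain ⟨C, iC, j, hjd, hj0⟩ := aux_closure f
      obtain ⟨θ, hθ, hθa⟩ := aux_irrep (j a) (fun h => hTa' ((hj0 a).1 h))
      have hirr := aux_dense θ hθ j hjd
      have hTθ : ∀ x, T x = 0 → (θ.pull j).π x = 0 := by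
        intro x hx
        rw [HilbertRep.pull_apply]
        have : j x = 0 := (hj0 x).2 hx
        rw [this]
        exact map_zero θ.π
      let J : PrimSpace D := ⟨{x | (θ.pull j).π x = 0}, θ.pull j, hirr, rfl⟩
      have hJ : J ∈ frontier P := by
        rw [hfr]
        refine ⟨?_, fun x hx => hTθ x (hIT x hx)⟩
        rw [mem_closure_iff]
        intro U hU hJU
        obtain ⟨x, hxJ, hxU⟩ := aux_open_nhd J U hU hJU
        have hne : ∃ b ∈ Set.range ι, ¬ (x * b = 0 ∧ b * x = 0) := by
          by_contra! hcon
          exact hxJ (hTθ x (hIpT x (fun b hb => by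
            have := hcon b hb
            tauto)))
        obtain ⟨b, hb, hxb⟩ := hne
        have : ∃ σ : HilbertRep D, σ.IsIrreducible ∧ σ.π x ≠ 0 ∧ σ.π b ≠ 0 := by
          by_cases h1 : x * b = 0
          · obtain ⟨σ, hσ, hσ'⟩ := aux_irrep (b * x) (fun h2 => hxb ⟨h1, h2⟩)
            refine ⟨σ, hσ, ?_, ?_⟩ <;> intro h <;> apply hσ' <;> simp [h]
          · obtain ⟨σ, hσ, hσ'⟩ := aux_irrep (x * b) h1
            refine ⟨σ, hσ, ?_, ?_⟩ <;> intro h <;> apply hσ' <;> simp [h]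
        obtain ⟨σ, hσ, hσx, hσb⟩ := this
        exact ⟨⟨{x | σ.π x = 0}, σ, hσ, rfl⟩, hxU _ hσx, fun h => hσb (h hb)⟩
      have haJ : a ∈ J.1 := by
        have h1 : a ∈ (⟨J, hJ⟩ : frontier P).1.1 := by
          rw [hρ ⟨J, hJ⟩]
          exact congrFun ha ⟨J, hJ⟩
        exact h1
      exact hθa haJ
    have h1 : FiniteDimensional ℂ (LinearMap.range Φ) := inferInstance
    have h2 : FiniteDimensional ℂ (D ⧸ LinearMap.ker Φ) :=
      Module.Finite.equiv Φ.quotKerEquivRange.symm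
    have h3 : FiniteDimensional ℂ (D ⧸ LinearMap.ker T) :=
      Module.Finite.of_surjective (Submodule.factor hle) (Submodule.factor_surjective hle)
    exact Module.Finite.equiv T.quotKerEquivRange
  · intro hfd
    have h3 : FiniteDimensional ℂ (D ⧸ LinearMap.ker T) :=
      Module.Finite.equiv T.quotKerEquivRange.symm
    let S : Set (Submodule ℂ D) := {M | ∃ J ∈ frontier P, (M : Set D) = J.1}
    have hS : S.Finite := by
      refine aux_finite_primes (LinearMap.ker T) S ?_ ?_ ?_ ?_
      · rintro M ⟨J, hJ, hM⟩ a ha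
        have := hfrK J hJ a ha
        rwa [← hM] at this
      · rintro M ⟨J, hJ, hM⟩ a b hb
        obtain ⟨ρ, hρ, hJρ⟩ := J.2
        have hm : ∀ x, x ∈ M ↔ ρ.π x = 0 := by
          intro x; rw [← SetLike.mem_coe, hM, hJρ]; rfl
        rw [hm] at hb ⊢
        rw [map_mul, hb, mul_zero]
      · rintro M ⟨J, hJ, hM⟩ a b hb
        obtain ⟨ρ, hρ, hJρ⟩ := J.2
        have hm : ∀ x, x ∈ M ↔ ρ.π x = 0 := by
          intro x; rw [← SetLike.mem_coe, hM, hJρ]; rfl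
        rw [hm] at hb ⊢
        rw [map_mul, hb, zero_mul]
      · rintro M ⟨J, hJ, hM⟩ a b ha hb
        obtain ⟨ρ, hρ, hJρ⟩ := J.2
        have hm : ∀ x, x ∈ M ↔ ρ.π x = 0 := by
          intro x; rw [← SetLike.mem_coe, hM, hJρ]; rfl
        rw [hm] at ha hb
        obtain ⟨x, hx⟩ := aux_prime ρ hρ a b ha hb
        exact ⟨x, by rwa [hm]⟩
    refine Set.Finite.of_finite_image (f := fun J : PrimSpace D => J.1)
      ((hS.image fun M : Submodule ℂ D => (M : Set D)).subset ?_) (fun x _ y _ h => Subtype.ext h)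
    rintro _ ⟨J, hJ, rfl⟩
    obtain ⟨ρ, hρ, hJρ⟩ := J.2
    let M : Submodule ℂ D :=
      { carrier := {a | ρ.π a = 0}
        add_mem' := fun {x y} hx hy => by
          have hx' : ρ.π x = 0 := hx
          have hy' : ρ.π y = 0 := hy
          show ρ.π (x + y) = 0
          rw [map_add, hx', hy', add_zero]
        zero_mem' := map_zero ρ.π
        smul_mem' := fun c x hx => by
          have hx' : ρ.π x = 0 := hx
          show ρ.π (c • x) = 0
          rw [map_smul, hx', smul_zero] }
    exact ⟨M, ⟨J, hJ, hJρ.symm⟩, hJρ.symm⟩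

end Main


/-- Let `0 → I → A → B → 0` be an extension of C*-algebras with `I`
`N`-subhomogeneous, and let `τ : B → M(I)/I` be the Busby map (characterized
here by its defining property `ker (τ ∘ p) = closure (I + I⊥)`).  Then the
boundary of `Prim(I)` in `Prim(A)` is finite if and only if `τ(B)` is a
finite-dimensional C*-algebra. -/
theorem finite_boundary_iff_busbyImage_finiteDimensional
    (N : ℕ)
    {I B Q : Type}
    [NonUnitalNormedRing I] [StarRing I] [CStarRing I] [NormedSpace ℂ I]
    [IsScalarTower ℂ I I] [SMulCommClass ℂ I I] [StarModule ℂ I] [CompleteSpace I]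
    [NonUnitalNormedRing B] [StarRing B] [CStarRing B] [NormedSpace ℂ B]
    [IsScalarTower ℂ B B] [SMulCommClass ℂ B B] [StarModule ℂ B] [CompleteSpace B]
    [NonUnitalNormedRing Q] [StarRing Q] [CStarRing Q] [NormedSpace ℂ Q]
    [IsScalarTower ℂ Q Q] [SMulCommClass ℂ Q Q] [StarModule ℂ Q] [CompleteSpace Q]
    (ι : I →⋆ₙₐ[ℂ] A) (hιinj : Function.Injective ι)
    (hιiso : Isometry ι)
    (hιideal : ∀ a : A, ∀ i ∈ Set.range ι, a * i ∈ Set.range ι ∧ i * a ∈ Set.range ι)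
    (hιclosed : IsClosed (Set.range ι))
    (p : A →⋆ₙₐ[ℂ] B) (hpsurj : Function.Surjective p)
    (hexact : Set.range ι = {a : A | p a = 0})
    (hsub : ∀ ρ : HilbertRep I, ρ.IsIrreducible → Module.rank ℂ ρ.carrier ≤ N)
    (τ : B →⋆ₙₐ[ℂ] Q)
    (hBusby : {a : A | τ (p a) = 0} =
      closure (Set.range ι +
        {a : A | ∀ b ∈ Set.range ι, a * b = 0 ∧ b * a = 0})) :
    (frontier {J : PrimSpace A | ¬ Set.range ι ⊆ J.1}).Finite ↔
      FiniteDimensional ℂ ↥(Submodule.span ℂ (Set.range τ)) := by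
  letI : NonUnitalCStarAlgebra A := {}
  letI : NonUnitalCStarAlgebra I := {}
  letI : NonUnitalCStarAlgebra B := {}
  letI : NonUnitalCStarAlgebra Q := {}
  exact aux_main N ι hιideal p hpsurj hsub τ hBusby
end
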